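/- arXiv:1205.3957 — 4 statements merged into one kernel-verified Lean document; each statement's English description precedes it below -/
import Mathlib

section
/- Let 0 < σ < 1, α ≥ −1/2 and β > −1/2. Then for all θ, φ ∈ (0, π) with θ ≠ φ, the Jacobi fractional integral kernel satisfies 0 ≤ K_σ^{α,β}(θ,φ) and there exists a constant C_σ > 0, depending only on σ (and not on α or β), such that K_σ^{α,β}(θ,φ) ≤ C_σ · (sin(θ/2) sin(φ/2))^{−(α+1/2)} (cos(θ/2) cos(φ/2))^{−(β+1/2)} · ( 1/(β+1/2) + 1/|sin((θ−φ)/4)|^{1−σ} ). -/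
open MeasureTheory Real Set

/-- The measure `Π_γ` on `[-1,1]`: for `γ > -1/2` it has density
`Γ(γ+1)/(√π Γ(γ+1/2)) (1-u²)^{γ-1/2}`; for `γ = -1/2` it is `(δ_{-1}+δ_1)/2`. -/
noncomputable def jacobiPiMeasure (γ : ℝ) : Measure ℝ :=
  if γ = -(1/2) then (2 : ENNReal)⁻¹ • (Measure.dirac (-1) + Measure.dirac 1)
  else (volume.restrict (Icc (-1 : ℝ) 1)).withDensity
    (fun u => ENNReal.ofReal (Real.Gamma (γ + 1) / (Real.sqrt π * Real.Gamma (γ + 1/2)) *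
      (1 - u ^ 2) ^ (γ - 1/2)))

/-- `z(u,v,θ,φ) = u sin(θ/2) sin(φ/2) + v cos(θ/2) cos(φ/2)`. -/
noncomputable def zAux (u v θ φ : ℝ) : ℝ :=
  u * Real.sin (θ/2) * Real.sin (φ/2) + v * Real.cos (θ/2) * Real.cos (φ/2)

/-- The Jacobi–Poisson kernel `P_t^{α,β}(θ,φ)`. -/
noncomputable def jacobiPoissonKernel (α β t θ φ : ℝ) : ℝ :=
  Real.Gamma (α + β + 2) / (Real.Gamma (α + 1) * Real.Gamma (β + 1)) *
    ∫ v, ∫ u, (Real.exp (-t * (α + β + 1) / 2) * (1 - Real.exp (-t))) /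
      ((1 - Real.exp (-t/2)) ^ 2 + 2 * Real.exp (-t/2) * (1 - zAux u v θ φ)) ^ (α + β + 2)
      ∂(jacobiPiMeasure α) ∂(jacobiPiMeasure β)

/-- The Jacobi fractional integral kernel `K_σ^{α,β}(θ,φ) = (1/Γ(σ)) ∫_0^∞ P_t^{α,β}(θ,φ) t^{σ-1} dt`. -/
noncomputable def jacobiFracKernel (σ α β θ φ : ℝ) : ℝ :=
  (1 / Real.Gamma σ) * ∫ t in Ioi (0:ℝ), jacobiPoissonKernel α β t θ φ * t ^ (σ - 1)

lemma jk_gamma_lint (a r : ℝ) (ha : 0 < a) (hr : 0 < r) :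
    ∫⁻ t in Ioi (0:ℝ), ENNReal.ofReal (t^(a-1) * Real.exp (-(r*t)))
      = ENNReal.ofReal ((1/r)^a * Real.Gamma a) := by
  have h := Real.integral_rpow_mul_exp_neg_mul_Ioi ha hr
  have hpos : 0 < (1/r)^a * Real.Gamma a :=
    mul_pos (Real.rpow_pos_of_pos (by positivity) _) (Real.Gamma_pos_of_pos ha)
  have hint : Integrable (fun t : ℝ => t^(a-1) * Real.exp (-(r*t))) (volume.restrict (Ioi 0)) := by
    by_contra hc
    rw [integral_undef hc] at h
    linarith
  rw [← h, ofReal_integral_eq_lintegral_ofReal hint]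
  filter_upwards [self_mem_ae_restrict measurableSet_Ioi] with t ht
  have ht : 0 < t := ht
  simp only [Pi.zero_apply]
  positivity

lemma jk_beta_lint (s q k B : ℝ) (hs : 0 < s) (hq : 0 < q) (hk : 0 < k) (hB : 0 < B) :
    ∫⁻ w in Ioi (0:ℝ), ENNReal.ofReal (w^(s-1) * (B+k*w)^(-(s+q)))
      = ENNReal.ofReal (Real.Gamma s * Real.Gamma q / Real.Gamma (s+q) * k^(-s) * B^(-q)) := by
  have hG := Real.Gamma_pos_of_pos (add_pos hs hq)
  have hGs := Real.Gamma_pos_of_pos hs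
  have hGq := Real.Gamma_pos_of_pos hq
  have e1 : ∀ w ∈ Ioi (0:ℝ), ENNReal.ofReal (w^(s-1) * (B+k*w)^(-(s+q))) =
      ∫⁻ x in Ioi (0:ℝ), ENNReal.ofReal (1/Real.Gamma (s+q)) * ENNReal.ofReal (w^(s-1) *
        (x^(s+q-1) * Real.exp (-((B+k*w)*x)))) := by
    intro w hw
    have hw : 0 < w := hw
    have hb : 0 < B + k*w := by positivity
    have : ∀ x : ℝ, ENNReal.ofReal (1/Real.Gamma (s+q)) * ENNReal.ofReal (w^(s-1) *
        (x^(s+q-1) * Real.exp (-((B+k*w)*x)))) = ENNReal.ofReal (w^(s-1)/Real.Gamma (s+q)) *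
        ENNReal.ofReal (x^(s+q-1) * Real.exp (-((B+k*w)*x))) := by
      intro x
      rw [← ENNReal.ofReal_mul (by positivity), ← ENNReal.ofReal_mul (by positivity)]
      congr 1; ring
    simp_rw [this]
    rw [lintegral_const_mul _ (by fun_prop), jk_gamma_lint _ _ (add_pos hs hq) hb,
      ← ENNReal.ofReal_mul (by positivity), Real.rpow_neg hb.le, one_div, Real.inv_rpow hb.le]
    congr 1; field_simp
  rw [setLIntegral_congr_fun measurableSet_Ioi e1, lintegral_lintegral_swap (by fun_prop)]
  have e2 : ∀ x ∈ Ioi (0:ℝ), (∫⁻ w in Ioi (0:ℝ), ENNReal.ofReal (1/Real.Gamma (s+q)) *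
        ENNReal.ofReal (w^(s-1) * (x^(s+q-1) * Real.exp (-((B+k*w)*x))))) =
      ENNReal.ofReal (Real.Gamma s / Real.Gamma (s+q) * k^(-s)) *
        ENNReal.ofReal (x^(q-1) * Real.exp (-(B*x))) := by
    intro x hx
    have hx : 0 < x := hx
    have : ∀ w : ℝ, ENNReal.ofReal (1/Real.Gamma (s+q)) * ENNReal.ofReal (w^(s-1) *
        (x^(s+q-1) * Real.exp (-((B+k*w)*x)))) =
        ENNReal.ofReal (1/Real.Gamma (s+q) * x^(s+q-1) * Real.exp (-(B*x))) *
        ENNReal.ofReal (w^(s-1) * Real.exp (-((k*x)*w))) := by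
      intro w
      rw [← ENNReal.ofReal_mul (by positivity), ← ENNReal.ofReal_mul (by positivity)]
      congr 1
      rw [show -((B+k*w)*x) = -(B*x) + -((k*x)*w) by ring, Real.exp_add]; ring
    simp_rw [this]
    rw [lintegral_const_mul _ (by fun_prop), jk_gamma_lint _ _ hs (by positivity),
      ← ENNReal.ofReal_mul (by positivity), ← ENNReal.ofReal_mul (by positivity)]
    congr 1
    rw [one_div (k*x), Real.inv_rpow (by positivity), Real.mul_rpow hk.le hx.le,
      Real.rpow_neg hk.le, show s+q-1 = s + (q-1) by ring, Real.rpow_add hx]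
    field_simp
  rw [setLIntegral_congr_fun measurableSet_Ioi e2, lintegral_const_mul _ (by fun_prop),
    jk_gamma_lint _ _ hq hB, ← ENNReal.ofReal_mul (by positivity)]
  congr 1
  rw [one_div B, Real.inv_rpow hB.le, Real.rpow_neg hB.le]
  field_simp

lemma jk_pi_ae (γ : ℝ) : ∀ᵐ u ∂(jacobiPiMeasure γ), u ∈ Icc (-1:ℝ) 1 := by
  unfold jacobiPiMeasure
  split_ifs with h
  · refine Measure.ae_smul_measure ?_ _
    rw [ae_add_measure_iff]
    constructor <;> refine (ae_dirac_iff (p := fun x => x ∈ Icc (-1:ℝ) 1) measurableSet_Icc).2 ?_ <;> norm_num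
  · exact (withDensity_absolutelyContinuous _ _).ae_le (self_mem_ae_restrict measurableSet_Icc)

lemma jk_pi_lint (γ k B q : ℝ) (hγ : -(1/2) ≤ γ) (hk : 0 < k) (hB : 0 < B) (hq : 0 < q) :
    ∫⁻ u, ENNReal.ofReal ((B + 2*k*(1-u))^(-(γ+1/2+q))) ∂(jacobiPiMeasure γ) ≤
      ENNReal.ofReal (2/Real.sqrt π * k^(-(γ+1/2)) * B^(-q) *
        (Real.Gamma (γ+1) * Real.Gamma q / Real.Gamma (γ+1/2+q))) := by
  unfold jacobiPiMeasure
  split_ifs with h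
  · subst h
    have hG := Real.Gamma_pos_of_pos hq
    rw [lintegral_smul_measure, lintegral_add_measure, lintegral_dirac, lintegral_dirac]
    have hb : ((B + 2*k*(1-(-1)))^(-(-(1/2)+1/2+q)) : ℝ) ≤ B^(-q) := by
      rw [show (-(-(1/2)+1/2+q) : ℝ) = -q by ring]
      exact Real.rpow_le_rpow_of_nonpos hB (by linarith) (by linarith)
    have e : (2/Real.sqrt π * k^(-(-(1/2)+1/2:ℝ)) * B^(-q) *
        (Real.Gamma (-(1/2)+1) * Real.Gamma q / Real.Gamma (-(1/2)+1/2+q))) = 2 * B^(-q) := by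
      rw [show (-(1/2)+1/2+q : ℝ) = q by ring, show (-(-(1/2)+1/2:ℝ)) = 0 by ring,
        show (-(1/2)+1:ℝ) = 1/2 by ring, Real.Gamma_one_half_eq, Real.rpow_zero]
      have : 0 < Real.sqrt π := Real.sqrt_pos.mpr Real.pi_pos
      field_simp
    rw [e]
    have h1 : ((B + 2*k*(1-1))^(-(-(1/2)+1/2+q)) : ℝ) = B^(-q) := by
      congr 1 <;> ring
    rw [h1, ← ENNReal.ofReal_add (by positivity) (by positivity)]
    have h2 : (2:ENNReal)⁻¹ = ENNReal.ofReal (1/2) := by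
      rw [one_div, ENNReal.ofReal_inv_of_pos (by norm_num)]; simp
    rw [h2, smul_eq_mul, ← ENNReal.ofReal_mul (by norm_num)]
    apply ENNReal.ofReal_le_ofReal
    have : 0 < B^(-q) := by positivity
    linarith
  · have hs : 0 < γ + 1/2 := by
      rcases lt_or_eq_of_le hγ with h' | h'
      · linarith
      · exact absurd h'.symm h
    have hGs := Real.Gamma_pos_of_pos hs
    have hGq := Real.Gamma_pos_of_pos hq
    have hG1 := Real.Gamma_pos_of_pos (show 0 < γ+1 by linarith)
    have hGsq := Real.Gamma_pos_of_pos (add_pos hs hq)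
    have hpi : 0 < Real.sqrt π := Real.sqrt_pos.mpr Real.pi_pos
    set c := Real.Gamma (γ + 1) / (Real.sqrt π * Real.Gamma (γ + 1/2)) with hc
    have hcpos : 0 < c := by positivity
    rw [lintegral_withDensity_eq_lintegral_mul _ (by fun_prop) (by fun_prop)]
    set F : ℝ → ENNReal := fun u => ENNReal.ofReal (c * (1-u^2)^(γ-1/2)) *
      ENNReal.ofReal ((B + 2*k*(1-u))^(-(γ+1/2+q))) with hF
    have hFm : Measurable F := by rw [hF]; fun_prop
    change ∫⁻ u in Icc (-1:ℝ) 1, F u ≤ _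
    set H : ℝ → ENNReal := (Icc (0:ℝ) 1).indicator F with hH
    have hHm : Measurable H := hFm.indicator measurableSet_Icc
    set M : ℝ → ENNReal := fun w => ENNReal.ofReal (c * 2^(γ+1/2)) *
      ENNReal.ofReal (w^(γ+1/2-1) * (B+(2*k)*w)^(-(γ+1/2+q))) with hM
    have step1 : ∫⁻ u in Icc (-1:ℝ) 1, F u ≤ ∫⁻ u, (H u + H (-u)) := by
      rw [← lintegral_indicator measurableSet_Icc]
      apply lintegral_mono
      intro u
      by_cases hu : u ∈ Icc (-1:ℝ) 1
      · simp only [Set.indicator_of_mem hu]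
        by_cases h0 : 0 ≤ u
        · have : H u = F u := Set.indicator_of_mem (show u ∈ Icc (0:ℝ) 1 from ⟨h0, hu.2⟩) _
          rw [this]; exact le_self_add
        · push Not at h0
          have : H (-u) = F (-u) := Set.indicator_of_mem
            (show -u ∈ Icc (0:ℝ) 1 from ⟨by linarith, by linarith [hu.1]⟩) _
          rw [this]
          refine le_trans ?_ le_add_self
          simp only [hF, neg_sq]
          gcongr 1
          apply ENNReal.ofReal_le_ofReal
          refine Real.rpow_le_rpow_of_nonpos ?_ ?_ (by linarith)
          · have := hu.1
            have : 0 ≤ 2*k*(1 - -u) := mul_nonneg (by linarith) (by linarith)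
            linarith
          · nlinarith
      · simp only [Set.indicator_of_notMem hu]; exact zero_le
    have step2 : ∫⁻ u, H u ≤ ∫⁻ w in Ioi (0:ℝ), M w := by
      rw [← lintegral_sub_left_eq_self H 1, setLIntegral_congr Ioi_ae_eq_Ici,
        ← lintegral_indicator measurableSet_Ici]
      apply lintegral_mono
      intro w
      by_cases hw : 1 - w ∈ Icc (0:ℝ) 1
      · have e : H (1-w) = F (1-w) := Set.indicator_of_mem hw _
        have hw0 : 0 ≤ w := by linarith [hw.2]
        have hw1 : w ≤ 1 := by linarith [hw.1]
        have e' : (Ici (0:ℝ)).indicator M w = M w := Set.indicator_of_mem hw0 _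
        change H (1-w) ≤ _
        rw [e, e']
        simp only [hF, hM]
        have hbase : 0 ≤ B + 2*k*w := by positivity
        rw [← ENNReal.ofReal_mul (mul_nonneg hcpos.le (Real.rpow_nonneg (by nlinarith) _)),
          ← ENNReal.ofReal_mul (by positivity)]
        apply ENNReal.ofReal_le_ofReal
        rw [show 1-(1-w)^2 = w*(2-w) by ring, show 1-(1-w) = w by ring,
          Real.mul_rpow hw0 (by linarith), show γ+1/2-1 = γ-1/2 by ring]
        have key : (2-w)^(γ-1/2) ≤ (2:ℝ)^(γ+1/2) := by
          rcases le_total 0 (γ-1/2) with h' | h'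
          · calc (2-w)^(γ-1/2) ≤ 2^(γ-1/2) := Real.rpow_le_rpow (by linarith) (by linarith) h'
              _ ≤ 2^(γ+1/2) := Real.rpow_le_rpow_of_exponent_le (by norm_num) (by linarith)
          · calc (2-w)^(γ-1/2) ≤ 1 := Real.rpow_le_one_of_one_le_of_nonpos (by linarith) h'
              _ ≤ 2^(γ+1/2) := Real.one_le_rpow (by norm_num) hs.le
        calc c * (w^(γ-1/2) * (2-w)^(γ-1/2)) * (B+2*k*w)^(-(γ+1/2+q))
            ≤ c * (w^(γ-1/2) * 2^(γ+1/2)) * (B+2*k*w)^(-(γ+1/2+q)) := by gcongr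
          _ = _ := by ring
      · have e : H (1-w) = 0 := Set.indicator_of_notMem hw _
        change H (1-w) ≤ _
        rw [e]; exact zero_le
    have step3 : ∫⁻ w in Ioi (0:ℝ), M w = ENNReal.ofReal (1/Real.sqrt π * k^(-(γ+1/2)) * B^(-q) *
        (Real.Gamma (γ+1) * Real.Gamma q / Real.Gamma (γ+1/2+q))) := by
      simp only [hM]
      rw [lintegral_const_mul _ (by fun_prop), jk_beta_lint _ _ _ _ hs hq (by positivity) hB,
        ← ENNReal.ofReal_mul (by positivity)]
      congr 1
      rw [Real.mul_rpow (by norm_num) hk.le, Real.rpow_neg (by norm_num : (0:ℝ) ≤ 2), hc]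
      generalize Real.Gamma (γ+1/2) = g1 at *
      generalize Real.Gamma (γ+1/2+q) = g2 at *
      field_simp
    have step4 : ∫⁻ u, (H u + H (-u)) = 2 * ∫⁻ u, H u := by
      rw [lintegral_add_left hHm, lintegral_neg_eq_self, two_mul]
    refine step1.trans ?_
    rw [step4]
    refine (mul_le_mul_right step2 2).trans ?_
    rw [step3, show (2:ENNReal) = ENNReal.ofReal 2 by simp, ← ENNReal.ofReal_mul (by norm_num)]
    apply le_of_eq
    congr 1; ring

lemma jk_pi_int (γ k B q : ℝ) (hγ : -(1/2) ≤ γ) (hk : 0 < k) (hB : 0 < B) (hq : 0 < q) :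
    Integrable (fun u => (B + 2*k*(1-u))^(-(γ+1/2+q))) (jacobiPiMeasure γ) ∧
    ∫ u, (B + 2*k*(1-u))^(-(γ+1/2+q)) ∂(jacobiPiMeasure γ) ≤
      (2/Real.sqrt π * k^(-(γ+1/2)) * B^(-q) *
        (Real.Gamma (γ+1) * Real.Gamma q / Real.Gamma (γ+1/2+q))) := by
  have h := jk_pi_lint γ k B q hγ hk hB hq
  have hm : Measurable (fun u => (B + 2*k*(1-u))^(-(γ+1/2+q))) := by fun_prop
  have h0 : 0 ≤ᵐ[jacobiPiMeasure γ] (fun u => (B + 2*k*(1-u))^(-(γ+1/2+q))) := by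
    filter_upwards [jk_pi_ae γ] with u hu
    apply Real.rpow_nonneg
    have : 0 ≤ 2*k*(1-u) := mul_nonneg (by linarith) (by linarith [hu.2])
    linarith
  have hGq := Real.Gamma_pos_of_pos hq
  have hG1 := Real.Gamma_pos_of_pos (show 0 < γ+1 by linarith)
  have hGsq := Real.Gamma_pos_of_pos (show 0 < γ+1/2+q by linarith)
  constructor
  · refine ⟨hm.aestronglyMeasurable, ?_⟩
    rw [hasFiniteIntegral_iff_ofReal h0]
    exact h.trans_lt ENNReal.ofReal_lt_top
  · rw [integral_eq_lintegral_of_nonneg_ae h0 hm.aestronglyMeasurable]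
    exact ENNReal.toReal_le_of_le_ofReal (by positivity) h

lemma jk_double (α β A a b c : ℝ) (hα : -(1/2) ≤ α) (hβ : -(1/2) < β) (hA : 0 < A)
    (ha : 0 < a) (hb : 0 < b) (hc : 0 ≤ c) (g : ℝ → ℝ → ℝ)
    (hg : ∀ u ∈ Icc (-1:ℝ) 1, ∀ v ∈ Icc (-1:ℝ) 1, 0 ≤ g u v ∧
      g u v ≤ c * (A + 2*b*(1-v) + 2*a*(1-u))^(-(α+β+2))) :
    0 ≤ Real.Gamma (α + β + 2) / (Real.Gamma (α + 1) * Real.Gamma (β + 1)) *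
      (∫ v, ∫ u, g u v ∂(jacobiPiMeasure α) ∂(jacobiPiMeasure β)) ∧
    Real.Gamma (α + β + 2) / (Real.Gamma (α + 1) * Real.Gamma (β + 1)) *
      (∫ v, ∫ u, g u v ∂(jacobiPiMeasure α) ∂(jacobiPiMeasure β)) ≤
      c * (4/π) * a^(-(α+1/2)) * b^(-(β+1/2)) / A := by
  have G1 := Real.Gamma_pos_of_pos (show 0 < α+β+2 by linarith)
  have G2 := Real.Gamma_pos_of_pos (show 0 < α+1 by linarith)
  have G3 := Real.Gamma_pos_of_pos (show 0 < β+1 by linarith)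
  have G4 := Real.Gamma_pos_of_pos (show 0 < β+1/2+1 by linarith)
  have hpi : 0 < Real.sqrt π := Real.sqrt_pos.mpr Real.pi_pos
  have hin0 : ∀ v ∈ Icc (-1:ℝ) 1, 0 ≤ ∫ u, g u v ∂(jacobiPiMeasure α) := by
    intro v hv
    apply integral_nonneg_of_ae
    filter_upwards [jk_pi_ae α] with u hu using (hg u hu v hv).1
  have hout0 : 0 ≤ᵐ[jacobiPiMeasure β] fun v => ∫ u, g u v ∂(jacobiPiMeasure α) := by
    filter_upwards [jk_pi_ae β] with v hv using hin0 v hv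
  refine ⟨mul_nonneg (by positivity) (integral_nonneg_of_ae hout0), ?_⟩
  set c1 := c * (2/Real.sqrt π * a^(-(α+1/2)) *
        (Real.Gamma (α+1) * Real.Gamma (β+1/2+1) / Real.Gamma (α+β+2))) with hc1
  have hc1p : 0 ≤ c1 := by positivity
  have hin : ∀ v ∈ Icc (-1:ℝ) 1, ∫ u, g u v ∂(jacobiPiMeasure α) ≤
      c1 * (A + 2*b*(1-v))^(-(β+1/2+1)) := by
    intro v hv
    have hB : 0 < A + 2*b*(1-v) := by
      have : 0 ≤ 2*b*(1-v) := mul_nonneg (by linarith) (by linarith [hv.2])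
      linarith
    obtain ⟨hi, hle⟩ := jk_pi_int α a (A + 2*b*(1-v)) (β+1/2+1) hα ha hB (by linarith)
    rw [show α+1/2+(β+1/2+1) = α+β+2 by ring] at hi hle
    calc ∫ u, g u v ∂(jacobiPiMeasure α) ≤
        ∫ u, c * (A + 2*b*(1-v) + 2*a*(1-u))^(-(α+β+2)) ∂(jacobiPiMeasure α) := by
          apply integral_mono_of_nonneg
          · filter_upwards [jk_pi_ae α] with u hu using (hg u hu v hv).1
          · exact hi.const_mul c
          · filter_upwards [jk_pi_ae α] with u hu using (hg u hu v hv).2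
      _ = c * ∫ u, (A + 2*b*(1-v) + 2*a*(1-u))^(-(α+β+2)) ∂(jacobiPiMeasure α) :=
          integral_const_mul _ _
      _ ≤ _ := mul_le_mul_of_nonneg_left hle hc
      _ = _ := by rw [hc1]; ring
  obtain ⟨hi, hle⟩ := jk_pi_int β b A 1 hβ.le hb hA one_pos
  have hout : ∫ v, ∫ u, g u v ∂(jacobiPiMeasure α) ∂(jacobiPiMeasure β) ≤
      c1 * (2/Real.sqrt π * b^(-(β+1/2)) * A^(-(1:ℝ)) *
        (Real.Gamma (β+1) * Real.Gamma 1 / Real.Gamma (β+1/2+1))) := by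
    calc _ ≤ ∫ v, c1 * (A + 2*b*(1-v))^(-(β+1/2+1)) ∂(jacobiPiMeasure β) := by
          apply integral_mono_of_nonneg hout0 (hi.const_mul c1)
          filter_upwards [jk_pi_ae β] with v hv using hin v hv
      _ = c1 * ∫ v, (A + 2*b*(1-v))^(-(β+1/2+1)) ∂(jacobiPiMeasure β) :=
          integral_const_mul _ _
      _ ≤ _ := mul_le_mul_of_nonneg_left hle hc1p
  refine (mul_le_mul_of_nonneg_left hout (by positivity)).trans (le_of_eq ?_)
  rw [hc1, Real.Gamma_one, Real.rpow_neg_one]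
  have hsq : Real.sqrt π ^ 2 = π := Real.sq_sqrt Real.pi_pos.le
  have hp := Real.pi_pos
  generalize Real.Gamma (β+1/2+1) = g1 at *
  generalize a^(-(α+1/2)) = X
  generalize b^(-(β+1/2)) = Y
  field_simp
  try rw [hsq]
  try ring

lemma jk_z_eq (u v θ φ r : ℝ) :
    (1 - r) ^ 2 + 2 * r * (1 - zAux u v θ φ) =
      ((1-r)^2 + 4*r*(Real.sin ((θ-φ)/4))^2) + 2*(r*(Real.cos (θ/2) * Real.cos (φ/2)))*(1-v)
        + 2*(r*(Real.sin (θ/2) * Real.sin (φ/2)))*(1-u) := by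
  have h1 : Real.cos ((θ-φ)/2) =
      Real.cos (θ/2) * Real.cos (φ/2) + Real.sin (θ/2) * Real.sin (φ/2) := by
    rw [show (θ-φ)/2 = θ/2 - φ/2 by ring, Real.cos_sub]
  have h2 : Real.cos ((θ-φ)/2) = 1 - 2*(Real.sin ((θ-φ)/4))^2 := by
    rw [show (θ-φ)/2 = 2*((θ-φ)/4) by ring, Real.cos_two_mul, Real.cos_sq']; ring
  unfold zAux
  linear_combination 2*r*(h1 - h2)

lemma jk_poisson_small (α β θ φ t : ℝ) (hα : -(1/2) ≤ α) (hβ : -(1/2) < β)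
    (ha : 0 < Real.sin (θ/2) * Real.sin (φ/2)) (hb : 0 < Real.cos (θ/2) * Real.cos (φ/2))
    (ht : 0 < t) :
    0 ≤ jacobiPoissonKernel α β t θ φ ∧ jacobiPoissonKernel α β t θ φ ≤
      (4/π) * (Real.sin (θ/2) * Real.sin (φ/2)) ^ (-(α+1/2)) *
          (Real.cos (θ/2) * Real.cos (φ/2)) ^ (-(β+1/2)) *
      ((1 - Real.exp (-t)) / ((1-Real.exp (-t/2))^2 +
        4*Real.exp (-t/2)*(Real.sin ((θ-φ)/4))^2)) := by
  have hr : 0 < Real.exp (-t/2) := Real.exp_pos _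
  have hr1 : Real.exp (-t/2) < 1 := by rw [Real.exp_lt_one_iff]; linarith
  have hN : 0 < 1 - Real.exp (-t) := by
    have : Real.exp (-t) < 1 := by rw [Real.exp_lt_one_iff]; linarith
    linarith
  have hA : 0 < (1-Real.exp (-t/2))^2 + 4*Real.exp (-t/2)*(Real.sin ((θ-φ)/4))^2 := by
    have : 0 < 1 - Real.exp (-t/2) := by linarith
    positivity
  have h := jk_double α β _ _ _ (Real.exp (-t * (α + β + 1) / 2) * (1 - Real.exp (-t))) hα hβ hA
    (mul_pos hr ha) (mul_pos hr hb) (by positivity)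
    (fun u v => (Real.exp (-t * (α + β + 1) / 2) * (1 - Real.exp (-t))) /
      ((1 - Real.exp (-t/2)) ^ 2 + 2 * Real.exp (-t/2) * (1 - zAux u v θ φ)) ^ (α + β + 2)) ?_
  · refine ⟨h.1, h.2.trans (le_of_eq ?_)⟩
    rw [Real.mul_rpow hr.le ha.le, Real.mul_rpow hr.le hb.le, ← Real.exp_mul, ← Real.exp_mul]
    have e : Real.exp (-t * (α + β + 1) / 2) * Real.exp (-t/2 * (-(α+1/2))) *
        Real.exp (-t/2 * (-(β+1/2))) = 1 := by
      rw [← Real.exp_add, ← Real.exp_add, ← Real.exp_zero]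
      congr 1; ring
    generalize (Real.sin (θ/2) * Real.sin (φ/2)) ^ (-(α+1/2)) = X
    generalize (Real.cos (θ/2) * Real.cos (φ/2)) ^ (-(β+1/2)) = Y
    generalize (1-Real.exp (-t/2))^2 + 4*Real.exp (-t/2)*(Real.sin ((θ-φ)/4))^2 = A
    linear_combination ((1 - Real.exp (-t)) * (4/π) * X * Y / A) * e
  · intro u hu v hv
    rw [jk_z_eq]
    have hD : 0 < ((1-Real.exp (-t/2))^2 + 4*Real.exp (-t/2)*(Real.sin ((θ-φ)/4))^2)
        + 2*(Real.exp (-t/2)*(Real.cos (θ/2) * Real.cos (φ/2)))*(1-v)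
        + 2*(Real.exp (-t/2)*(Real.sin (θ/2) * Real.sin (φ/2)))*(1-u) := by
      have h1 : 0 ≤ 1 - u := by linarith [hu.2]
      have h2 : 0 ≤ 1 - v := by linarith [hv.2]
      have h3 := mul_pos hr ha
      have h4 := mul_pos hr hb
      have := mul_nonneg h3.le h1
      have := mul_nonneg h4.le h2
      linarith
    refine ⟨by positivity, ?_⟩
    rw [Real.rpow_neg hD.le, div_eq_mul_inv]

lemma jk_E_lower (h : ℝ) (hh : 0 ≤ h) :
    Real.exp (h/20) * (Real.exp (1/2) + Real.exp (-(1/2)) + 2) ≤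
      Real.exp ((1+h)/2) + Real.exp (-((1+h)/2)) + 2 := by
  have e1 : Real.exp ((1+h)/2) = Real.exp (h/20) * (Real.exp (1/2) * Real.exp (9*h/20)) := by
    rw [← Real.exp_add, ← Real.exp_add]; congr 1; ring
  have e2 : Real.exp (-((1+h)/2)) =
      Real.exp (h/20) * (Real.exp (-(1/2)) * Real.exp (-(11*h/20))) := by
    rw [← Real.exp_add, ← Real.exp_add]; congr 1; ring
  have e3 : (2:ℝ) = Real.exp (h/20) * (2 * Real.exp (-(h/20))) := by
    rw [mul_left_comm, ← Real.exp_add]; simp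
  suffices hsuf : Real.exp (h/20) * (Real.exp (1/2) + Real.exp (-(1/2)) + 2) ≤
      Real.exp (h/20) * (Real.exp (1/2) * Real.exp (9*h/20) +
        Real.exp (-(1/2)) * Real.exp (-(11*h/20)) + 2 * Real.exp (-(h/20))) by
    rw [e1, e2]; linarith
  apply mul_le_mul_of_nonneg_left _ (Real.exp_pos _).le
  have l1 := Real.add_one_le_exp (9*h/20)
  have l2 := Real.add_one_le_exp (-(11*h/20))
  have l3 := Real.add_one_le_exp (-(h/20))
  have p1 : (3/2:ℝ) ≤ Real.exp (1/2) := by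
    have := Real.add_one_le_exp (1/2:ℝ); linarith
  have p2 : Real.exp (-(1/2)) ≤ (2/3:ℝ) := by
    rw [Real.exp_neg]
    rw [inv_le_comm₀ (Real.exp_pos _) (by norm_num)]
    linarith
  have p3 := Real.exp_pos (-(1/2))
  have m1 := mul_le_mul_of_nonneg_left l1 (by linarith : 0 ≤ Real.exp (1/2))
  have m2 := mul_le_mul_of_nonneg_left l2 p3.le
  nlinarith

set_option maxHeartbeats 1600000 in
lemma jk_poisson_large (α β θ φ t : ℝ) (hα : -(1/2) ≤ α) (hβ : -(1/2) < β)
    (ha : 0 < Real.sin (θ/2) * Real.sin (φ/2)) (hb : 0 < Real.cos (θ/2) * Real.cos (φ/2))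
    (ht : 1 ≤ t) :
    jacobiPoissonKernel α β t θ φ ≤
      200 * (Real.sin (θ/2) * Real.sin (φ/2)) ^ (-(α+1/2)) *
          (Real.cos (θ/2) * Real.cos (φ/2)) ^ (-(β+1/2)) *
      Real.exp (-((β+1/2)/20) * (t-1)) := by
  set r := Real.exp (-t/2) with hrd
  set q := Real.exp (-1/2) with hqd
  have hr : 0 < r := Real.exp_pos _
  have hq : 0 < q := Real.exp_pos _
  have hr1 : r < 1 := by rw [hrd, Real.exp_lt_one_iff]; linarith
  have hq1 : q ≤ 2/3 := by
    have p1 : (3/2:ℝ) ≤ Real.exp (1/2) := by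
      have := Real.add_one_le_exp (1/2:ℝ); linarith
    rw [hqd, show (-1/2:ℝ) = -(1/2) by ring, Real.exp_neg,
      inv_le_comm₀ (Real.exp_pos _) (by norm_num)]
    linarith
  have hrq : r ≤ q := Real.exp_le_exp.mpr (by linarith)
  have hexpt : Real.exp (-t) = r^2 := by
    rw [hrd, ← Real.exp_nat_mul]; congr 1; push_cast; ring
  have hexpm : Real.exp (-t * (α + β + 1) / 2) = r^(α+β+1) := by
    rw [hrd, ← Real.exp_mul]; congr 1; ring
  have hN : 0 < 1 - r^2 := by nlinarith
  set s := Real.sin ((θ-φ)/4) with hs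
  have hA : 1/9 ≤ (1-q)^2 + 4*q*s^2 := by
    have : 0 ≤ 4*q*s^2 := by positivity
    nlinarith
  -- ratio
  set E := ((1+r)^2/r) / ((1+q)^2/q) with hE
  have hEpos : 0 < E := by positivity
  have hEl : Real.exp ((t-1)/20) ≤ E := by
    rw [hE, le_div_iff₀ (by positivity)]
    have h := jk_E_lower (t-1) (by linarith)
    have i1 : (1+r)^2/r = Real.exp ((1+(t-1))/2) + Real.exp (-((1+(t-1))/2)) + 2 := by
      have : Real.exp ((1+(t-1))/2) = r⁻¹ := by
        rw [hrd, ← Real.exp_neg]; congr 1; ring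
      rw [this, show -((1+(t-1))/2) = -t/2 by ring, ← hrd]
      field_simp; ring
    have i2 : (1+q)^2/q = Real.exp (1/2) + Real.exp (-(1/2)) + 2 := by
      have : Real.exp (1/2) = q⁻¹ := by
        rw [hqd, ← Real.exp_neg]; congr 1; ring
      rw [this, show -(1/2:ℝ) = -1/2 by ring, ← hqd]
      field_simp; ring
    rw [i1, i2]; exact h
  set μ := α+β+2 with hμ
  set c := (1-r^2)/r * E^(-μ) * q^μ with hc
  have hcp : 0 ≤ c := by positivity
  have h := jk_double α β _ _ _ c hα hβ (lt_of_lt_of_le (by norm_num) hA)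
    (mul_pos hq ha) (mul_pos hq hb) hcp
    (fun u v => (Real.exp (-t * (α + β + 1) / 2) * (1 - Real.exp (-t))) /
      ((1 - r) ^ 2 + 2 * r * (1 - zAux u v θ φ)) ^ μ) ?_
  · refine h.2.trans ?_
    rw [Real.mul_rpow hq.le ha.le, Real.mul_rpow hq.le hb.le]
    set X := (Real.sin (θ/2) * Real.sin (φ/2)) ^ (-(α+1/2)) with hX
    set Y := (Real.cos (θ/2) * Real.cos (φ/2)) ^ (-(β+1/2)) with hY
    have hXp : 0 < X := by positivity
    have hYp : 0 < Y := by positivity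
    have e1 : q^μ * q^(-(α+1/2)) * q^(-(β+1/2)) = q := by
      rw [← Real.rpow_add hq, ← Real.rpow_add hq]
      conv_rhs => rw [← Real.rpow_one q]
      congr 1; rw [hμ]; ring
    have e2 : E^(-μ) = E⁻¹ * E^(-(α+β+1)) := by
      rw [← Real.rpow_neg_one E, ← Real.rpow_add hEpos]; congr 1; rw [hμ]; ring
    have e3 : (1-r^2)/r * E⁻¹ * q ≤ 4 := by
      have : (1-r^2)/r * E⁻¹ * q = (1-r)/(1+r) * (1+q)^2 := by
        rw [hE]; field_simp; ring
      rw [this]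
      have h1 : (1-r)/(1+r) ≤ 1 := by rw [div_le_one (by linarith)]; linarith
      have h2 : (1+q)^2 ≤ 4 := by nlinarith
      have h3 : 0 ≤ (1+q)^2 := by positivity
      nlinarith
    have hE1 : 1 ≤ E := le_trans (Real.one_le_exp (by linarith)) hEl
    have e4 : E^(-(α+β+1)) ≤ Real.exp (-((β+1/2)/20) * (t-1)) := by
      calc E^(-(α+β+1)) ≤ E^(-(β+1/2)) :=
            Real.rpow_le_rpow_of_exponent_le hE1 (by linarith)
        _ ≤ (Real.exp ((t-1)/20))^(-(β+1/2)) :=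
            Real.rpow_le_rpow_of_nonpos (Real.exp_pos _) hEl (by linarith)
        _ = _ := by rw [← Real.exp_mul]; congr 1; ring
    have e5 : 4/π ≤ 2 := by
      rw [div_le_iff₀ Real.pi_pos]; linarith [Real.pi_gt_three]
    have e6 : ((1-q)^2 + 4*q*s^2)⁻¹ ≤ 9 := by
      rw [inv_le_comm₀ (by linarith) (by norm_num)]; linarith
    have hAi : 0 ≤ ((1-q)^2 + 4*q*s^2)⁻¹ := by positivity
    have hpi := Real.pi_pos
    calc c * (4/π) * (q^(-(α+1/2)) * X) * (q^(-(β+1/2)) * Y) / ((1-q)^2 + 4*q*s^2)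
        = ((1-r^2)/r * E⁻¹ * (q^μ * q^(-(α+1/2)) * q^(-(β+1/2)))) * E^(-(α+β+1)) * (4/π)
            * ((1-q)^2 + 4*q*s^2)⁻¹ * (X * Y) := by rw [hc, e2]; ring
      _ = ((1-r^2)/r * E⁻¹ * q) * E^(-(α+β+1)) * (4/π)
            * ((1-q)^2 + 4*q*s^2)⁻¹ * (X * Y) := by rw [e1]
      _ ≤ 4 * Real.exp (-((β+1/2)/20) * (t-1)) * 2 * 9 * (X * Y) := by gcongr
      _ ≤ 200 * X * Y * Real.exp (-((β+1/2)/20) * (t-1)) := by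
          have : 0 ≤ X * Y * Real.exp (-((β+1/2)/20) * (t-1)) := by positivity
          nlinarith
  · intro u hu v hv
    have hz1 : (-1:ℝ) ≤ zAux u v θ φ ∧ zAux u v θ φ ≤ 1 := by
      have hc1 : Real.cos (θ/2) * Real.cos (φ/2) + Real.sin (θ/2) * Real.sin (φ/2) ≤ 1 := by
        rw [← Real.cos_sub]; exact Real.cos_le_one _
      have m1 := mul_nonneg ha.le (sub_nonneg.2 hu.2)
      have m2 := mul_nonneg hb.le (sub_nonneg.2 hv.2)
      have m3 := mul_nonneg ha.le (neg_le_iff_add_nonneg.1 hu.1)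
      have m4 := mul_nonneg hb.le (neg_le_iff_add_nonneg.1 hv.1)
      unfold zAux
      constructor <;> nlinarith
    rw [← jk_z_eq, hexpt, hexpm]
    set z := zAux u v θ φ
    have hDq : 0 < (1-q)^2 + 2*q*(1-z) := by
      have : 0 < (1-q)^2 := by apply pow_pos; linarith
      have := mul_nonneg hq.le (sub_nonneg.2 hz1.2)
      linarith
    have hDr : 0 < (1-r)^2 + 2*r*(1-z) := by
      have : 0 < (1-r)^2 := by apply pow_pos; linarith
      have := mul_nonneg hr.le (sub_nonneg.2 hz1.2)
      linarith
    refine ⟨by positivity, ?_⟩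
    have key : E * (((1-q)^2 + 2*q*(1-z))/q) ≤ ((1-r)^2 + 2*r*(1-z))/r := by
      have : E * (((1-q)^2 + 2*q*(1-z))/q) =
          ((1+r)^2 * ((1-q)^2 + 2*q*(1-z))) / (r * (1+q)^2) := by
        rw [hE]; field_simp
      rw [this, div_le_div_iff₀ (by positivity) hr]
      have hz : 0 ≤ 1 + z := by linarith [hz1.1]
      have f1 : 0 ≤ (q - r) * (1 - q*r) := mul_nonneg (by linarith) (by nlinarith)
      have f2 := mul_nonneg (mul_nonneg hz f1) hr.le
      nlinarith
    have hμ0 : 0 < μ := by rw [hμ]; linarith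
    have k2 := Real.rpow_le_rpow_of_nonpos (by positivity) key (by linarith : -μ ≤ 0)
    rw [Real.mul_rpow hEpos.le (by positivity), Real.div_rpow hDr.le hr.le,
      Real.div_rpow hDq.le hq.le] at k2
    have e1 : r^(α+β+1) = r⁻¹ * r^μ := by
      rw [← Real.rpow_neg_one r, ← Real.rpow_add hr]; congr 1; rw [hμ]; ring
    rw [Real.rpow_neg hr.le, Real.rpow_neg hq.le] at k2
    calc r^(α+β+1) * (1-r^2) / ((1-r)^2 + 2*r*(1-z))^μ
        = (1-r^2)/r * (((1-r)^2 + 2*r*(1-z))^(-μ) / (r^μ)⁻¹) := by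
          rw [e1, Real.rpow_neg hDr.le]; field_simp
      _ ≤ (1-r^2)/r * (E^(-μ) * (((1-q)^2 + 2*q*(1-z))^(-μ) / (q^μ)⁻¹)) := by gcongr
      _ = _ := by rw [hc, ← hμ]; field_simp

lemma jk_small_t (t s : ℝ) (ht : 0 < t) (ht1 : t ≤ 1) :
    (1 - Real.exp (-t)) / ((1-Real.exp (-t/2))^2 + 4*Real.exp (-t/2)*s^2) ≤
      9 * (t / (t^2 + s^2)) := by
  have h1 : 1 - Real.exp (-t) ≤ t := by linarith [Real.add_one_le_exp (-t)]
  have h2 : 1/2 ≤ Real.exp (-t/2) := by linarith [Real.add_one_le_exp (-t/2)]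
  have h3 : t/3 ≤ 1 - Real.exp (-t/2) := by
    have h4 : 1 + t/2 ≤ Real.exp (t/2) := by linarith [Real.add_one_le_exp (t/2)]
    have h5 : Real.exp (-t/2) * Real.exp (t/2) = 1 := by
      rw [← Real.exp_add, ← Real.exp_zero]; congr 1; ring
    have h6 := mul_le_mul_of_nonneg_left h4 (Real.exp_pos (-t/2)).le
    nlinarith
  have hA : (t^2+s^2)/9 ≤ (1-Real.exp (-t/2))^2 + 4*Real.exp (-t/2)*s^2 := by
    have := sq_nonneg s
    nlinarith
  have hpos : 0 < t^2+s^2 := by positivity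
  calc _ ≤ t / ((t^2+s^2)/9) := by gcongr
    _ = _ := by field_simp

lemma jk_int1 (σ s : ℝ) (hσ0 : 0 < σ) (hs : 0 < s) :
    IntegrableOn (fun t : ℝ => t^σ * s^(-2:ℝ)) (Ioc 0 s) ∧
    ∫ t in Ioc 0 s, t^σ * s^(-2:ℝ) = s^(σ-1) / (σ+1) := by
  have hi : IntegrableOn (fun t : ℝ => t^σ) (Ioc 0 s) := by
    rw [← intervalIntegrable_iff_integrableOn_Ioc_of_le hs.le]
    exact intervalIntegral.intervalIntegrable_rpow' (by linarith)
  refine ⟨hi.mul_const _, ?_⟩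
  rw [integral_mul_const, ← intervalIntegral.integral_of_le hs.le,
    integral_rpow (Or.inl (by linarith)), Real.zero_rpow (by linarith), sub_zero, div_mul_eq_mul_div,
    ← Real.rpow_add hs]
  congr 2; ring

lemma jk_int2 (σ s : ℝ) (hσ1 : σ < 1) (hs : 0 < s) :
    IntegrableOn (fun t : ℝ => t^(σ-2)) (Ioi s) ∧
    ∫ t in Ioi s, t^(σ-2) = s^(σ-1) / (1-σ) := by
  refine ⟨integrableOn_Ioi_rpow_of_lt (by linarith) hs, ?_⟩
  rw [integral_Ioi_rpow_of_lt (by linarith) hs, show σ-2+1 = σ-1 by ring,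
    show σ - 1 = -(1-σ) by ring, neg_div_neg_eq]

lemma jk_int3 (κ : ℝ) (hκ : 0 < κ) :
    IntegrableOn (fun t : ℝ => Real.exp (-κ * (t-1))) (Ioi 1) ∧
    ∫ t in Ioi (1:ℝ), Real.exp (-κ * (t-1)) = 1/κ := by
  have e : (fun t : ℝ => Real.exp (-κ * (t-1))) = fun t => Real.exp κ * Real.exp (-κ * t) := by
    funext t; rw [← Real.exp_add]; congr 1; ring
  rw [e]
  refine ⟨(integrableOn_exp_mul_Ioi (by linarith) 1).const_mul _, ?_⟩
  rw [integral_const_mul, integral_exp_mul_Ioi (by linarith), neg_div_neg_eq, mul_div_assoc',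
    ← Real.exp_add]
  simp

/-- Sharp estimate for the Jacobi fractional integral kernel: for `0 < σ < 1`,
`α ≥ -1/2`, `β > -1/2` and `θ ≠ φ` in `(0,π)`, one has `0 ≤ K_σ^{α,β}(θ,φ)` and
`K_σ^{α,β}(θ,φ) ≤ C_σ (sin(θ/2)sin(φ/2))^{-(α+1/2)} (cos(θ/2)cos(φ/2))^{-(β+1/2)}
  (1/(β+1/2) + 1/|sin((θ-φ)/4)|^{1-σ})`
with `C_σ > 0` depending only on `σ`. -/
theorem jacobiFracKernel_nonneg_and_sharp_bound (σ : ℝ) (hσ0 : 0 < σ) (hσ1 : σ < 1) :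
    ∃ C : ℝ, 0 < C ∧ ∀ α β θ φ : ℝ, -(1/2) ≤ α → -(1/2) < β →
      θ ∈ Ioo (0:ℝ) π → φ ∈ Ioo (0:ℝ) π → θ ≠ φ →
      0 ≤ jacobiFracKernel σ α β θ φ ∧
      jacobiFracKernel σ α β θ φ ≤
        C * (Real.sin (θ/2) * Real.sin (φ/2)) ^ (-(α+1/2)) *
          (Real.cos (θ/2) * Real.cos (φ/2)) ^ (-(β+1/2)) *
          (1/(β+1/2) + 1/|Real.sin ((θ-φ)/4)| ^ (1-σ)) := by
  have hΓ := Real.Gamma_pos_of_pos hσ0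
  have h1σ : 0 < 1 - σ := by linarith
  refine ⟨1/Real.Gamma σ * (18/(σ+1) + 18/(1-σ) + 4000), by positivity, ?_⟩
  intro α β θ φ hα hβ hθ hφ hne
  have hsin : ∀ x ∈ Ioo (0:ℝ) π, 0 < Real.sin (x/2) := fun x hx =>
    Real.sin_pos_of_pos_of_lt_pi (by linarith [hx.1]) (by linarith [hx.2, hx.1])
  have hcos : ∀ x ∈ Ioo (0:ℝ) π, 0 < Real.cos (x/2) := fun x hx =>
    Real.cos_pos_of_mem_Ioo ⟨by linarith [hx.1, Real.pi_pos], by linarith [hx.2]⟩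
  have ha := mul_pos (hsin θ hθ) (hsin φ hφ)
  have hb := mul_pos (hcos θ hθ) (hcos φ hφ)
  have hP0 : ∀ t : ℝ, 0 < t → 0 ≤ jacobiPoissonKernel α β t θ φ * t^(σ-1) := fun t ht =>
    mul_nonneg (jk_poisson_small α β θ φ t hα hβ ha hb ht).1 (Real.rpow_nonneg ht.le _)
  constructor
  · unfold jacobiFracKernel
    exact mul_nonneg (by positivity) (setIntegral_nonneg measurableSet_Ioi fun t ht => hP0 t ht)
  have hsne : Real.sin ((θ-φ)/4) ≠ 0 := by
    intro h0
    have := (Real.sin_eq_zero_iff_of_lt_of_lt (x := (θ-φ)/4)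
      (by linarith [hθ.1, hθ.2, hφ.1, hφ.2]) (by linarith [hθ.1, hθ.2, hφ.1, hφ.2])).1 h0
    apply hne; linarith
  set s := |Real.sin ((θ-φ)/4)| with hs
  have hspos : 0 < s := abs_pos.2 hsne
  have hs1 : s ≤ 1 := Real.abs_sin_le_one _
  have hs2 : (Real.sin ((θ-φ)/4))^2 = s^2 := by rw [hs, sq_abs]
  set X := (Real.sin (θ/2) * Real.sin (φ/2)) ^ (-(α+1/2)) with hX
  set Y := (Real.cos (θ/2) * Real.cos (φ/2)) ^ (-(β+1/2)) with hY
  have hXp : 0 < X := by positivity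
  have hYp : 0 < Y := by positivity
  have hβ' : 0 < β + 1/2 := by linarith
  obtain ⟨i1, v1⟩ := jk_int1 σ s hσ0 hspos
  obtain ⟨i2, v2⟩ := jk_int2 σ s hσ1 hspos
  obtain ⟨i3, v3⟩ := jk_int3 ((β+1/2)/20) (by positivity)
  set F1 := (Ioc 0 s).indicator (fun t : ℝ => t^σ * s^(-2:ℝ)) with hF1
  set F2 := (Ioi s).indicator (fun t : ℝ => t^(σ-2)) with hF2
  set F3 := (Ioi (1:ℝ)).indicator (fun t : ℝ => Real.exp (-((β+1/2)/20) * (t-1))) with hF3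
  have j1 : IntegrableOn F1 (Ioi 0) := ((integrable_indicator_iff measurableSet_Ioc).2 i1).integrableOn
  have j2 : IntegrableOn F2 (Ioi 0) := ((integrable_indicator_iff measurableSet_Ioi).2 i2).integrableOn
  have j3 : IntegrableOn F3 (Ioi 0) := ((integrable_indicator_iff measurableSet_Ioi).2 i3).integrableOn
  have w1 : ∫ t in Ioi (0:ℝ), F1 t = s^(σ-1)/(σ+1) := by
    rw [hF1, setIntegral_indicator measurableSet_Ioc, ← v1,
      inter_eq_self_of_subset_right (fun x hx => hx.1)]
  have w2 : ∫ t in Ioi (0:ℝ), F2 t = s^(σ-1)/(1-σ) := by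
    rw [hF2, setIntegral_indicator measurableSet_Ioi, ← v2,
      inter_eq_self_of_subset_right (Ioi_subset_Ioi hspos.le)]
  have w3 : ∫ t in Ioi (0:ℝ), F3 t = 1/((β+1/2)/20) := by
    rw [hF3, setIntegral_indicator measurableSet_Ioi, ← v3,
      inter_eq_self_of_subset_right (Ioi_subset_Ioi zero_le_one)]
  have n1 : ∀ t, 0 < t → 0 ≤ F1 t := fun t ht =>
    Set.indicator_nonneg (fun x hx => by have := hx.1; positivity) t
  have n2 : ∀ t, 0 < t → 0 ≤ F2 t := fun t ht =>
    Set.indicator_nonneg (fun x hx => Real.rpow_nonneg (hspos.trans hx).le _) t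
  have n3 : ∀ t, 0 < t → 0 ≤ F3 t := fun t ht =>
    Set.indicator_nonneg (fun x hx => (Real.exp_pos _).le) t
  have hbound : ∀ t ∈ Ioi (0:ℝ), jacobiPoissonKernel α β t θ φ * t^(σ-1) ≤
      X * Y * (18 * F1 t + 18 * F2 t + 200 * F3 t) := by
    intro t ht
    have ht : 0 < t := ht
    have hXY : 0 < X * Y := by positivity
    rcases le_or_gt t 1 with h1 | h1
    · have hp := (jk_poisson_small α β θ φ t hα hβ ha hb ht).2
      rw [hs2] at hp
      have e5 : 4/π ≤ 2 := by
        rw [div_le_iff₀ Real.pi_pos]; linarith [Real.pi_gt_three]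
      have hst := jk_small_t t s ht h1
      have hpi := Real.pi_pos
      have hp2 : jacobiPoissonKernel α β t θ φ ≤ 2 * X * Y * (9 * (t / (t^2 + s^2))) := by
        refine hp.trans ?_
        calc _ ≤ 4/π * X * Y * (9 * (t / (t^2 + s^2))) := by gcongr
          _ ≤ _ := by gcongr
      have hp3 : jacobiPoissonKernel α β t θ φ * t^(σ-1) ≤
          X * Y * (18 * (t / (t^2+s^2) * t^(σ-1))) := by
        calc _ ≤ 2 * X * Y * (9 * (t / (t^2 + s^2))) * t^(σ-1) := by gcongr
          _ = _ := by ring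
      refine hp3.trans (mul_le_mul_of_nonneg_left ?_ hXY.le)
      have m1 := n1 t ht
      have m2 := n2 t ht
      have m3 := n3 t ht
      rcases le_or_gt t s with h2 | h2
      · have : F1 t = t^σ * s^(-2:ℝ) := Set.indicator_of_mem (show t ∈ Ioc 0 s from ⟨ht, h2⟩) _
        have hle : t / (t^2+s^2) * t^(σ-1) ≤ t^σ * s^(-2:ℝ) := by
          rw [Real.rpow_neg hspos.le, Real.rpow_two, Real.rpow_sub_one ht.ne']
          calc t / (t^2+s^2) * (t^σ/t) ≤ t / (s^2) * (t^σ/t) := by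
                gcongr; linarith [sq_nonneg t]
            _ = _ := by field_simp
        linarith
      · have : F2 t = t^(σ-2) := Set.indicator_of_mem (show t ∈ Ioi s from h2) _
        have hle : t / (t^2+s^2) * t^(σ-1) ≤ t^(σ-2) := by
          rw [show σ - 2 = (σ-1) - 1 by ring, Real.rpow_sub_one ht.ne' (σ-1)]
          calc t / (t^2+s^2) * t^(σ-1) ≤ t / (t^2) * t^(σ-1) := by
                gcongr; linarith [sq_nonneg s]
            _ = _ := by field_simp
        linarith
    · have hp := jk_poisson_large α β θ φ t hα hβ ha hb h1.le
      have hF : F3 t = Real.exp (-((β+1/2)/20) * (t-1)) :=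
        Set.indicator_of_mem (show t ∈ Ioi (1:ℝ) from h1) _
      have ht1 : t^(σ-1) ≤ 1 := Real.rpow_le_one_of_one_le_of_nonpos h1.le (by linarith)
      have hP := (jk_poisson_small α β θ φ t hα hβ ha hb ht).1
      have m1 := n1 t ht
      have m2 := n2 t ht
      calc jacobiPoissonKernel α β t θ φ * t^(σ-1) ≤ jacobiPoissonKernel α β t θ φ * 1 := by gcongr
        _ ≤ 200 * X * Y * F3 t := by rw [mul_one, hF]; exact hp
        _ = X * Y * (200 * F3 t) := by ring
        _ ≤ _ := by gcongr; linarith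
  have hint : ∫ t in Ioi (0:ℝ), jacobiPoissonKernel α β t θ φ * t^(σ-1) ≤
      X * Y * (18 * (s^(σ-1)/(σ+1)) + 18 * (s^(σ-1)/(1-σ)) + 200 * (1/((β+1/2)/20))) := by
    have j12 : Integrable (fun t => 18 * F1 t + 18 * F2 t) (volume.restrict (Ioi 0)) :=
      (j1.const_mul 18).add (j2.const_mul 18)
    rw [← w1, ← w2, ← w3, ← integral_const_mul, ← integral_const_mul, ← integral_const_mul,
      ← integral_add (j1.const_mul 18) (j2.const_mul 18),
      ← integral_add j12 (j3.const_mul 200),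
      ← integral_const_mul]
    apply integral_mono_of_nonneg
    · filter_upwards [self_mem_ae_restrict measurableSet_Ioi] with t ht using hP0 t ht
    · exact (j12.add (j3.const_mul 200)).const_mul _
    · filter_upwards [self_mem_ae_restrict measurableSet_Ioi] with t ht using hbound t ht
  unfold jacobiFracKernel
  have hsr : s^(σ-1) = 1/s^(1-σ) := by
    rw [show σ-1 = -(1-σ) by ring, Real.rpow_neg hspos.le, one_div]
  rw [hsr] at hint
  set Z := 1/s^(1-σ) with hZ
  have hZp : 0 < Z := by positivity
  set V := 1/(β+1/2) with hV
  have hVp : 0 < V := by positivity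
  have hV2 : 1/((β+1/2)/20) = 20 * V := by rw [hV]; field_simp
  rw [hV2] at hint
  have hfin : 18 * (Z/(σ+1)) + 18 * (Z/(1-σ)) + 200 * (20 * V) ≤
      (18/(σ+1) + 18/(1-σ) + 4000) * (V + Z) := by
    have q1 : 0 ≤ (18/(σ+1) + 18/(1-σ)) * V := by positivity
    have q2 : (18/(σ+1) + 18/(1-σ) + 4000) * (V + Z) =
      18 * (Z/(σ+1)) + 18 * (Z/(1-σ)) + 200 * (20 * V) +
        ((18/(σ+1) + 18/(1-σ)) * V + 4000 * Z) := by ring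
    rw [q2]; linarith
  calc _ ≤ 1/Real.Gamma σ * (X * Y * (18 * (Z/(σ+1)) + 18 * (Z/(1-σ)) + 200 * (20 * V))) := by
        gcongr
    _ ≤ 1/Real.Gamma σ * (X * Y * ((18/(σ+1) + 18/(1-σ) + 4000) * (V + Z))) := by gcongr
    _ = _ := by ring
end

section
/- Suppose 0 < σ < 1 and 1 < p ≤ q < ∞. Let w and v be weights on (0,π) (strictly positive, finite a.e. measurable functions) such that w belongs to A_∞ and v̄ := v^{−1/(p−1)} belongs to A_∞. Then there exists a constant C such that ‖I_σ f‖_{L^q((0,π), w dθ)} ≤ C ‖f‖_{L^p((0,π), v dθ)} for all nonnegative f ∈ L^p((0,π), v dθ), if and only if there exists a constant C′ < ∞ such that for every interval I ⊂ (0,π): (∫_I w dθ)^{1/q} (∫_I v̄ dθ)^{(p−1)/p} ≤ C′ |I|^{1−σ}, where |I| is the length of I. -/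
open MeasureTheory Real Set

/-- The fractional integral `I_σ g(θ) = ∫_0^π g(φ)/|θ-φ|^{1-σ} dφ` of a nonnegative
function on `(0,π)`, with values in `[0,∞]`. -/
noncomputable def fracIntegral (σ : ℝ) (g : ℝ → ℝ) (θ : ℝ) : ENNReal :=
  ∫⁻ φ in Ioo (0:ℝ) π, ENNReal.ofReal (g φ) * ENNReal.ofReal |θ - φ| ^ (σ - 1)

/-- The Muckenhoupt class `A_r` on `(0,π)` (`r > 1`): `u` and `u^{-1/(r-1)}` are
locally integrable and the `A_r` characteristic is uniformly bounded over all
subintervals of `(0,π)`. -/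
def MuckenhouptAr (u : ℝ → ℝ) (r : ℝ) : Prop :=
  ∃ C : ℝ, ∀ a b : ℝ, 0 ≤ a → a < b → b ≤ π →
    IntegrableOn u (Ioo a b) ∧
    IntegrableOn (fun θ => u θ ^ (-(1/(r-1)))) (Ioo a b) ∧
    ((b - a)⁻¹ * ∫ θ in Ioo a b, u θ) *
      ((b - a)⁻¹ * ∫ θ in Ioo a b, u θ ^ (-(1/(r-1)))) ^ (r-1) ≤ C

/-- `A_∞` on `(0,π)` is the union of the classes `A_r` over `1 < r < ∞`. -/
def MuckenhouptAinf (u : ℝ → ℝ) : Prop :=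
  ∃ r : ℝ, 1 < r ∧ MuckenhouptAr u r


section Core
variable {ι : Type} 

/-- Sum of `φ` over the stopping cells below `i`. -/
noncomputable def fiSel (l r : ι → ι) (F len : ι → ℝ) (φ : ι → ℝ) : ℕ → ι → ℝ → ℝ
  | 0, _, _ => 0
  | n+1, i, t => if 4 * t * len i < F i then
      φ i + (fiSel l r F len φ n (l i) (F i / len i) + fiSel l r F len φ n (r i) (F i / len i))
      else fiSel l r F len φ n (l i) t + fiSel l r F len φ n (r i) t

/-- Sum of `X` over the first stopping cells below `i`. -/
noncomputable def fiStop (l r : ι → ι) (F len : ι → ℝ) (X : ι → ℝ) : ℕ → ι → ℝ → ℝ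
  | 0, _, _ => 0
  | n+1, i, t => if 4 * t * len i < F i then X i
      else fiStop l r F len X n (l i) t + fiStop l r F len X n (r i) t

/-- Sum of `φ` over all cells below `i`. -/
noncomputable def fiTot (l r : ι → ι) (φ : ι → ℝ) : ℕ → ι → ℝ
  | 0, _ => 0
  | n+1, i => φ i + (fiTot l r φ n (l i) + fiTot l r φ n (r i))

lemma fiSel_nonneg (l r : ι → ι) (F len : ι → ℝ) (φ : ι → ℝ) (h : ∀ i, 0 ≤ φ i) (n : ℕ) :
    ∀ i t, 0 ≤ fiSel l r F len φ n i t := by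
  induction n with
  | zero => intro i t; simp [fiSel]
  | succ n ih =>
    intro i t
    simp only [fiSel]
    split_ifs
    · have := ih (l i) (F i / len i); have := ih (r i) (F i / len i); have := h i; linarith
    · have := ih (l i) t; have := ih (r i) t; linarith

lemma fiSel_le (l r : ι → ι) (F len : ι → ℝ) (φ ψ χ : ι → ℝ) (D : ℝ)
    (h : ∀ i, φ i ≤ D * (ψ i + χ i)) (n : ℕ) :
    ∀ i t, fiSel l r F len φ n i t ≤ D * (fiSel l r F len ψ n i t + fiSel l r F len χ n i t) := by
  induction n with
  | zero => intro i t; simp [fiSel]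
  | succ n ih =>
    intro i t
    simp only [fiSel]
    split_ifs
    · have := ih (l i) (F i / len i); have := ih (r i) (F i / len i); have := h i; linarith
    · have := ih (l i) t; have := ih (r i) t; linarith

lemma fiTot_le (l r : ι → ι) (F G len κ δ : ι → ℝ) (ρ : ℝ) (hρ0 : 0 ≤ ρ) (hρ1 : ρ < 1)
    (hF0 : ∀ i, 0 ≤ F i) (hG0 : ∀ i, 0 ≤ G i) (hlen0 : ∀ i, 0 ≤ len i) (hκ : ∀ i, 0 ≤ κ i)
    (hδ : ∀ i, 0 ≤ δ i)
    (hG : ∀ i, G i = G (l i) + G (r i))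
    (hl : ∀ i, κ (l i) * δ (l i) = ρ * (κ i * δ i)) (hr : ∀ i, κ (r i) * δ (r i) = ρ * (κ i * δ i))
    (hlenδ : ∀ i, len i ≤ δ i) (hδlen : ∀ i, 0 < len i → δ i ≤ 6 * len i)
    (hFlen : ∀ i, len i = 0 → F i = 0) (n : ℕ) :
    ∀ i t, 0 ≤ t → fiTot l r (fun i => κ i * F i * G i) n i ≤
      4 / (1 - ρ) * t * (κ i * δ i * G i) +
      (1 + 6 * (4 / (1 - ρ))) * fiSel l r F len (fun i => κ i * F i * G i) n i t := by
  have hC : 0 ≤ 4 / (1 - ρ) := div_nonneg (by norm_num) (by linarith)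
  have hCe : 4 / (1 - ρ) * ρ = 4 / (1 - ρ) - 4 := by
    field_simp [show (1 - ρ) ≠ 0 by linarith]; ring
  set C := 4 / (1 - ρ) with hCdef
  induction n with
  | zero =>
    intro i t ht
    simp only [fiSel, fiTot]
    have := mul_nonneg (mul_nonneg hC ht) (mul_nonneg (mul_nonneg (hκ i) (hδ i)) (hG0 i))
    linarith
  | succ n ih =>
    intro i t ht
    simp only [fiSel, fiTot]
    split_ifs with hs
    · have hlp : 0 < len i := by
        rcases (hlen0 i).lt_or_eq with h | h
        · exact h
        · rw [hFlen i h.symm] at hs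
          rw [← h] at hs; simp at hs
      have hm : 0 ≤ F i / len i := div_nonneg (hF0 i) (hlen0 i)
      have h1 := ih (l i) _ hm
      have h2 := ih (r i) _ hm
      rw [hl] at h1
      rw [hr] at h2
      have h3 : F i / len i * δ i ≤ 6 * F i := by
        rw [div_mul_eq_mul_div, div_le_iff₀ hlp]
        nlinarith [hδlen i hlp, hF0 i]
      have h4 : C * (F i / len i) * (ρ * (κ i * δ i) * G (l i)) +
          C * (F i / len i) * (ρ * (κ i * δ i) * G (r i)) =
          (C * ρ) * ((F i / len i * δ i) * (κ i * G i)) := by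
        rw [hG i]; ring
      have h5 : (C * ρ) * ((F i / len i * δ i) * (κ i * G i)) ≤ C * (6 * F i * (κ i * G i)) := by
        have a1 : 0 ≤ κ i * G i := mul_nonneg (hκ i) (hG0 i)
        have a2 : (F i / len i * δ i) * (κ i * G i) ≤ 6 * F i * (κ i * G i) :=
          mul_le_mul_of_nonneg_right h3 a1
        have a3 : C * ρ ≤ C := by linarith
        have a4 : 0 ≤ (F i / len i * δ i) * (κ i * G i) :=
          mul_nonneg (mul_nonneg hm (hδ i)) a1
        exact mul_le_mul a3 a2 a4 hC
      have h6 := mul_nonneg (mul_nonneg hC ht) (mul_nonneg (mul_nonneg (hκ i) (hδ i)) (hG0 i))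
      nlinarith
    · have h1 := ih (l i) _ ht
      have h2 := ih (r i) _ ht
      rw [hl] at h1
      rw [hr] at h2
      push Not at hs
      have h4 : C * t * (ρ * (κ i * δ i) * G (l i)) +
          C * t * (ρ * (κ i * δ i) * G (r i)) =
          (C * ρ) * (t * (κ i * δ i * G i)) := by
        rw [hG i]; ring
      rw [hCe] at h4
      have a1 : 0 ≤ κ i * G i := mul_nonneg (hκ i) (hG0 i)
      have h5 : F i ≤ 4 * t * δ i :=
        hs.trans (mul_le_mul_of_nonneg_left (hlenδ i) (by linarith))
      have h6 := mul_le_mul_of_nonneg_right h5 a1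
      nlinarith

lemma fiStop_len (l r : ι → ι) (F len : ι → ℝ) 
    (hF0 : ∀ i, 0 ≤ F i) 
    (hF : ∀ i, F i = F (l i) + F (r i)) (n : ℕ) :
    ∀ i t, 4 * t * fiStop l r F len len n i t ≤ F i := by
  induction n with
  | zero => intro i t; simp [fiStop, hF0 i]
  | succ n ih =>
    intro i t
    simp only [fiStop]
    split_ifs with hs
    · exact hs.le
    · rw [hF i]; have := ih (l i) t; have := ih (r i) t; linarith

lemma fiStop_le (l r : ι → ι) (F len X : ι → ℝ) 
    (hX0 : ∀ i, 0 ≤ X i) 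
    (hX : ∀ i, X i = X (l i) + X (r i)) (n : ℕ) :
    ∀ i t, fiStop l r F len X n i t ≤ X i := by
  induction n with
  | zero => intro i t; simp [fiStop, hX0 i]
  | succ n ih =>
    intro i t
    simp only [fiStop]
    split_ifs with hs
    · exact le_rfl
    · rw [hX i]; have := ih (l i) t; have := ih (r i) t; linarith

lemma fiSel_mass (l r : ι → ι) (F len ν : ι → ℝ) (K : ℝ) (hK : 1 ≤ K)
    (hF0 : ∀ i, 0 ≤ F i) (hlen0 : ∀ i, 0 ≤ len i)
    (hFlen : ∀ i, len i = 0 → F i = 0)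
    (hF : ∀ i, F i = F (l i) + F (r i))
    (hA : ∀ n i t, 4 * (fiStop l r F len len n (l i) t + fiStop l r F len len n (r i) t) ≤ len i →
      K * (fiStop l r F len ν n (l i) t + fiStop l r F len ν n (r i) t) ≤ (K - 1) * ν i)
    (n : ℕ) :
    ∀ i t, 0 ≤ t → fiSel l r F len ν n i t ≤ K * fiStop l r F len ν n i t := by
  induction n with
  | zero => intro i t ht; simp [fiSel, fiStop]
  | succ n ih =>
    intro i t ht
    simp only [fiSel, fiStop]
    split_ifs with hs
    · have hlp : 0 < len i := by
        rcases (hlen0 i).lt_or_eq with h | h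
        · exact h
        · rw [hFlen i h.symm] at hs
          rw [← h] at hs; simp at hs
      have hFp : 0 < F i := lt_of_le_of_lt (by have := hlen0 i; positivity) hs
      have hm : 0 < F i / len i := div_pos hFp hlp
      have h1 := ih (l i) _ hm.le
      have h2 := ih (r i) _ hm.le
      have h3 := fiStop_len l r F len hF0 hF n (l i) (F i / len i)
      have h4 := fiStop_len l r F len hF0 hF n (r i) (F i / len i)
      have h5 := hA n i (F i / len i) (by
        have : (F i / len i) * (4 * (fiStop l r F len len n (l i) (F i / len i) +
          fiStop l r F len len n (r i) (F i / len i))) ≤ (F i / len i) * len i := by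
          rw [div_mul_cancel₀ _ hlp.ne']
          rw [hF i] at h3 h4 ⊢
          linarith
        exact le_of_mul_le_mul_left this hm)
      nlinarith
    · have := ih (l i) t ht; have := ih (r i) t ht; linarith

/-- convexity of the perspective function -/
lemma fi_persp (p : ℝ) (hp : 1 < p) (a b x y : ℝ) (ha : 0 ≤ a) (hb : 0 ≤ b) (hx : 0 ≤ x)
    (hy : 0 ≤ y) (hax : x = 0 → a = 0) (hby : y = 0 → b = 0) :
    (a + b) ^ p * (x + y) ^ (1 - p) ≤ a ^ p * x ^ (1 - p) + b ^ p * y ^ (1 - p) := by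
  have hp0 : p ≠ 0 := by linarith
  rcases hx.lt_or_eq with hx | hx
  · rcases hy.lt_or_eq with hy | hy
    · have hc := (convexOn_rpow hp.le).2 (show a / x ∈ Ici (0:ℝ) from div_nonneg ha hx.le)
        (show b / y ∈ Ici (0:ℝ) from div_nonneg hb hy.le) (show 0 ≤ x / (x + y) by positivity)
        (show 0 ≤ y / (x + y) by positivity) (by field_simp)
      simp only [smul_eq_mul] at hc
      have e1 : x / (x + y) * (a / x) + y / (x + y) * (b / y) = (a + b) / (x + y) := by
        field_simp
      rw [e1, div_rpow (by linarith) (by linarith), div_rpow ha hx.le, div_rpow hb hy.le] at hc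
      have hxy : 0 < x + y := by linarith
      have e2 : ∀ z : ℝ, 0 < z → z ^ (1 - p) = z / z ^ p := by
        intro z hz; rw [rpow_sub hz, rpow_one]
      rw [e2 _ hxy, e2 _ hx, e2 _ hy]
      have h3 := mul_le_mul_of_nonneg_left hc hxy.le
      have e3 : (x + y) * (x / (x + y) * (a ^ p / x ^ p) + y / (x + y) * (b ^ p / y ^ p)) =
        a ^ p * (x / x ^ p) + b ^ p * (y / y ^ p) := by field_simp
      rw [e3] at h3
      calc _ = (x + y) * ((a + b) ^ p / (x + y) ^ p) := by ring
        _ ≤ _ := h3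
    · rw [hby hy.symm, ← hy]; simp [zero_rpow hp0]
  · rw [hax hx.symm, ← hx]; simp [zero_rpow hp0]

/-- the constant of the Carleson embedding -/
noncomputable def fiC (p K : ℝ) : ℝ := (2 ^ (1 - p) * (1 - (1 + 1 / (2 * K)) ^ (1 - p)))⁻¹

lemma fiC_pos (p K : ℝ) (hp : 1 < p) (hK : 1 ≤ K) : 0 < fiC p K := by
  unfold fiC
  have : (1 + 1 / (2 * K)) ^ (1 - p) < 1 :=
    rpow_lt_one_of_one_lt_of_neg (by simp; linarith) (by linarith)
  have h2 : (0:ℝ) < 2 ^ (1 - p) := rpow_pos_of_pos (by norm_num) _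
  exact inv_pos.mpr (mul_pos h2 (by linarith))

lemma fi_bell (p K v A : ℝ) (hp : 1 < p) (hK : 1 ≤ K) (hv : 0 < v) (hA0 : 0 ≤ A)
    (hA : A ≤ K * v) : v ^ (1 - p) ≤
      fiC p K * ((v + A / K) ^ (1 - p) - (v + (v + A) / K) ^ (1 - p)) := by
  have hc := fiC_pos p K hp hK
  have hK0 : 0 < K := by linarith
  have hAK : A / K ≤ v := by rw [div_le_iff₀ hK0]; linarith
  have hAK0 : 0 ≤ A / K := by positivity
  set z := v + A / K with hz
  have hz0 : 0 < z := by linarith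
  have e : v + (v + A) / K = z * (1 + v / (K * z)) := by
    rw [hz, mul_add, add_div]; field_simp
    ring
  have h1 : (2 * v) ^ (1 - p) ≤ z ^ (1 - p) :=
    rpow_le_rpow_of_nonpos hz0 (by linarith) (by linarith)
  have h2 : (1 + v / (K * z)) ^ (1 - p) ≤ (1 + 1 / (2 * K)) ^ (1 - p) := by
    apply rpow_le_rpow_of_nonpos (by positivity) _ (by linarith)
    gcongr 1 + ?_
    rw [div_le_div_iff₀ (by positivity) (by positivity)]
    nlinarith
  have h3 : (1 + 1 / (2 * K)) ^ (1 - p) < 1 :=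
    rpow_lt_one_of_one_lt_of_neg (by simp; linarith) (by linarith)
  rw [e, mul_rpow hz0.le (by positivity)]
  rw [mul_rpow (by norm_num) hv.le] at h1
  have hv' : 0 < v ^ (1 - p) := rpow_pos_of_pos hv _
  have key : 2 ^ (1 - p) * v ^ (1 - p) * (1 - (1 + 1 / (2 * K)) ^ (1 - p)) ≤
      z ^ (1 - p) * (1 - (1 + v / (K * z)) ^ (1 - p)) :=
    mul_le_mul h1 (by linarith) (by linarith) (rpow_nonneg hz0.le _)
  have e2 : v ^ (1 - p) = fiC p K * (2 ^ (1 - p) * v ^ (1 - p) * (1 - (1 + 1 / (2 * K)) ^ (1 - p))) := by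
    unfold fiC
    have h2 : (0:ℝ) < 2 ^ (1 - p) := rpow_pos_of_pos (by norm_num) _
    have h5 : (1 - (1 + 1 / (2 * K)) ^ (1 - p)) ≠ 0 := by linarith
    generalize (1 - (1 + 1 / (2 * K)) ^ (1 - p)) = u at h5
    field_simp
  calc v ^ (1 - p) = _ := e2
    _ ≤ fiC p K * (z ^ (1 - p) * (1 - (1 + v / (K * z)) ^ (1 - p))) := by gcongr
    _ = _ := by ring

lemma fi_embed (l r : ι → ι) (F len ν H P : ι → ℝ) (p K : ℝ) (hp : 1 < p) (hK : 1 ≤ K)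
    (hν0 : ∀ i, 0 ≤ ν i) (hH0 : ∀ i, 0 ≤ H i) (hP0 : ∀ i, 0 ≤ P i) 
    (hν : ∀ i, ν i = ν (l i) + ν (r i)) (hH : ∀ i, H i = H (l i) + H (r i))
    (hP : ∀ i, P i = P (l i) + P (r i))
    (hHol : ∀ i, H i ^ p * ν i ^ (1 - p) ≤ P i) (hνH : ∀ i, ν i = 0 → H i = 0)
    (hlen0 : ∀ i, 0 ≤ len i) (hF0 : ∀ i, 0 ≤ F i)
    (hA : ∀ n i t, 0 ≤ t → fiSel l r F len ν n i t ≤ K * ν i) (n : ℕ) :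
    ∀ i t, 0 ≤ t → fiSel l r F len (fun i => H i ^ p * ν i ^ (1 - p)) n i t ≤
      fiC p K * (P i - H i ^ p * (ν i + fiSel l r F len ν n i t / K) ^ (1 - p)) := by
  have hc := fiC_pos p K hp hK
  have hK0 : 0 < K := by linarith
  have hcomb : ∀ n i t, 0 ≤ t → H i ^ p * (ν i + (fiSel l r F len ν n (l i) t +
      fiSel l r F len ν n (r i) t) / K) ^ (1 - p) ≤
      H (l i) ^ p * (ν (l i) + fiSel l r F len ν n (l i) t / K) ^ (1 - p) + 
      H (r i) ^ p * (ν (r i) + fiSel l r F len ν n (r i) t / K) ^ (1 - p) := by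
    intro n i t ht
    have s1 : 0 ≤ fiSel l r F len ν n (l i) t / K :=
      div_nonneg (fiSel_nonneg l r F len ν hν0 n _ _) hK0.le
    have s2 : 0 ≤ fiSel l r F len ν n (r i) t / K :=
      div_nonneg (fiSel_nonneg l r F len ν hν0 n _ _) hK0.le
    have := fi_persp p hp (H (l i)) (H (r i)) (ν (l i) + fiSel l r F len ν n (l i) t / K)
      (ν (r i) + fiSel l r F len ν n (r i) t / K) (hH0 _) (hH0 _) (add_nonneg (hν0 _) s1)
      (add_nonneg (hν0 _) s2) (fun h => hνH _ (by linarith [hν0 (l i)]))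
      (fun h => hνH _ (by linarith [hν0 (r i)]))
    rw [← hH] at this
    convert this using 3
    rw [hν i]; ring
  induction n with
  | zero =>
    intro i t ht
    simp only [fiSel, zero_div, add_zero]
    exact mul_nonneg hc.le (by linarith [hHol i])
  | succ n ih =>
    intro i t ht
    simp only [fiSel]
    split_ifs with hs
    · have hm : 0 ≤ F i / len i := div_nonneg (hF0 i) (hlen0 i)
      have h1 := ih (l i) _ hm
      have h2 := ih (r i) _ hm
      have h3 := hcomb n i _ hm
      set t' := F i / len i
      set A := fiSel l r F len ν n (l i) t' + fiSel l r F len ν n (r i) t'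
      have hA' : A ≤ K * ν i := by
        rw [hν i]; have := hA n (l i) t' hm; have := hA n (r i) t' hm; linarith
      have hA0 : 0 ≤ A := add_nonneg (fiSel_nonneg l r F len ν hν0 n _ _)
        (fiSel_nonneg l r F len ν hν0 n _ _)
      have h4 : H i ^ p * ν i ^ (1 - p) ≤ H i ^ p *
          (fiC p K * ((ν i + A / K) ^ (1 - p) - (ν i + (ν i + A) / K) ^ (1 - p))) := by
        rcases (hν0 i).lt_or_eq with h | h
        · exact mul_le_mul_of_nonneg_left (fi_bell p K _ _ hp hK h hA0 hA')
            (rpow_nonneg (hH0 i) _)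
        · rw [hνH i h.symm, zero_rpow (by linarith)]; simp
      have h5 := mul_le_mul_of_nonneg_left h3 hc.le
      rw [hP i]
      linarith
    · have h1 := ih (l i) _ ht
      have h2 := ih (r i) _ ht
      have h5 := mul_le_mul_of_nonneg_left (hcomb n i t ht) hc.le
      rw [hP i]
      linarith

lemma fi_embed' (l r : ι → ι) (F len ν H P : ι → ℝ) (p K : ℝ) (hp : 1 < p) (hK : 1 ≤ K)
    (hν0 : ∀ i, 0 ≤ ν i) (hH0 : ∀ i, 0 ≤ H i) (hP0 : ∀ i, 0 ≤ P i) 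
    (hν : ∀ i, ν i = ν (l i) + ν (r i)) (hH : ∀ i, H i = H (l i) + H (r i))
    (hP : ∀ i, P i = P (l i) + P (r i))
    (hHol : ∀ i, H i ^ p * ν i ^ (1 - p) ≤ P i) (hνH : ∀ i, ν i = 0 → H i = 0)
    (hlen0 : ∀ i, 0 ≤ len i) (hF0 : ∀ i, 0 ≤ F i)
    (hFlen : ∀ i, len i = 0 → F i = 0)
    (hF : ∀ i, F i = F (l i) + F (r i))
    (hA : ∀ n i t, 4 * (fiStop l r F len len n (l i) t + fiStop l r F len len n (r i) t) ≤ len i →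
      K * (fiStop l r F len ν n (l i) t + fiStop l r F len ν n (r i) t) ≤ (K - 1) * ν i) (n : ℕ) :
    ∀ i t, 0 ≤ t → fiSel l r F len (fun i => H i ^ p * ν i ^ (1 - p)) n i t ≤
      fiC p K * P i := by
  intro i t ht
  have hc := fiC_pos p K hp hK
  refine (fi_embed l r F len ν H P p K hp hK hν0 hH0 hP0 hν hH hP hHol hνH hlen0 hF0 ?_ n i t
    ht).trans ?_
  · intro n i t ht
    exact (fiSel_mass l r F len ν K hK hF0 hlen0 hFlen hF hA n i t ht).trans
      (mul_le_mul_of_nonneg_left (fiStop_le l r F len ν hν0 hν n i t) (by linarith))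
  · apply mul_le_mul_of_nonneg_left _ hc.le
    have := mul_nonneg (rpow_nonneg (hH0 i) p) (rpow_nonneg (add_nonneg (hν0 i) (div_nonneg (fiSel_nonneg l r F len ν hν0 n i t) (by linarith : 0 ≤ K))) (1 - p))
    linarith

lemma fi_point (p q κ F G μ ν D : ℝ) (hp : 1 < p) (hpq : p ≤ q) (hκ : 0 ≤ κ)
    (hF : 0 ≤ F) (hG : 0 ≤ G) (hμ : 0 ≤ μ) (hν : 0 ≤ ν) (hD : 0 ≤ D)
    (hcond : κ * (μ ^ (1 / q) * ν ^ ((p - 1) / p)) ≤ D)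
    (hμG : μ = 0 → G = 0) (hνF : ν = 0 → F = 0)
    (hR : G ^ (q / (q - 1)) * μ ^ (1 - q / (q - 1)) ≤ 1) :
    κ * F * G ≤ D * (F ^ p * ν ^ (1 - p) + G ^ (q / (q - 1)) * μ ^ (1 - q / (q - 1))) := by
  have hnn : 0 ≤ D * (F ^ p * ν ^ (1 - p) + G ^ (q / (q - 1)) * μ ^ (1 - q / (q - 1))) := by
    positivity
  rcases hμ.lt_or_eq with hμ | h
  swap
  · rw [hμG h.symm] at hnn ⊢; simpa using hnn
  rcases hν.lt_or_eq with hν | h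
  swap
  · rw [hνF h.symm] at hnn ⊢; simpa using hnn
  have hp0 : 0 < p := by linarith
  have hq0 : 0 < q := by linarith
  have hp1 : p - 1 ≠ 0 := by linarith
  have hq1 : q - 1 ≠ 0 := by linarith
  set x := F * ν ^ (-((p - 1) / p)) with hx
  set y := G * μ ^ (-(1 / q)) with hy
  have hx0 : 0 ≤ x := by positivity
  have hy0 : 0 ≤ y := by positivity
  have ex : x ^ p = F ^ p * ν ^ (1 - p) := by
    rw [hx, mul_rpow hF (by positivity), ← rpow_mul hν.le]
    congr 2; field_simp; ring
  have ey : y ^ (q / (q - 1)) = G ^ (q / (q - 1)) * μ ^ (1 - q / (q - 1)) := by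
    rw [hy, mul_rpow hG (by positivity), ← rpow_mul hμ.le]
    congr 2; field_simp; ring
  rw [← ey] at hR ⊢
  rw [← ex]
  have hqq : 0 < q / (q - 1) := div_pos hq0 (by linarith)
  have hpp : 0 < p / (p - 1) := div_pos hp0 (by linarith)
  have hy1 : y ≤ 1 := by
    by_contra hcon
    push Not at hcon
    exact absurd (one_lt_rpow hcon hqq) (by linarith)
  have hconj : p.HolderConjugate (p / (p - 1)) := Real.HolderConjugate.conjExponent hp
  have hY := young_inequality_of_nonneg hx0 hy0 hconj
  have hxy : x * y ≤ x ^ p + y ^ (q / (q - 1)) := by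
    refine hY.trans (add_le_add ?_ ?_)
    · exact div_le_self (by positivity) hp.le
    · refine (div_le_self (by positivity) hconj.symm.lt.le).trans ?_
      rcases hy0.lt_or_eq with hy0 | hy0
      · apply rpow_le_rpow_of_exponent_ge hy0 hy1
        rw [div_le_div_iff₀ (by linarith) (by linarith)]; linarith
      · rw [← hy0, zero_rpow hqq.ne', zero_rpow hpp.ne']
  have e : κ * F * G = κ * (μ ^ (1 / q) * ν ^ ((p - 1) / p)) * (x * y) := by
    rw [hx, hy]
    have a1 : μ ^ (1 / q) * μ ^ (-(1 / q)) = 1 := by rw [← rpow_add hμ]; simp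
    have a2 : ν ^ ((p - 1) / p) * ν ^ (-((p - 1) / p)) = 1 := by rw [← rpow_add hν]; simp
    calc κ * F * G = κ * F * G * (μ ^ (1 / q) * μ ^ (-(1 / q))) * (ν ^ ((p - 1) / p) * ν ^ (-((p - 1) / p))) := by rw [a1, a2]; ring
      _ = _ := by ring
  rw [e]
  exact mul_le_mul hcond hxy (by positivity) hD

end Core

section Grid

/-- side length of the cells of generation `k` -/
noncomputable def fiδ (k : ℕ) : ℝ := 2 * π / 2 ^ k

lemma fiδ_pos (k : ℕ) : 0 < fiδ k := by unfold fiδ; positivity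

lemma fiδ_succ (k : ℕ) : fiδ (k + 1) = fiδ k / 2 := by unfold fiδ; rw [pow_succ]; field_simp

/-- a dyadic grid with shifts -/
structure FiGrid where
  s : ℕ → ℝ
  e : ℕ → ℤ
  t : ℕ → ℤ
  m0 : ℤ
  hs : ∀ k, 2 * s k = s (k + 1) + e k
  h3 : ∀ k, 3 * s k = t k
  hroot : ∀ x ∈ Ioo (0:ℝ) π, ⌊x / fiδ 0 - s 0⌋ = m0

namespace FiGrid
variable (g : FiGrid)

noncomputable def idx (k : ℕ) (x : ℝ) : ℤ := ⌊x / fiδ k - g.s k⌋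

def cell (i : ℕ × ℤ) : Set ℝ := {x | x ∈ Ioo (0:ℝ) π ∧ g.idx i.1 x = i.2}

def lc (i : ℕ × ℤ) : ℕ × ℤ := (i.1 + 1, 2 * i.2 + g.e i.1)
def rc (i : ℕ × ℤ) : ℕ × ℤ := (i.1 + 1, 2 * i.2 + g.e i.1 + 1)

lemma idx_succ (k : ℕ) (x : ℝ) :
    g.idx (k + 1) x = 2 * g.idx k x + g.e k ∨ g.idx (k + 1) x = 2 * g.idx k x + g.e k + 1 := by
  unfold idx
  have h : x / fiδ (k + 1) - g.s (k + 1) = 2 * (x / fiδ k - g.s k) + g.e k := by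
    rw [fiδ_succ]
    have := g.hs k
    have hh : x / (fiδ k / 2) = 2 * (x / fiδ k) := by rw [div_div_eq_mul_div]; ring
    rw [hh]
    linarith
  rw [h, Int.floor_add_intCast]
  set u := x / fiδ k - g.s k
  have h1 := Int.floor_le u
  have h2 := Int.lt_floor_add_one u
  have h3 : 2 * ⌊u⌋ ≤ ⌊2 * u⌋ := by rw [Int.le_floor]; push_cast; linarith
  have h4 : ⌊2 * u⌋ < 2 * ⌊u⌋ + 2 := by rw [Int.floor_lt]; push_cast; linarith
  omega

lemma idx_nested (k d : ℕ) (x y : ℝ) (h : g.idx (k + d) x = g.idx (k + d) y) :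
    g.idx k x = g.idx k y := by
  induction d with
  | zero => exact h
  | succ d ih =>
    apply ih
    have h1 := g.idx_succ (k + d) x
    have h2 := g.idx_succ (k + d) y
    rw [← add_assoc] at h
    omega

lemma cell_split (i : ℕ × ℤ) : g.cell i = g.cell (g.lc i) ∪ g.cell (g.rc i) := by
  ext x
  simp only [cell, lc, rc, mem_union, Set.mem_ofPred_eq]
  have h1 := g.idx_succ i.1 x
  constructor
  · rintro ⟨hx, h⟩
    rw [h] at h1
    rcases h1 with h1 | h1
    · exact Or.inl ⟨hx, h1⟩
    · exact Or.inr ⟨hx, h1⟩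
  · rintro (⟨hx, h⟩ | ⟨hx, h⟩)
    · exact ⟨hx, by omega⟩
    · exact ⟨hx, by omega⟩

lemma cell_disj (i : ℕ × ℤ) : Disjoint (g.cell (g.lc i)) (g.cell (g.rc i)) := by
  rw [Set.disjoint_left]
  rintro x ⟨_, h⟩ ⟨_, h'⟩
  simp only [lc, rc] at h h'
  omega

lemma measurableSet_cell (i : ℕ × ℤ) : MeasurableSet (g.cell i) := by
  have : Measurable (g.idx i.1) := by unfold idx; fun_prop
  exact measurableSet_Ioo.inter (this (measurableSet_singleton i.2))

lemma cell_subset (i : ℕ × ℤ) : g.cell i ⊆ Ioo 0 π := fun _ h => h.1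

lemma cell_root : g.cell (0, g.m0) = Ioo 0 π := by
  ext x; exact ⟨fun h => h.1, fun h => ⟨h, g.hroot x h⟩⟩

lemma cell_interval (i : ℕ × ℤ) : ∃ a b : ℝ, 0 ≤ a ∧ a ≤ b ∧ b ≤ π ∧ Ioo a b ⊆ g.cell i ∧
    g.cell i ⊆ Icc a b ∧ b - a ≤ fiδ i.1 ∧ (a < b → fiδ i.1 ≤ 6 * (b - a)) := by
  obtain ⟨k, m⟩ := i
  have hδ := fiδ_pos k
  have hpi := pi_pos
  set δ := fiδ k with hδd
  set a0 := δ * (m + g.s k) with ha0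
  set b0 := δ * (m + 1 + g.s k) with hb0
  have hab : b0 = a0 + δ := by rw [ha0, hb0]; ring
  refine ⟨max 0 (min π a0), max 0 (min π b0), le_max_left _ _, ?_, ?_, ?_, ?_, ?_, ?_⟩
  · gcongr; linarith
  · exact max_le hpi.le (min_le_left _ _)
  · rintro x ⟨h1, h2⟩
    have hx0 : 0 < x := lt_of_le_of_lt (le_max_left _ _) h1
    have h2' : x < min π b0 := by
      rcases lt_max_iff.mp h2 with h | h
      · linarith
      · exact h
    have hxp : x < π := h2'.trans_le (min_le_left _ _)
    have hxb : x < b0 := h2'.trans_le (min_le_right _ _)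
    have hxa : a0 < x := by
      have := lt_of_le_of_lt (le_max_right _ _) h1
      rcases min_lt_iff.mp this with h | h
      · linarith
      · exact h
    refine ⟨⟨hx0, hxp⟩, ?_⟩
    simp only [idx]
    rw [Int.floor_eq_iff, ← hδd]
    constructor
    · rw [le_sub_iff_add_le, le_div_iff₀ hδ]; linarith
    · rw [sub_lt_iff_lt_add, div_lt_iff₀ hδ]; linarith
  · rintro x ⟨⟨hx0, hxp⟩, hx⟩
    simp only [idx] at hx
    rw [Int.floor_eq_iff, ← hδd] at hx
    obtain ⟨h1, h2⟩ := hx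
    rw [le_sub_iff_add_le, le_div_iff₀ hδ] at h1
    rw [sub_lt_iff_lt_add, div_lt_iff₀ hδ] at h2
    constructor
    · exact max_le hx0.le ((min_le_right _ _).trans (by linarith))
    · exact le_max_of_le_right (le_min hxp.le (by linarith))
  · rcases le_total π a0 with h1 | h1 <;> rcases le_total π b0 with h2 | h2 <;>
    rcases le_total 0 a0 with h3 | h3 <;> rcases le_total 0 b0 with h4 | h4 <;>
    simp only [min_eq_left h1, min_eq_right h1, min_eq_left h2, min_eq_right h2, max_eq_left h3, max_eq_right h3, max_eq_left h4, max_eq_right h4, max_eq_right hpi.le] <;> linarith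
  · intro hlt
    have ha1 : a0 < π := by
      by_contra hcon
      push Not at hcon
      rw [min_eq_left hcon, min_eq_left (by linarith)] at hlt
      exact lt_irrefl _ hlt
    have hb1 : 0 < b0 := by
      by_contra hcon
      push Not at hcon
      rw [max_eq_left ((min_le_right _ _).trans hcon),
        max_eq_left ((min_le_right _ _).trans (by linarith))] at hlt
      exact lt_irrefl _ hlt
    have hj : a0 = δ * ((3 * m + g.t k : ℤ) : ℝ) / 3 := by
      rw [ha0]; push_cast; rw [← g.h3 k]; ring
    have hδe : δ * 2 ^ k = 2 * π := by rw [hδd]; unfold fiδ; field_simp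
    set j := 3 * m + g.t k
    have key1 : δ / 6 ≤ π - a0 := by
      have h1 : (2 * j : ℝ) < 3 * 2 ^ k := by
        rw [hj] at ha1
        have : δ * (2 * j) < δ * (3 * 2 ^ k) := by nlinarith
        exact lt_of_mul_lt_mul_left this hδ.le
      have h2 : 2 * j + 1 ≤ 3 * 2 ^ k := by
        have : 2 * j < 3 * 2 ^ k := by exact_mod_cast h1
        omega
      have h3 : (2 * j + 1 : ℝ) ≤ 3 * 2 ^ k := by exact_mod_cast h2
      rw [hj]
      have := mul_le_mul_of_nonneg_left h3 hδ.le
      nlinarith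
    have key2 : δ / 6 ≤ b0 := by
      have hb : b0 = δ * ((j : ℝ) + 3) / 3 := by rw [hab, hj]; ring
      rw [hb] at hb1 ⊢
      have h1 : (0:ℝ) < (j:ℝ) + 3 := by
        by_contra hcon
        push Not at hcon
        nlinarith
      have h2 : (0:ℤ) < j + 3 := by exact_mod_cast h1
      have h3 : (1:ℝ) ≤ (j:ℝ) + 3 := by
        have : (1:ℤ) ≤ j + 3 := by omega
        exact_mod_cast this
      nlinarith
    have key3 : δ ≤ 2 * π := by
      have : (1:ℝ) ≤ 2 ^ k := one_le_pow₀ (by norm_num)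
      nlinarith
    rw [min_eq_right ha1.le]
    rcases le_total π b0 with h2 | h2 <;> rcases le_total 0 a0 with h3 | h3 <;>
    simp only [min_eq_left h2, min_eq_right h2, max_eq_left h3, max_eq_right h3, max_eq_right hpi.le, max_eq_right hb1.le] <;> linarith

/-- the kernel is bounded below -/
lemma kernel_lb (κ : ℕ × ℤ → ℝ) (hκ : ∀ i, 0 ≤ κ i) (κ' : ℕ → ℝ) (hκ' : ∀ i, κ i = κ' i.1)
    (x y : ℝ) (d : ℕ) : ∀ (i : ℕ × ℤ) (n : ℕ), x ∈ g.cell i → y ∈ g.cell i →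
    g.idx (i.1 + d) x = g.idx (i.1 + d) y → d < n →
    κ' (i.1 + d) ≤ fiTot g.lc g.rc
      (fun i => κ i * (g.cell i).indicator 1 x * (g.cell i).indicator 1 y) n i := by
  have hnn : ∀ n i, 0 ≤ fiTot g.lc g.rc
      (fun i => κ i * (g.cell i).indicator 1 x * (g.cell i).indicator 1 y) n i := by
    intro n
    induction n with
    | zero => intro i; simp [fiTot]
    | succ n ih =>
      intro i
      simp only [fiTot]
      have h1 : 0 ≤ κ i * (g.cell i).indicator 1 x * (g.cell i).indicator 1 y :=
        mul_nonneg (mul_nonneg (hκ i) (indicator_nonneg (by simp) _))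
          (indicator_nonneg (by simp) _)
      have := ih (g.lc i); have := ih (g.rc i)
      linarith
  induction d with
  | zero =>
    intro i n hx hy _ hn
    obtain ⟨n, rfl⟩ : ∃ n', n = n' + 1 := ⟨n - 1, by omega⟩
    simp only [fiTot, indicator_of_mem hx, indicator_of_mem hy, add_zero, Pi.one_apply, mul_one]
    have := hnn n (g.lc i); have := hnn n (g.rc i); have := hκ' i
    linarith
  | succ d ih =>
    intro i n hx hy hxy hn
    obtain ⟨n, rfl⟩ : ∃ n', n = n' + 1 := ⟨n - 1, by omega⟩
    simp only [fiTot]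
    have h1 : 0 ≤ κ i * (g.cell i).indicator 1 x * (g.cell i).indicator 1 y :=
        mul_nonneg (mul_nonneg (hκ i) (indicator_nonneg (by simp) _))
          (indicator_nonneg (by simp) _)
    have e : i.1 + (d + 1) = i.1 + 1 + d := by omega
    rw [e] at hxy ⊢
    have h2 := g.idx_nested (i.1 + 1) d x y hxy
    have hx' := hx
    rw [g.cell_split] at hx'
    rcases hx' with hx' | hx'
    · have hy' : y ∈ g.cell (g.lc i) := ⟨hy.1, h2.symm.trans hx'.2⟩
      have := ih (g.lc i) n hx' hy' hxy (by omega)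
      have := hnn n (g.rc i)
      simp only [lc] at *
      linarith
    · have hy' : y ∈ g.cell (g.rc i) := ⟨hy.1, h2.symm.trans hx'.2⟩
      have := ih (g.rc i) n hx' hy' hxy (by omega)
      have := hnn n (g.lc i)
      simp only [rc] at *
      linarith

/-- the set version of `fiStop` -/
def stopSet (F len : ℕ × ℤ → ℝ) : ℕ → ℕ × ℤ → ℝ → Set ℝ
  | 0, _, _ => ∅
  | n+1, i, t => {x | (4 * t * len i < F i ∧ x ∈ g.cell i) ∨
      (¬ (4 * t * len i < F i) ∧
        x ∈ stopSet F len n (g.lc i) t ∪ stopSet F len n (g.rc i) t)}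

lemma stopSet_props (F len : ℕ × ℤ → ℝ) (n : ℕ) : ∀ i t,
    MeasurableSet (g.stopSet F len n i t) ∧ g.stopSet F len n i t ⊆ g.cell i ∧
    ∀ (μ : Measure ℝ) [IsFiniteMeasure μ], 
      fiStop g.lc g.rc F len (fun i => μ.real (g.cell i)) n i t =
      μ.real (g.stopSet F len n i t) := by
  induction n with
  | zero => intro i t; simp [stopSet, fiStop]
  | succ n ih =>
    intro i t
    obtain ⟨l1, l2, l3⟩ := ih (g.lc i) t
    obtain ⟨r1, r2, r3⟩ := ih (g.rc i) t
    by_cases h : 4 * t * len i < F i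
    · have e : g.stopSet F len (n+1) i t = g.cell i := by simp [stopSet, h]
      rw [e]
      refine ⟨g.measurableSet_cell i, le_rfl, ?_⟩
      intro μ _
      simp [fiStop, h]
    · have e : g.stopSet F len (n+1) i t =
        g.stopSet F len n (g.lc i) t ∪ g.stopSet F len n (g.rc i) t := by
        rw [stopSet]; simp only [h, false_and, not_false_eq_true, true_and, false_or]; rfl
      rw [e]
      refine ⟨l1.union r1, ?_, ?_⟩
      · rw [g.cell_split i]; exact union_subset_union l2 r2
      · intro μ _
        rw [measureReal_union ((g.cell_disj i).mono l2 r2) r1, ← l3 μ, ← r3 μ]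
        simp only [fiStop, h, if_false]

lemma measure_split (μ : Measure ℝ) [IsFiniteMeasure μ] (i : ℕ × ℤ) :
    μ.real (g.cell i) = μ.real (g.cell (g.lc i)) + μ.real (g.cell (g.rc i)) := by
  rw [g.cell_split i, measureReal_union (g.cell_disj i) (g.measurableSet_cell _)]

end FiGrid

/-- the standard grid -/
noncomputable def fiGrid0 : FiGrid where
  s := fun _ => 0
  e := fun _ => 0
  t := fun _ => 0
  m0 := 0
  hs := by simp
  h3 := by simp
  hroot := by
    intro x hx
    rw [Int.floor_eq_iff]
    unfold fiδ
    have := pi_pos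
    have := hx.1
    have := hx.2
    constructor
    · simp; positivity
    · simp only [pow_zero, div_one, sub_zero, Int.cast_zero, zero_add]
      rw [div_lt_one (by positivity)]; linarith

/-- the shifted grid -/
noncomputable def fiGrid1 : FiGrid where
  s := fun k => if Even k then 2/3 else 1/3
  e := fun k => if Even k then 1 else 0
  t := fun k => if Even k then 2 else 1
  m0 := -1
  hs := by
    intro k
    by_cases h : Even k
    · have : ¬ Even (k+1) := by simpa [Nat.even_add_one] using h
      simp only [h, this]; norm_num
    · have : Even (k+1) := by simpa [Nat.even_add_one] using h
      simp only [h, this]; norm_num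
  h3 := by
    intro k
    by_cases h : Even k
    · simp only [h]; norm_num
    · simp only [h]; norm_num
  hroot := by
    intro x hx
    rw [Int.floor_eq_iff]
    unfold fiδ
    have := pi_pos
    have := hx.1
    have := hx.2
    have h1 : 0 < x / (2 * π) := by positivity
    have h2 : x / (2 * π) < 1 / 2 := by rw [div_lt_div_iff₀ (by positivity) (by norm_num)]; linarith
    simp only [pow_zero, div_one, Even.zero, if_true]
    push_cast
    constructor <;> linarith

lemma fi_third (u v : ℝ) (h : |u - v| < 1/3) (s : ℝ) (hs : s = 1/3 ∨ s = 2/3) :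
    ⌊u⌋ = ⌊v⌋ ∨ ⌊u - s⌋ = ⌊v - s⌋ := by
  wlog huv : u ≤ v generalizing u v
  · rcases this v u (by rwa [abs_sub_comm]) (by linarith) with h | h
    · exact Or.inl h.symm
    · exact Or.inr h.symm
  by_contra hcon
  push Not at hcon
  obtain ⟨h1, h2⟩ := hcon
  have a1 : ⌊u⌋ < ⌊v⌋ := lt_of_le_of_ne (Int.floor_le_floor huv) h1
  have a2 : ⌊u - s⌋ < ⌊v - s⌋ := lt_of_le_of_ne (Int.floor_le_floor (by linarith)) h2
  have b1 : u < ⌊v⌋ := Int.floor_lt.mp a1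
  have b2 : u - s < ⌊v - s⌋ := Int.floor_lt.mp a2
  have c1 := Int.floor_le v
  have c2 := Int.floor_le (v - s)
  rw [abs_lt] at h
  obtain ⟨h3, h4⟩ := h
  set m := ⌊v⌋
  set m' := ⌊v - s⌋
  have d1 : (3 * (m' - m) : ℝ) + 3 * s < 1 := by linarith
  have d2 : -1 < (3 * (m' - m) : ℝ) + 3 * s := by linarith
  rcases hs with rfl | rfl
  · have e1 : (3 * (m' - m) : ℝ) < 0 := by linarith
    have e2 : (-2 : ℝ) < (3 * (m' - m) : ℝ) := by linarith
    have e1' : 3 * (m' - m) < 0 := by exact_mod_cast e1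
    have e2' : -2 < 3 * (m' - m) := by exact_mod_cast e2
    omega
  · have e1 : (3 * (m' - m) : ℝ) < -1 := by linarith
    have e2 : (-3 : ℝ) < (3 * (m' - m) : ℝ) := by linarith
    have e1' : 3 * (m' - m) < -1 := by exact_mod_cast e1
    have e2' : -3 < 3 * (m' - m) := by exact_mod_cast e2
    omega

lemma fi_same_cell (x y : ℝ) (k : ℕ) (h : |x - y| < fiδ k / 3) :
    fiGrid0.idx k x = fiGrid0.idx k y ∨ fiGrid1.idx k x = fiGrid1.idx k y := by
  unfold FiGrid.idx fiGrid0 fiGrid1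
  simp only [sub_zero]
  apply fi_third
  · rw [← sub_div, abs_div, abs_of_pos (fiδ_pos k), div_lt_iff₀ (fiδ_pos k)]; linarith
  · by_cases h : Even k <;> simp [h]

lemma fi_scale (x y : ℝ) (hxy : x ≠ y) (hx : x ∈ Ioo (0:ℝ) π) (hy : y ∈ Ioo (0:ℝ) π) :
    ∃ k, fiδ k / 6 ≤ |x - y| ∧ 
      (fiGrid0.idx k x = fiGrid0.idx k y ∨ fiGrid1.idx k x = fiGrid1.idx k y) := by
  have hpos : 0 < |x - y| := abs_pos.mpr (sub_ne_zero.mpr hxy)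
  have hex : ∃ k, fiδ (k+1) / 3 ≤ |x - y| := by
    obtain ⟨n, hn⟩ := exists_pow_lt_of_lt_one (show 0 < |x - y| / π by have := pi_pos; positivity)
      (show (1/2 : ℝ) < 1 by norm_num)
    refine ⟨n, ?_⟩
    unfold fiδ
    have := pi_pos
    rw [lt_div_iff₀ pi_pos] at hn
    rw [one_div, inv_pow] at hn
    have e : 2 * π / 2 ^ (n+1) = (2 ^ n)⁻¹ * π := by rw [pow_succ]; field_simp
    rw [e]
    have : 0 < (2 ^ n)⁻¹ * π := by positivity
    linarith
  classical
  refine ⟨Nat.find hex, ?_, ?_⟩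
  · have := Nat.find_spec hex
    rw [fiδ_succ] at this
    linarith
  · rcases Nat.eq_zero_or_pos (Nat.find hex) with h | h
    · rw [h]
      left
      exact (fiGrid0.hroot x hx).trans (fiGrid0.hroot y hy).symm
    · apply fi_same_cell
      have := Nat.find_min hex (m := Nat.find hex - 1) (by omega)
      rw [Nat.sub_add_cancel h] at this
      exact not_le.mp this

end Grid

section Meas

lemma fi_core {ι : Type} (l r : ι → ι) (F G len κ δ μ ν P R : ι → ℝ) (ρ p q K1 K2 D : ℝ)
    (hρ0 : 0 ≤ ρ) (hρ1 : ρ < 1) (hp : 1 < p) (hpq : p ≤ q) (hK1 : 1 ≤ K1) (hK2 : 1 ≤ K2)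
    (hD : 0 ≤ D)
    (hF0 : ∀ i, 0 ≤ F i) (hG0 : ∀ i, 0 ≤ G i) (hlen0 : ∀ i, 0 ≤ len i) (hκ : ∀ i, 0 ≤ κ i)
    (hδ : ∀ i, 0 ≤ δ i) (hμ0 : ∀ i, 0 ≤ μ i) (hν0 : ∀ i, 0 ≤ ν i) (hP0 : ∀ i, 0 ≤ P i)
    (hR0 : ∀ i, 0 ≤ R i)
    (hF : ∀ i, F i = F (l i) + F (r i))
    (hG : ∀ i, G i = G (l i) + G (r i))
    (hμ : ∀ i, μ i = μ (l i) + μ (r i))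
    (hν : ∀ i, ν i = ν (l i) + ν (r i))
    (hP : ∀ i, P i = P (l i) + P (r i))
    (hR : ∀ i, R i = R (l i) + R (r i))
    (hl : ∀ i, κ (l i) * δ (l i) = ρ * (κ i * δ i)) (hr : ∀ i, κ (r i) * δ (r i) = ρ * (κ i * δ i))
    (hlenδ : ∀ i, len i ≤ δ i) (hδlen : ∀ i, 0 < len i → δ i ≤ 6 * len i)
    (hFlen : ∀ i, len i = 0 → F i = 0)
    (hHolF : ∀ i, F i ^ p ≤ P i * ν i ^ (p - 1))
    (hHolG : ∀ i, G i ^ (q / (q - 1)) ≤ R i * μ i ^ (q / (q - 1) - 1))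
    (hP1 : ∀ i, P i ≤ 1) (hR1 : ∀ i, R i ≤ 1)
    (hcond : ∀ i, κ i * (μ i ^ (1 / q) * ν i ^ ((p - 1) / p)) ≤ D)
    (hA1 : ∀ n i t, 4 * (fiStop l r F len len n (l i) t + fiStop l r F len len n (r i) t) ≤ len i →
      K1 * (fiStop l r F len ν n (l i) t + fiStop l r F len ν n (r i) t) ≤ (K1 - 1) * ν i)
    (hA2 : ∀ n i t, 4 * (fiStop l r F len len n (l i) t + fiStop l r F len len n (r i) t) ≤ len i →
      K2 * (fiStop l r F len μ n (l i) t + fiStop l r F len μ n (r i) t) ≤ (K2 - 1) * μ i)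
    (n : ℕ) (i : ι) :
    fiTot l r (fun i => κ i * F i * G i) n i ≤
      (1 + 6 * (4 / (1 - ρ))) * (D * (fiC p K1 + fiC (q / (q - 1)) K2)) := by
  have hq1 : 1 < q := by linarith
  have hq' : 1 < q / (q - 1) := by rw [lt_div_iff₀ (by linarith)]; linarith
  have key : ∀ (s : ℝ), 1 < s → ∀ X Y Z : ℝ, 0 ≤ X → 0 ≤ Y → 0 ≤ Z → X ^ s ≤ Y * Z ^ (s - 1) →
      X ^ s * Z ^ (1 - s) ≤ Y ∧ (Z = 0 → X = 0) := by
    intro s hs X Y Z hX hY hZ h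
    have hz : Z = 0 → X = 0 := by
      intro h0
      rw [h0, zero_rpow (by linarith), mul_zero] at h
      have : X ^ s = 0 := le_antisymm h (rpow_nonneg hX _)
      exact (rpow_eq_zero hX (by linarith)).mp this
    refine ⟨?_, hz⟩
    rcases hZ.lt_or_eq with h0 | h0
    · calc X ^ s * Z ^ (1 - s) ≤ Y * Z ^ (s - 1) * Z ^ (1 - s) := by gcongr
        _ = Y := by rw [mul_assoc, ← rpow_add h0]; simp
    · rw [hz h0.symm, zero_rpow (by linarith)]; simpa using hY
  have kF := fun i => key p hp (F i) (P i) (ν i) (hF0 i) (hP0 i) (hν0 i) (hHolF i)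
  have kG := fun i => key _ hq' (G i) (R i) (μ i) (hG0 i) (hR0 i) (hμ0 i) (hHolG i)
  have h1 := fiTot_le l r F G len κ δ ρ hρ0 hρ1 hF0 hG0 hlen0 hκ hδ hG hl hr hlenδ hδlen hFlen
    n i 0 le_rfl
  have h2 := fiSel_le l r F len (fun i => κ i * F i * G i) (fun i => F i ^ p * ν i ^ (1 - p))
    (fun i => G i ^ (q / (q - 1)) * μ i ^ (1 - q / (q - 1))) D (fun i =>
      fi_point p q (κ i) (F i) (G i) (μ i) (ν i) D hp hpq (hκ i) (hF0 i) (hG0 i) (hμ0 i) (hν0 i)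
        hD (hcond i) (kG i).2 (kF i).2 ((kG i).1.trans (hR1 i))) n i 0
  have h3 := fi_embed' l r F len ν F P p K1 hp hK1 hν0 hF0 hP0 hν hF hP (fun i => (kF i).1)
    (fun i => (kF i).2) hlen0 hF0 hFlen hF hA1 n i 0 le_rfl
  have h4 := fi_embed' l r F len μ G R (q / (q - 1)) K2 hq' hK2 hμ0 hG0 hR0 hμ hG hR
    (fun i => (kG i).1) (fun i => (kG i).2) hlen0 hF0 hFlen hF hA2 n i 0 le_rfl
  have c1 := (fiC_pos p K1 hp hK1).le
  have c2 := (fiC_pos (q / (q - 1)) K2 hq' hK2).le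
  have h3' := h3.trans (mul_le_of_le_one_right c1 (hP1 i))
  have h4' := h4.trans (mul_le_of_le_one_right c2 (hR1 i))
  have hC : 0 ≤ 4 / (1 - ρ) := div_nonneg (by norm_num) (by linarith)
  rw [mul_zero, zero_mul, zero_add] at h1
  refine h1.trans (mul_le_mul_of_nonneg_left (h2.trans ?_) (by linarith))
  exact mul_le_mul_of_nonneg_left (add_le_add h3' h4') hD

/-- measure on `(0,π)` with density `d` -/
noncomputable def fiM (d : ℝ → ENNReal) : Measure ℝ :=
  (volume.restrict (Ioo (0:ℝ) π)).withDensity d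

lemma fiM_finite (d : ℝ → ENNReal) (h : ∫⁻ x in Ioo (0:ℝ) π, d x ≠ ⊤) :
    IsFiniteMeasure (fiM d) := isFiniteMeasure_withDensity h

lemma fiM_ac (d : ℝ → ENNReal) : fiM d ≪ volume :=
  (withDensity_absolutelyContinuous _ _).trans Measure.restrict_le_self.absolutelyContinuous

lemma fi_holder_enn (p : ℝ) (hp : 1 < p) (dF dP dν : ℝ → ENNReal)
    (hP : Measurable dP) (hν : Measurable dν)
    (h : ∀ᵐ x ∂(volume.restrict (Ioo (0:ℝ) π)), dF x = dP x ^ (1 / p) * dν x ^ ((p - 1) / p))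
    (Q : Set ℝ) (hQ : MeasurableSet Q) :
    fiM dF Q ≤ fiM dP Q ^ (1 / p) * fiM dν Q ^ ((p - 1) / p) := by
  unfold fiM
  rw [withDensity_apply _ hQ, withDensity_apply _ hQ, withDensity_apply _ hQ]
  have hp0 : p ≠ 0 := by linarith
  have hp1 : p - 1 ≠ 0 := by linarith
  have h' : ∀ᵐ x ∂((volume.restrict (Ioo (0:ℝ) π)).restrict Q),
      dF x = dP x ^ (1 / p) * dν x ^ ((p - 1) / p) := ae_restrict_of_ae h
  rw [lintegral_congr_ae h']
  have hconj : p.HolderConjugate (p / (p - 1)) := Real.HolderConjugate.conjExponent hp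
  have := ENNReal.lintegral_mul_le_Lp_mul_Lq ((volume.restrict (Ioo (0:ℝ) π)).restrict Q) hconj
    (f := fun x => dP x ^ (1 / p)) (g := fun x => dν x ^ ((p - 1) / p))
    (by fun_prop) (by fun_prop)
  simp only [Pi.mul_apply, ← ENNReal.rpow_mul] at this
  rw [show 1 / p * p = 1 by field_simp, show (p - 1) / p * (p / (p - 1)) = 1 by field_simp,
    show 1 / (p / (p - 1)) = (p - 1) / p by field_simp] at this
  simpa using this

lemma fi_holder (p : ℝ) (hp : 1 < p) (dF dP dν : ℝ → ENNReal)
    (hP : Measurable dP) (hν : Measurable dν)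
    (h : ∀ᵐ x ∂(volume.restrict (Ioo (0:ℝ) π)), dF x = dP x ^ (1 / p) * dν x ^ ((p - 1) / p))
    [IsFiniteMeasure (fiM dP)] [IsFiniteMeasure (fiM dν)]
    (Q : Set ℝ) (hQ : MeasurableSet Q) :
    (fiM dF).real Q ^ p ≤ (fiM dP).real Q * (fiM dν).real Q ^ (p - 1) := by
  have h1 := fi_holder_enn p hp dF dP dν hP hν h Q hQ
  have hp0 : p ≠ 0 := by linarith
  have h2 := ENNReal.toReal_mono (ENNReal.mul_ne_top
    (ENNReal.rpow_ne_top_of_nonneg (by positivity) (measure_ne_top _ _))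
    (ENNReal.rpow_ne_top_of_nonneg (div_nonneg (by linarith) (by linarith)) (measure_ne_top _ _))) h1
  rw [ENNReal.toReal_mul, ← ENNReal.toReal_rpow, ← ENNReal.toReal_rpow] at h2
  change (fiM dF).real Q ≤ (fiM dP).real Q ^ (1 / p) * (fiM dν).real Q ^ ((p - 1) / p) at h2
  calc (fiM dF).real Q ^ p ≤ ((fiM dP).real Q ^ (1 / p) * (fiM dν).real Q ^ ((p - 1) / p)) ^ p := by
        apply rpow_le_rpow measureReal_nonneg h2 (by linarith)
    _ = _ := by
        rw [mul_rpow (by positivity) (by positivity), ← rpow_mul measureReal_nonneg,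
          ← rpow_mul measureReal_nonneg]
        rw [show 1 / p * p = 1 by field_simp, show (p - 1) / p * p = p - 1 by field_simp, rpow_one]

lemma fi_holder_fin (p : ℝ) (hp : 1 < p) (dF dP dν : ℝ → ENNReal)
    (hP : Measurable dP) (hν : Measurable dν)
    (h : ∀ᵐ x ∂(volume.restrict (Ioo (0:ℝ) π)), dF x = dP x ^ (1 / p) * dν x ^ ((p - 1) / p))
    [IsFiniteMeasure (fiM dP)] [IsFiniteMeasure (fiM dν)] : IsFiniteMeasure (fiM dF) := by
  refine ⟨lt_of_le_of_lt (fi_holder_enn p hp dF dP dν hP hν h univ MeasurableSet.univ) ?_⟩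
  have hp0 : p ≠ 0 := by linarith
  exact (ENNReal.mul_ne_top
    (ENNReal.rpow_ne_top_of_nonneg (by positivity) (measure_ne_top _ _))
    (ENNReal.rpow_ne_top_of_nonneg (div_nonneg (by linarith) (by linarith))
    (measure_ne_top _ _))).lt_top

lemma fiM_int (u : ℝ → ℝ) (hpos : ∀ᵐ θ ∂(volume.restrict (Ioo (0:ℝ) π)), 0 < u θ)
    (hum : Measurable u) (a b : ℝ) (ha : 0 ≤ a) (hb : b ≤ π) :
    ∫ θ in Ioo a b, u θ = (fiM (fun x => ENNReal.ofReal (u x))).real (Ioo a b) := by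
  have hsub : Ioo a b ⊆ Ioo 0 π := Ioo_subset_Ioo ha hb
  have hp' : ∀ᵐ θ ∂(volume.restrict (Ioo a b)), 0 ≤ u θ :=
    (ae_restrict_of_ae_restrict_of_subset hsub hpos).mono fun x hx => hx.le
  rw [integral_eq_lintegral_of_nonneg_ae hp' hum.aestronglyMeasurable]
  unfold fiM Measure.real
  rw [withDensity_apply _ measurableSet_Ioo, Measure.restrict_restrict measurableSet_Ioo,
    inter_eq_left.mpr hsub]

lemma fi_ainf (u : ℝ → ℝ) (hum : Measurable u)
    (hpos : ∀ᵐ θ ∂(volume.restrict (Ioo (0:ℝ) π)), 0 < u θ) (hA : MuckenhouptAinf u) :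
    IsFiniteMeasure (fiM (fun x => ENNReal.ofReal (u x))) ∧
    ∃ K : ℝ, 1 ≤ K ∧ ∀ a b : ℝ, 0 ≤ a → a ≤ b → b ≤ π → ∀ U : Set ℝ, MeasurableSet U →
      U ⊆ Icc a b → 4 * (fiM 1).real U ≤ b - a →
      K * (fiM (fun x => ENNReal.ofReal (u x))).real U ≤
        (K - 1) * (fiM (fun x => ENNReal.ofReal (u x))).real (Ioo a b) := by
  obtain ⟨r, hr, C, hC⟩ := hA
  set m := fiM (fun x => ENNReal.ofReal (u x)) with hm
  set u' := fun θ => u θ ^ (-(1/(r-1))) with hu'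
  have hum' : Measurable u' := by fun_prop
  have hpos' : ∀ᵐ θ ∂(volume.restrict (Ioo (0:ℝ) π)), 0 < u' θ :=
    hpos.mono fun x hx => rpow_pos_of_pos hx _
  have hfin1 : IsFiniteMeasure m := by
    apply fiM_finite
    exact (hC 0 π le_rfl pi_pos le_rfl).1.lintegral_lt_top.ne
  set m' := fiM (fun x => ENNReal.ofReal (u' x)) with hm'
  have hfin2 : IsFiniteMeasure m' := by
    apply fiM_finite
    exact (hC 0 π le_rfl pi_pos le_rfl).2.1.lintegral_lt_top.ne
  have hfin3 : IsFiniteMeasure (fiM 1) := by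
    apply fiM_finite; simp
  have hr0 : r ≠ 0 := by linarith
  have hr1 : r - 1 ≠ 0 := by linarith
  have hHol := fi_holder r hr 1 (fun x => ENNReal.ofReal (u x)) (fun x => ENNReal.ofReal (u' x))
    (by fun_prop) (by fun_prop) (by
      filter_upwards [hpos] with x hx
      rw [ENNReal.ofReal_rpow_of_pos hx, ENNReal.ofReal_rpow_of_pos (rpow_pos_of_pos hx _),
        ← ENNReal.ofReal_mul (by positivity)]
      rw [← rpow_mul hx.le, ← rpow_add hx]
      rw [show 1 / r + -(1 / (r - 1)) * ((r - 1) / r) = 0 by field_simp; ring]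
      simp)
  refine ⟨hfin1, max 1 (C * (4/3) ^ r), le_max_left _ _, ?_⟩
  intro a b ha hab hb U hU hUI hU4
  set K := max 1 (C * (4/3) ^ r) with hKdef
  have hK1 : 1 ≤ K := le_max_left _ _
  have hIcc : ∀ (d : ℝ → ENNReal) [IsFiniteMeasure (fiM d)],
      (fiM d).real (Icc a b) = (fiM d).real (Ioo a b) := by
    intro d _
    exact measureReal_congr ((fiM_ac d).ae_eq Ioo_ae_eq_Icc.symm)
  have hUm : m.real U = m.real (Ioo a b) - m.real (Icc a b \ U) := by
    rw [measureReal_diff hUI hU, hIcc]; ring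
  rcases hab.lt_or_eq with hlt | heq
  swap
  · have h0 : m.real (Ioo a b) = 0 := by rw [heq]; simp
    have h1 : m.real U = 0 := le_antisymm
      ((measureReal_mono hUI).trans (by rw [hIcc, h0])) measureReal_nonneg
    rw [h0, h1]; simp
  obtain ⟨_, _, hc⟩ := hC a b ha hlt hb
  rw [fiM_int u hpos hum a b ha hb, fiM_int u' hpos' hum' a b ha hb] at hc
  have hlen : (fiM 1).real (Ioo a b) = b - a := by
    unfold fiM Measure.real
    rw [withDensity_one, Measure.restrict_apply measurableSet_Ioo,
      inter_eq_left.mpr (Ioo_subset_Ioo ha hb), Real.volume_Ioo, ENNReal.toReal_ofReal (by linarith)]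
  set E := Icc a b \ U with hE
  have hEm : MeasurableSet E := measurableSet_Icc.diff hU
  have h1 := hHol E hEm
  have hEl : 3 / 4 * (b - a) ≤ (fiM 1).real E := by
    rw [hE, measureReal_diff hUI hU, hIcc, hlen]; linarith
  have h2 : m'.real E ≤ m'.real (Ioo a b) := by
    rw [← hIcc]; exact measureReal_mono diff_subset
  set d := b - a with hd
  have hd0 : 0 < d := by rw [hd]; linarith
  set A := m.real (Ioo a b)
  set B := m'.real (Ioo a b)
  have hA0 : 0 ≤ A := measureReal_nonneg
  have hB0 : 0 ≤ B := measureReal_nonneg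
  have hE0 : 0 ≤ m.real E := measureReal_nonneg
  have h3 : (3 / 4 * d) ^ r ≤ m.real E * B ^ (r - 1) := by
    calc (3 / 4 * d) ^ r ≤ (fiM 1).real E ^ r := by gcongr
      _ ≤ m.real E * m'.real E ^ (r - 1) := h1
      _ ≤ _ := by gcongr
  have h4 : A * B ^ (r - 1) ≤ C * d ^ r := by
    rw [mul_rpow (by positivity) hB0, inv_rpow hd0.le] at hc
    have e : d ^ r = d * d ^ (r - 1) := by
      rw [← rpow_one_add' hd0.le (by linarith)]; congr 1; ring
    have hpp : 0 < d ^ (r - 1) := rpow_pos_of_pos hd0 _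
    rw [e]
    have e2 : d⁻¹ * A * ((d ^ (r - 1))⁻¹ * B ^ (r - 1)) = A * B ^ (r - 1) / (d * d ^ (r - 1)) := by
      field_simp
    rw [e2, div_le_iff₀ (by positivity)] at hc
    exact hc
  have h5 : A ≤ K * m.real E := by
    have h6 : (3/4) ^ r * d ^ r * A ≤ m.real E * (C * d ^ r) := by
      rw [← mul_rpow (by norm_num) hd0.le]
      calc (3/4 * d) ^ r * A ≤ m.real E * B ^ (r - 1) * A := by gcongr
        _ = m.real E * (A * B ^ (r - 1)) := by ring
        _ ≤ _ := by gcongr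
    have hdr : 0 < d ^ r := rpow_pos_of_pos hd0 _
    have h7 : (3/4 : ℝ) ^ r * A ≤ m.real E * C := by
      have : d ^ r * ((3/4) ^ r * A) ≤ d ^ r * (m.real E * C) := by linarith
      exact le_of_mul_le_mul_left this hdr
    have h8 : (4/3 : ℝ) ^ r * (3/4) ^ r = 1 := by
      rw [← mul_rpow (by norm_num) (by norm_num)]; norm_num
    calc A = (4/3 : ℝ) ^ r * ((3/4) ^ r * A) := by rw [← mul_assoc, h8, one_mul]
      _ ≤ (4/3 : ℝ) ^ r * (m.real E * C) := by gcongr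
      _ = (C * (4/3) ^ r) * m.real E := by ring
      _ ≤ K * m.real E := by gcongr; exact le_max_right _ _
  rw [hUm]
  nlinarith

lemma fi_integral_tot (g : FiGrid) (m : Measure ℝ) [IsFiniteMeasure m] (c : ℕ × ℤ → ℝ) (n : ℕ) :
    ∀ i, Measurable (fun x => fiTot g.lc g.rc (fun i => c i * (g.cell i).indicator 1 x) n i) ∧
      Integrable (fun x => fiTot g.lc g.rc (fun i => c i * (g.cell i).indicator 1 x) n i) m ∧
      (∃ B : ℝ, ∀ x, fiTot g.lc g.rc (fun i => c i * (g.cell i).indicator 1 x) n i ≤ B) ∧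
      ∫ x, fiTot g.lc g.rc (fun i => c i * (g.cell i).indicator 1 x) n i ∂m =
        fiTot g.lc g.rc (fun i => c i * m.real (g.cell i)) n i := by
  induction n with
  | zero => intro i; simp only [fiTot]; simp; exact ⟨0, le_rfl⟩
  | succ n ih =>
    intro i
    simp only [fiTot]
    obtain ⟨l1, l2, ⟨Bl, l3⟩, l4⟩ := ih (g.lc i)
    obtain ⟨r1, r2, ⟨Br, r3⟩, r4⟩ := ih (g.rc i)
    have hmi : Measurable ((g.cell i).indicator (1 : ℝ → ℝ)) :=
      measurable_one.indicator (g.measurableSet_cell i)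
    have h0 : Integrable ((g.cell i).indicator (1 : ℝ → ℝ)) m :=
      (integrable_const (1:ℝ)).indicator (g.measurableSet_cell i)
    refine ⟨(hmi.const_mul _).add (l1.add r1), (h0.const_mul _).add (l2.add r2),
      ⟨|c i| + (Bl + Br), ?_⟩, ?_⟩
    · intro x
      have : c i * (g.cell i).indicator 1 x ≤ |c i| := by
        by_cases h : x ∈ g.cell i
        · simp [h, le_abs_self]
        · simp [h]
      exact add_le_add this (add_le_add (l3 x) (r3 x))
    · have l2r2 := l2.add r2
      simp only [Pi.add_def] at l2r2
      rw [integral_add (h0.const_mul _) l2r2, integral_add l2 r2, l4, r4, integral_const_mul,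
        integral_indicator_one (g.measurableSet_cell i)]

lemma fiTot_nonneg {ι : Type} (l r : ι → ι) (φ : ι → ℝ) (h : ∀ i, 0 ≤ φ i) (n : ℕ) :
    ∀ i, 0 ≤ fiTot l r φ n i := by
  induction n with
  | zero => intro i; simp [fiTot]
  | succ n ih =>
    intro i; simp only [fiTot]
    have := h i; have := ih (l i); have := ih (r i); linarith

lemma fiTot_mono_n {ι : Type} (l r : ι → ι) (φ : ι → ℝ) (h : ∀ i, 0 ≤ φ i) (n : ℕ) :
    ∀ i, fiTot l r φ n i ≤ fiTot l r φ (n + 1) i := by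
  induction n with
  | zero => intro i; exact fiTot_nonneg l r φ h 1 i
  | succ n ih =>
    intro i
    have := ih (l i); have := ih (r i)
    simp only [fiTot] at *
    linarith

end Meas

section MainProof

lemma fiM_cell (g : FiGrid) (i : ℕ × ℤ) (a b : ℝ) (h1 : Ioo a b ⊆ g.cell i)
    (h2 : g.cell i ⊆ Icc a b) (d : ℝ → ENNReal) :
    (fiM d).real (g.cell i) = (fiM d).real (Ioo a b) := by
  have e : fiM d (Icc a b) = fiM d (Ioo a b) :=
    measure_congr ((fiM_ac d).ae_eq Ioo_ae_eq_Icc.symm)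
  unfold Measure.real
  congr 1
  exact le_antisymm ((measure_mono h2).trans e.le) (measure_mono h1)

lemma fiM_one_Ioo (a b : ℝ) (ha : 0 ≤ a) (hab : a ≤ b) (hb : b ≤ π) :
    (fiM 1).real (Ioo a b) = b - a := by
  unfold fiM Measure.real
  rw [withDensity_one, Measure.restrict_apply measurableSet_Ioo,
    inter_eq_left.mpr (Ioo_subset_Ioo ha hb), Real.volume_Ioo, ENNReal.toReal_ofReal (by linarith)]

lemma fiM_Ioo (d : ℝ → ENNReal) (a b : ℝ) (ha : 0 ≤ a) (hb : b ≤ π) :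
    fiM d (Ioo a b) = ∫⁻ x in Ioo a b, d x := by
  unfold fiM
  rw [withDensity_apply _ measurableSet_Ioo, Measure.restrict_restrict measurableSet_Ioo,
    inter_eq_left.mpr (Ioo_subset_Ioo ha hb)]

lemma fiM_univ (d : ℝ → ENNReal) : fiM d univ = ∫⁻ x in Ioo (0:ℝ) π, d x := by
  unfold fiM
  rw [withDensity_apply _ MeasurableSet.univ, Measure.restrict_univ]

/-- discretised fractional integral attached to a grid -/
noncomputable def fiT (g : FiGrid) (σ : ℝ) (f : ℝ → ℝ) (n : ℕ) (x : ℝ) : ℝ :=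
  fiTot g.lc g.rc (fun i => (fiδ i.1 ^ (σ - 1) *
    (fiM (fun y => ENNReal.ofReal (f y))).real (g.cell i)) * (g.cell i).indicator 1 x) n (0, g.m0)

lemma fi_f_dens (p : ℝ) (hp : 1 < p) (v f : ℝ → ℝ)
    (hvpos : ∀ᵐ θ ∂(volume.restrict (Ioo (0:ℝ) π)), 0 < v θ) :
    ∀ᵐ x ∂(volume.restrict (Ioo (0:ℝ) π)), ENNReal.ofReal (f x) =
      (ENNReal.ofReal (f x) ^ p * ENNReal.ofReal (v x)) ^ (1 / p) *
      ENNReal.ofReal (v x ^ (-(1/(p-1)))) ^ ((p - 1) / p) := by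
  filter_upwards [hvpos] with x hx
  have hp0 : p ≠ 0 := by linarith
  have hp1 : p - 1 ≠ 0 := by linarith
  rw [ENNReal.mul_rpow_of_nonneg _ _ (by positivity), ← ENNReal.rpow_mul,
    show p * (1 / p) = 1 by field_simp, ENNReal.rpow_one, mul_assoc,
    ENNReal.ofReal_rpow_of_pos hx, ENNReal.ofReal_rpow_of_pos (rpow_pos_of_pos hx _),
    ← ENNReal.ofReal_mul (by positivity), ← rpow_mul hx.le, ← rpow_add hx,
    show 1 / p + -(1 / (p - 1)) * ((p - 1) / p) = 0 by field_simp; ring]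
  simp

lemma fi_grid (σ p q : ℝ) (hσ0 : 0 < σ) (_hσ1 : σ < 1)
    (hp : 1 < p) (hpq : p ≤ q) (w v : ℝ → ℝ) (hwm : Measurable w) (hvm : Measurable v)
    (hwpos : ∀ᵐ θ ∂(volume.restrict (Ioo (0:ℝ) π)), 0 < w θ)
    (hvpos : ∀ᵐ θ ∂(volume.restrict (Ioo (0:ℝ) π)), 0 < v θ)
    (hwA : MuckenhouptAinf w) (hvA : MuckenhouptAinf (fun θ => v θ ^ (-(1/(p-1)))))
    (C' : ℝ) (hC' : 0 < C') (hc : ∀ a b : ℝ, 0 ≤ a → a ≤ b → b ≤ π →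
        (∫⁻ θ in Ioo a b, ENNReal.ofReal (w θ)) ^ (1/q) *
          (∫⁻ θ in Ioo a b, ENNReal.ofReal (v θ ^ (-(1/(p-1))))) ^ ((p-1)/p) ≤
          ENNReal.ofReal (C' * (b - a) ^ (1-σ))) (g : FiGrid) :
    ∃ C : ℝ, ∀ f : ℝ → ℝ, Measurable f → (∀ θ, 0 ≤ f θ) →
        (∫⁻ θ in Ioo (0:ℝ) π, ENNReal.ofReal (f θ) ^ p * ENNReal.ofReal (v θ)) ≤ 1 →
        IsFiniteMeasure (fiM (fun y => ENNReal.ofReal (f y))) ∧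
        ∀ n, ∫⁻ θ in Ioo (0:ℝ) π, ENNReal.ofReal (fiT g σ f n θ) ^ q * ENNReal.ofReal (w θ) ≤
          ENNReal.ofReal C := by
  have hp0 : p ≠ 0 := by linarith
  have hp1 : p - 1 ≠ 0 := by linarith
  have hq : 1 < q := by linarith
  have hq0 : q ≠ 0 := by linarith
  have hq1 : q - 1 ≠ 0 := by linarith
  have hq' : 1 < q / (q - 1) := by rw [lt_div_iff₀ (by linarith)]; linarith
  set vb := fun θ => v θ ^ (-(1/(p-1))) with hvb
  have hvbm : Measurable vb := by fun_prop
  have hvbpos : ∀ᵐ θ ∂(volume.restrict (Ioo (0:ℝ) π)), 0 < vb θ :=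
    hvpos.mono fun x hx => rpow_pos_of_pos hx _
  obtain ⟨hfinμ, K2, hK2, hA2⟩ := fi_ainf w hwm hwpos hwA
  obtain ⟨hfinν, K1, hK1, hA1⟩ := fi_ainf vb hvbm hvbpos hvA
  set μ := fiM (fun x => ENNReal.ofReal (w x)) with hμdef
  set ν := fiM (fun x => ENNReal.ofReal (vb x)) with hνdef
  have hfinL : IsFiniteMeasure (fiM 1) := by apply fiM_finite; simp
  have hσ2 : (2:ℝ) ^ (-σ) < 1 := rpow_lt_one_of_one_lt_of_neg (by norm_num) (by linarith)
  set Cc := (1 + 6 * (4 / (1 - (2:ℝ) ^ (-σ)))) * (C' * (fiC p K1 + fiC (q / (q - 1)) K2)) with hCc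
  refine ⟨Cc ^ q, ?_⟩
  intro f hfm hf0 hf1
  have hfinP : IsFiniteMeasure
      (fiM (fun θ => ENNReal.ofReal (f θ) ^ p * ENNReal.ofReal (v θ))) :=
    fiM_finite _ (hf1.trans_lt ENNReal.one_lt_top).ne
  have hdens := fi_f_dens p hp v f hvpos
  have hfinF : IsFiniteMeasure (fiM (fun y => ENNReal.ofReal (f y))) :=
    fi_holder_fin p hp _ _ _ (by fun_prop) (by fun_prop) hdens
  refine ⟨hfinF, ?_⟩
  intro n
  set mF := fiM (fun y => ENNReal.ofReal (f y)) with hmF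
  set mP := fiM (fun θ => ENNReal.ofReal (f θ) ^ p * ENNReal.ofReal (v θ)) with hmP
  obtain ⟨hTm, -, ⟨B, hTB⟩, -⟩ := fi_integral_tot g μ
    (fun i => fiδ i.1 ^ (σ - 1) * mF.real (g.cell i)) n (0, g.m0)
  change Measurable (fiT g σ f n) at hTm
  change ∀ x, fiT g σ f n x ≤ B at hTB
  have hT0 : ∀ x, 0 ≤ fiT g σ f n x := by
    intro x
    apply fiTot_nonneg
    intro i
    exact mul_nonneg (mul_nonneg (rpow_nonneg (fiδ_pos _).le _) measureReal_nonneg)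
      (indicator_nonneg (by simp) _)
  set T := fiT g σ f n with hTdef
  set X := ∫⁻ θ in Ioo (0:ℝ) π, ENNReal.ofReal (T θ) ^ q * ENNReal.ofReal (w θ) with hX
  have hXtop : X ≠ ⊤ := by
    have : X ≤ ∫⁻ θ in Ioo (0:ℝ) π, ENNReal.ofReal B ^ q * ENNReal.ofReal (w θ) := by
      apply lintegral_mono
      intro θ
      have := hTB θ
      dsimp only
      gcongr
    rw [lintegral_const_mul _ (by fun_prop)] at this
    refine ne_top_of_le_ne_top (ENNReal.mul_ne_top
      (ENNReal.rpow_ne_top_of_nonneg (by linarith) ENNReal.ofReal_ne_top) ?_) this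
    rw [← fiM_univ]
    exact measure_ne_top _ _
  rcases eq_or_ne X 0 with hX0 | hX0
  · rw [hX0]; exact zero_le
  have hXr : 0 < X.toReal := ENNReal.toReal_pos hX0 hXtop
  set c := X.toReal ^ (-((q - 1) / q)) with hcdef
  have hc0 : 0 < c := rpow_pos_of_pos hXr _
  set γ := fun x => ENNReal.ofReal (c * T x ^ (q - 1)) with hγ
  have hγm : Measurable γ := by fun_prop
  have hRint : ∫⁻ x in Ioo (0:ℝ) π, γ x ^ (q / (q - 1)) * ENNReal.ofReal (w x) = 1 := by
    have e : ∀ x, γ x ^ (q / (q - 1)) * ENNReal.ofReal (w x) =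
        ENNReal.ofReal (X.toReal⁻¹) * (ENNReal.ofReal (T x) ^ q * ENNReal.ofReal (w x)) := by
      intro x
      rw [← mul_assoc]
      congr 1
      rw [hγ]
      simp only
      rw [ENNReal.ofReal_rpow_of_nonneg (by have := hT0 x; positivity) (by linarith),
        ENNReal.ofReal_rpow_of_nonneg (hT0 x) (by linarith), ← ENNReal.ofReal_mul (by positivity)]
      congr 1
      rw [mul_rpow hc0.le (rpow_nonneg (hT0 x) _), ← rpow_mul (hT0 x), hcdef, ← rpow_mul hXr.le,
        show (q - 1) * (q / (q - 1)) = q by field_simp,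
        show -((q - 1) / q) * (q / (q - 1)) = -1 by field_simp, rpow_neg_one]
    simp_rw [e]
    rw [lintegral_const_mul _ (by fun_prop), ← hX]
    conv_lhs => rw [← ENNReal.ofReal_toReal hXtop]
    rw [← ENNReal.ofReal_mul (by positivity), ENNReal.toReal_ofReal hXr.le, inv_mul_cancel₀ hXr.ne', ENNReal.ofReal_one]
  have hfinR : IsFiniteMeasure (fiM (fun x => γ x ^ (q / (q - 1)) * ENNReal.ofReal (w x))) :=
    fiM_finite _ (by rw [hRint]; exact ENNReal.one_ne_top)
  have hdensG : ∀ᵐ x ∂(volume.restrict (Ioo (0:ℝ) π)), γ x * ENNReal.ofReal (w x) =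
      (γ x ^ (q / (q - 1)) * ENNReal.ofReal (w x)) ^ (1 / (q / (q - 1))) *
      ENNReal.ofReal (w x) ^ ((q / (q - 1) - 1) / (q / (q - 1))) := by
    filter_upwards [hwpos] with x hx
    rw [ENNReal.mul_rpow_of_nonneg _ _ (by positivity), ← ENNReal.rpow_mul,
      show q / (q - 1) * (1 / (q / (q - 1))) = 1 by field_simp, ENNReal.rpow_one, mul_assoc,
      ← ENNReal.rpow_add _ _ (by simpa using hx) ENNReal.ofReal_ne_top,
      show 1 / (q / (q - 1)) + (q / (q - 1) - 1) / (q / (q - 1)) = 1 by field_simp; ring,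
      ENNReal.rpow_one]
  have hfinG : IsFiniteMeasure (fiM (fun x => γ x * ENNReal.ofReal (w x))) :=
    fi_holder_fin _ hq' _ _ _ (by fun_prop) (by fun_prop) hdensG
  set mG := fiM (fun x => γ x * ENNReal.ofReal (w x)) with hmG
  set mR := fiM (fun x => γ x ^ (q / (q - 1)) * ENNReal.ofReal (w x)) with hmR
  -- stopping hypotheses
  have hStopping : ∀ (u : ℝ → ℝ) (K : ℝ) [IsFiniteMeasure (fiM (fun x => ENNReal.ofReal (u x)))],
      (∀ a b : ℝ, 0 ≤ a → a ≤ b → b ≤ π → ∀ U : Set ℝ, MeasurableSet U →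
      U ⊆ Icc a b → 4 * (fiM 1).real U ≤ b - a →
      K * (fiM (fun x => ENNReal.ofReal (u x))).real U ≤
        (K - 1) * (fiM (fun x => ENNReal.ofReal (u x))).real (Ioo a b)) → 
      ∀ n i t, 4 * (fiStop g.lc g.rc (fun i => mF.real (g.cell i)) (fun i => (fiM 1).real (g.cell i))
          (fun i => (fiM 1).real (g.cell i)) n (g.lc i) t +
        fiStop g.lc g.rc (fun i => mF.real (g.cell i)) (fun i => (fiM 1).real (g.cell i))
          (fun i => (fiM 1).real (g.cell i)) n (g.rc i) t) ≤ (fiM 1).real (g.cell i) →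
      K * (fiStop g.lc g.rc (fun i => mF.real (g.cell i)) (fun i => (fiM 1).real (g.cell i))
          (fun i => (fiM (fun x => ENNReal.ofReal (u x))).real (g.cell i)) n (g.lc i) t +
        fiStop g.lc g.rc (fun i => mF.real (g.cell i)) (fun i => (fiM 1).real (g.cell i))
          (fun i => (fiM (fun x => ENNReal.ofReal (u x))).real (g.cell i)) n (g.rc i) t) ≤
        (K - 1) * (fiM (fun x => ENNReal.ofReal (u x))).real (g.cell i) := by
    intro u K _ hu n i t hle
    obtain ⟨l1, l2, l3⟩ := g.stopSet_props (fun i => mF.real (g.cell i))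
      (fun i => (fiM 1).real (g.cell i)) n (g.lc i) t
    obtain ⟨r1, r2, r3⟩ := g.stopSet_props (fun i => mF.real (g.cell i))
      (fun i => (fiM 1).real (g.cell i)) n (g.rc i) t
    have hdisj := (g.cell_disj i).mono l2 r2
    rw [l3, r3, ← measureReal_union hdisj r1] at hle ⊢
    obtain ⟨a, b, ha, hab, hb, s1, s2, -, -⟩ := g.cell_interval i
    rw [fiM_cell g i a b s1 s2] at hle ⊢
    rw [fiM_one_Ioo a b ha hab hb] at hle
    refine hu a b ha hab hb _ (l1.union r1) ?_ hle
    refine Subset.trans ?_ s2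
    rw [g.cell_split i]
    exact union_subset_union l2 r2
  have hlenprop : ∀ i, (fiM 1).real (g.cell i) ≤ fiδ i.1 ∧
      (0 < (fiM 1).real (g.cell i) → fiδ i.1 ≤ 6 * (fiM 1).real (g.cell i)) ∧
      ((fiM 1).real (g.cell i) = 0 → mF.real (g.cell i) = 0) ∧
      fiδ i.1 ^ (σ - 1) * (μ.real (g.cell i) ^ (1/q) * ν.real (g.cell i) ^ ((p-1)/p)) ≤ C' := by
    intro i
    obtain ⟨a, b, ha, hab, hb, s1, s2, h1, h2⟩ := g.cell_interval i
    rw [hmF, hμdef, hνdef, fiM_cell g i a b s1 s2, fiM_cell g i a b s1 s2, fiM_cell g i a b s1 s2,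
      fiM_cell g i a b s1 s2, fiM_one_Ioo a b ha hab hb]
    refine ⟨h1, fun h => h2 (by linarith), fun h => ?_, ?_⟩
    · rw [show a = b by linarith]; simp
    · have h3 := hc a b ha hab hb
      rw [← fiM_Ioo _ a b ha hb, ← fiM_Ioo _ a b ha hb] at h3
      have h4 := ENNReal.toReal_mono ENNReal.ofReal_ne_top h3
      rw [ENNReal.toReal_mul, ← ENNReal.toReal_rpow, ← ENNReal.toReal_rpow,
        ENNReal.toReal_ofReal (mul_nonneg hC'.le (rpow_nonneg (by linarith) _))] at h4
      have hδ := fiδ_pos i.1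
      have h5 : (b - a) ^ (1 - σ) ≤ fiδ i.1 ^ (1 - σ) :=
        rpow_le_rpow (by linarith) h1 (by linarith)
      have h6 : fiδ i.1 ^ (σ - 1) * fiδ i.1 ^ (1 - σ) = 1 := by
        rw [← rpow_add hδ]; simp
      have h7 : 0 < fiδ i.1 ^ (σ - 1) := rpow_pos_of_pos hδ _
      calc _ ≤ fiδ i.1 ^ (σ - 1) * (C' * (b - a) ^ (1 - σ)) :=
            mul_le_mul_of_nonneg_left h4 h7.le
        _ ≤ fiδ i.1 ^ (σ - 1) * (C' * fiδ i.1 ^ (1 - σ)) := by gcongr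
        _ = C' * (fiδ i.1 ^ (σ - 1) * fiδ i.1 ^ (1 - σ)) := by ring
        _ = C' := by rw [h6, mul_one]
  have hgeo : ∀ k, fiδ (k+1) ^ (σ - 1) * fiδ (k+1) = 2 ^ (-σ) * (fiδ k ^ (σ - 1) * fiδ k) := by
    intro k
    have e : ∀ z : ℝ, 0 < z → z ^ (σ - 1) * z = z ^ σ := by
      intro z hz
      nth_rewrite 2 [← rpow_one z]
      rw [← rpow_add hz]; simp
    rw [e _ (fiδ_pos _), e _ (fiδ_pos _), fiδ_succ, div_rpow (fiδ_pos _).le (by norm_num),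
      rpow_neg (by norm_num)]
    ring
  have hP1 : mP.real univ ≤ 1 := by
    unfold Measure.real
    rw [hmP, fiM_univ]
    exact ENNReal.toReal_le_of_le_ofReal zero_le_one (by simpa using hf1)
  have hR1 : mR.real univ ≤ 1 := by
    unfold Measure.real
    rw [hmR, fiM_univ, hRint]; simp
  have hcore := fi_core g.lc g.rc (fun i => mF.real (g.cell i)) (fun i => mG.real (g.cell i))
    (fun i => (fiM 1).real (g.cell i)) (fun i => fiδ i.1 ^ (σ - 1)) (fun i => fiδ i.1)
    (fun i => μ.real (g.cell i)) (fun i => ν.real (g.cell i)) (fun i => mP.real (g.cell i))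
    (fun i => mR.real (g.cell i)) (2 ^ (-σ)) p q K1 K2 C' (by positivity) hσ2 hp hpq hK1 hK2 hC'.le
    (fun _ => measureReal_nonneg) (fun _ => measureReal_nonneg) (fun _ => measureReal_nonneg)
    (fun i => rpow_nonneg (fiδ_pos _).le _) (fun i => (fiδ_pos _).le)
    (fun _ => measureReal_nonneg) (fun _ => measureReal_nonneg) (fun _ => measureReal_nonneg)
    (fun _ => measureReal_nonneg)
    (g.measure_split _) (g.measure_split _) (g.measure_split _) (g.measure_split _)
    (g.measure_split _) (g.measure_split _)
    (fun i => hgeo i.1) (fun i => hgeo i.1)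
    (fun i => (hlenprop i).1) (fun i => (hlenprop i).2.1) (fun i => (hlenprop i).2.2.1)
    (fun i => fi_holder p hp _ _ _ (by fun_prop) (by fun_prop) hdens _ (g.measurableSet_cell i))
    (fun i => fi_holder _ hq' _ _ _ (by fun_prop) (by fun_prop) hdensG _ (g.measurableSet_cell i))
    (fun i => (measureReal_mono (subset_univ _)).trans hP1)
    (fun i => (measureReal_mono (subset_univ _)).trans hR1)
    (fun i => (hlenprop i).2.2.2)
    (hStopping vb K1 hA1) (hStopping w K2 hA2) n (0, g.m0)
  obtain ⟨-, hTi, -, hTe⟩ := fi_integral_tot g mG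
    (fun i => fiδ i.1 ^ (σ - 1) * mF.real (g.cell i)) n (0, g.m0)
  change Integrable T mG at hTi
  change ∫ x, T x ∂mG = _ at hTe
  rw [← hTe] at hcore
  have hTeq : ∫ x, T x ∂mG = c * X.toReal := by
    rw [integral_eq_lintegral_of_nonneg_ae (Filter.Eventually.of_forall hT0)
      hTm.aestronglyMeasurable, hmG]
    unfold fiM
    rw [lintegral_withDensity_eq_lintegral_mul _ (by fun_prop) (by fun_prop)]
    have e : ∀ x, ((fun x => γ x * ENNReal.ofReal (w x)) * fun x => ENNReal.ofReal (T x)) x =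
        ENNReal.ofReal c * (ENNReal.ofReal (T x) ^ q * ENNReal.ofReal (w x)) := by
      intro x
      simp only [Pi.mul_apply, hγ]
      have hTq : T x ^ q = T x ^ (q - 1) * T x := by
        have := rpow_add_one' (hT0 x) (show q - 1 + 1 ≠ 0 by simpa using hq0)
        rw [← this]; congr 1; ring
      rw [ENNReal.ofReal_rpow_of_nonneg (hT0 x) (by linarith), hTq,
        ENNReal.ofReal_mul hc0.le, ENNReal.ofReal_mul (rpow_nonneg (hT0 x) _)]
      ring
    simp_rw [e]
    rw [lintegral_const_mul _ (by fun_prop), ← hX, ENNReal.toReal_mul, ENNReal.toReal_ofReal hc0.le]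
  rw [hTeq] at hcore
  have hcX : c * X.toReal = X.toReal ^ (1 / q) := by
    rw [hcdef]
    nth_rewrite 2 [← rpow_one X.toReal]
    rw [← rpow_add hXr]; congr 1; field_simp; ring
  rw [hcX] at hcore
  have hfin : X.toReal ≤ Cc ^ q := by
    have := rpow_le_rpow (rpow_nonneg hXr.le _) hcore (by linarith : 0 ≤ q)
    rwa [← rpow_mul hXr.le, show 1 / q * q = 1 by field_simp, rpow_one] at this
  exact ENNReal.le_ofReal_iff_toReal_le hXtop (hXr.le.trans hfin) |>.mpr hfin

end MainProof

section Final

/-- truncated dyadic kernel -/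
noncomputable def fiK (g : FiGrid) (σ : ℝ) (n : ℕ) (x y : ℝ) : ℝ :=
  fiTot g.lc g.rc (fun i => (fiδ i.1 ^ (σ - 1) * (g.cell i).indicator 1 x) *
    (g.cell i).indicator 1 y) n (0, g.m0)

lemma fi_ind_nonneg (s : Set ℝ) (x : ℝ) : (0:ℝ) ≤ s.indicator 1 x :=
  indicator_nonneg (fun _ _ => zero_le_one) x

lemma fiK_mono (g : FiGrid) (σ : ℝ) (x y : ℝ) : Monotone (fun n => fiK g σ n x y) :=
  monotone_nat_of_le_succ fun n => fiTot_mono_n _ _ _ (fun i =>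
    mul_nonneg (mul_nonneg (rpow_nonneg (fiδ_pos _).le _) (fi_ind_nonneg _ _))
      (fi_ind_nonneg _ _)) n _

lemma fiK_nonneg (g : FiGrid) (σ : ℝ) (n : ℕ) (x y : ℝ) : 0 ≤ fiK g σ n x y :=
  fiTot_nonneg _ _ _ (fun i =>
    mul_nonneg (mul_nonneg (rpow_nonneg (fiδ_pos _).le _) (fi_ind_nonneg _ _))
      (fi_ind_nonneg _ _)) n _

lemma fiT_mono (g : FiGrid) (σ : ℝ) (f : ℝ → ℝ) (x : ℝ) : Monotone (fun n => fiT g σ f n x) :=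
  monotone_nat_of_le_succ fun n => fiTot_mono_n _ _ _ (fun i =>
    mul_nonneg (mul_nonneg (rpow_nonneg (fiδ_pos _).le _) measureReal_nonneg)
      (fi_ind_nonneg _ _)) n _

lemma fiT_meas (g : FiGrid) (σ : ℝ) (f : ℝ → ℝ) (n : ℕ) : Measurable (fiT g σ f n) :=
  (fi_integral_tot g (0 : Measure ℝ) _ n (0, g.m0)).1

lemma fiK_meas (g : FiGrid) (σ : ℝ) (n : ℕ) (x : ℝ) : Measurable (fiK g σ n x) :=
  (fi_integral_tot g (0 : Measure ℝ) _ n (0, g.m0)).1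

lemma fiT_eq (g : FiGrid) (σ : ℝ) (f : ℝ → ℝ) (hf : Measurable f)
    [IsFiniteMeasure (fiM (fun y => ENNReal.ofReal (f y)))] (n : ℕ) (x : ℝ) :
    ENNReal.ofReal (fiT g σ f n x) =
      ∫⁻ y in Ioo (0:ℝ) π, ENNReal.ofReal (f y) * ENNReal.ofReal (fiK g σ n x y) := by
  obtain ⟨_, hi, _, he⟩ := fi_integral_tot g (fiM (fun y => ENNReal.ofReal (f y)))
    (fun i => fiδ i.1 ^ (σ - 1) * (g.cell i).indicator 1 x) n (0, g.m0)
  have e : fiT g σ f n x = ∫ y, fiK g σ n x y ∂(fiM (fun y => ENNReal.ofReal (f y))) := by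
    unfold fiT fiK
    rw [he]
    congr 1
    funext i
    exact mul_right_comm _ _ _
  have hi' : Integrable (fiK g σ n x) (fiM (fun y => ENNReal.ofReal (f y))) := hi
  rw [e, ofReal_integral_eq_lintegral_ofReal hi' (Filter.Eventually.of_forall (fiK_nonneg g σ n x))]
  unfold fiM
  exact lintegral_withDensity_eq_lintegral_mul _ (by fun_prop)
    (ENNReal.measurable_ofReal.comp (fiK_meas g σ n x))

lemma fiT_sup (g : FiGrid) (σ : ℝ) (f : ℝ → ℝ) (hf : Measurable f)
    [IsFiniteMeasure (fiM (fun y => ENNReal.ofReal (f y)))] (x : ℝ) :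
    ⨆ n, ENNReal.ofReal (fiT g σ f n x) =
      ∫⁻ y in Ioo (0:ℝ) π, ENNReal.ofReal (f y) * ⨆ n, ENNReal.ofReal (fiK g σ n x y) := by
  simp_rw [fiT_eq g σ f hf _ x, ENNReal.mul_iSup]
  rw [lintegral_iSup]
  · intro n
    have := fiK_meas g σ n x
    fun_prop
  · intro a b hab y
    exact mul_le_mul_right (ENNReal.ofReal_le_ofReal (fiK_mono g σ x y hab)) _

lemma fiK_lb (g : FiGrid) (σ x y : ℝ) (hx : x ∈ Ioo (0:ℝ) π) (hy : y ∈ Ioo (0:ℝ) π) (k : ℕ)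
    (h : g.idx k x = g.idx k y) :
    ENNReal.ofReal (fiδ k ^ (σ - 1)) ≤ ⨆ n, ENNReal.ofReal (fiK g σ n x y) := by
  refine le_iSup_of_le (k + 1) (ENNReal.ofReal_le_ofReal ?_)
  have := g.kernel_lb (fun i => fiδ i.1 ^ (σ - 1)) (fun i => rpow_nonneg (fiδ_pos _).le _)
    (fun k => fiδ k ^ (σ - 1)) (fun i => rfl) x y k (0, g.m0) (k + 1)
    (by rw [g.cell_root]; exact hx) (by rw [g.cell_root]; exact hy) (by simpa using h) (by omega)
  simpa [fiK] using this

lemma fi_kernel (σ x y : ℝ) (hσ1 : σ < 1) (hxy : x ≠ y) (hx : x ∈ Ioo (0:ℝ) π)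
    (hy : y ∈ Ioo (0:ℝ) π) :
    ENNReal.ofReal |x - y| ^ (σ - 1) ≤ ENNReal.ofReal (6 ^ (1 - σ)) *
      ((⨆ n, ENNReal.ofReal (fiK fiGrid0 σ n x y)) + ⨆ n, ENNReal.ofReal (fiK fiGrid1 σ n x y)) := by
  obtain ⟨k, hk, hc⟩ := fi_scale x y hxy hx hy
  have hpos : 0 < |x - y| := abs_pos.mpr (sub_ne_zero.mpr hxy)
  have hδ := fiδ_pos k
  have h1 : ENNReal.ofReal |x - y| ^ (σ - 1) ≤
      ENNReal.ofReal (6 ^ (1 - σ)) * ENNReal.ofReal (fiδ k ^ (σ - 1)) := by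
    rw [ENNReal.ofReal_rpow_of_pos hpos, ← ENNReal.ofReal_mul (by positivity)]
    apply ENNReal.ofReal_le_ofReal
    calc |x - y| ^ (σ - 1) ≤ (fiδ k / 6) ^ (σ - 1) :=
          rpow_le_rpow_of_nonpos (by positivity) hk (by linarith)
      _ = 6 ^ (1 - σ) * fiδ k ^ (σ - 1) := by
          rw [div_rpow hδ.le (by norm_num), show 1 - σ = -(σ - 1) by ring,
            rpow_neg (by norm_num)]
          ring
  refine h1.trans (mul_le_mul_right ?_ _)
  rcases hc with h | h
  · exact (fiK_lb _ σ x y hx hy k h).trans le_self_add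
  · exact (fiK_lb _ σ x y hx hy k h).trans le_add_self

lemma fi_dom (σ : ℝ) (hσ1 : σ < 1) (f : ℝ → ℝ) (hf : Measurable f)
    [IsFiniteMeasure (fiM (fun y => ENNReal.ofReal (f y)))] (x : ℝ) (hx : x ∈ Ioo (0:ℝ) π) :
    fracIntegral σ f x ≤ ENNReal.ofReal (6 ^ (1 - σ)) *
      ((⨆ n, ENNReal.ofReal (fiT fiGrid0 σ f n x)) + ⨆ n, ENNReal.ofReal (fiT fiGrid1 σ f n x)) := by
  have hm : ∀ g : FiGrid, Measurable (fun y => ⨆ n, ENNReal.ofReal (fiK g σ n x y)) := fun g =>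
    Measurable.iSup fun n => ENNReal.measurable_ofReal.comp (fiK_meas g σ n x)
  have h0 := hm fiGrid0
  have h1 := hm fiGrid1
  rw [fiT_sup _ σ f hf, fiT_sup _ σ f hf, ← lintegral_add_left (by fun_prop),
    ← lintegral_const_mul' _ _ ENNReal.ofReal_ne_top]
  unfold fracIntegral
  apply lintegral_mono_ae
  have hne : ∀ᵐ y ∂(volume.restrict (Ioo (0:ℝ) π)), y ≠ x :=
    ae_restrict_of_ae (Measure.ae_ne volume x)
  filter_upwards [hne, ae_restrict_mem measurableSet_Ioo] with y hy hyI
  rw [← mul_add, mul_left_comm]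
  exact mul_le_mul_right (fi_kernel σ x y hσ1 hy.symm hx hyI) _

lemma fi_sup_bound (g : FiGrid) (σ q : ℝ) (hq : 1 < q) (w f : ℝ → ℝ) (hwm : Measurable w)
    (C : ENNReal) (h : ∀ n, ∫⁻ θ in Ioo (0:ℝ) π,
      ENNReal.ofReal (fiT g σ f n θ) ^ q * ENNReal.ofReal (w θ) ≤ C) :
    ∫⁻ θ in Ioo (0:ℝ) π, (⨆ n, ENNReal.ofReal (fiT g σ f n θ)) ^ q * ENNReal.ofReal (w θ) ≤ C := by
  have hq0 : 0 < q := by linarith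
  have e : ∀ θ, (⨆ n, ENNReal.ofReal (fiT g σ f n θ)) ^ q * ENNReal.ofReal (w θ) =
      ⨆ n, ENNReal.ofReal (fiT g σ f n θ) ^ q * ENNReal.ofReal (w θ) := by
    intro θ
    have := (ENNReal.orderIsoRpow q hq0).map_iSup (fun n => ENNReal.ofReal (fiT g σ f n θ))
    simp only [ENNReal.orderIsoRpow_apply] at this
    rw [this, ENNReal.iSup_mul]
  simp_rw [e]
  rw [lintegral_iSup]
  · exact iSup_le h
  · intro n
    have := fiT_meas g σ f n
    fun_prop
  · intro a b hab θ
    exact mul_le_mul_left (ENNReal.rpow_le_rpow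
      (ENNReal.ofReal_le_ofReal (fiT_mono g σ f θ hab)) hq0.le) _

lemma fi_norm_bound (σ q : ℝ) (hσ1 : σ < 1) (hq : 1 < q) (w f : ℝ → ℝ) (hwm : Measurable w)
    (hf : Measurable f) [IsFiniteMeasure (fiM (fun y => ENNReal.ofReal (f y)))]
    (C0 C1 : ENNReal)
    (h0 : ∀ n, ∫⁻ θ in Ioo (0:ℝ) π,
      ENNReal.ofReal (fiT fiGrid0 σ f n θ) ^ q * ENNReal.ofReal (w θ) ≤ C0)
    (h1 : ∀ n, ∫⁻ θ in Ioo (0:ℝ) π,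
      ENNReal.ofReal (fiT fiGrid1 σ f n θ) ^ q * ENNReal.ofReal (w θ) ≤ C1) :
    ∫⁻ θ in Ioo (0:ℝ) π, fracIntegral σ f θ ^ q * ENNReal.ofReal (w θ) ≤
      (ENNReal.ofReal (6 ^ (1 - σ)) ^ q * 2 ^ (q - 1)) * (C0 + C1) := by
  have hq0 : 0 < q := by linarith
  have hm : ∀ g : FiGrid, Measurable (fun y => ⨆ n, ENNReal.ofReal (fiT g σ f n y)) := fun g =>
    Measurable.iSup fun n => ENNReal.measurable_ofReal.comp (fiT_meas g σ f n)
  have m0 := hm fiGrid0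
  have h0' := fi_sup_bound fiGrid0 σ q hq w f hwm C0 h0
  have h1' := fi_sup_bound fiGrid1 σ q hq w f hwm C1 h1
  have hE : ENNReal.ofReal (6 ^ (1 - σ)) ^ q * 2 ^ (q - 1) ≠ ⊤ :=
    ENNReal.mul_ne_top (ENNReal.rpow_ne_top_of_nonneg hq0.le ENNReal.ofReal_ne_top)
      (ENNReal.rpow_ne_top_of_nonneg (by linarith) (by norm_num))
  refine le_trans ?_ (mul_le_mul_right (add_le_add h0' h1') _)
  rw [← lintegral_add_left (by fun_prop), ← lintegral_const_mul' _ _ hE]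
  apply lintegral_mono_ae
  filter_upwards [ae_restrict_mem measurableSet_Ioo] with x hx
  rw [← add_mul, ← mul_assoc]
  apply mul_le_mul_left
  calc fracIntegral σ f x ^ q ≤ _ := ENNReal.rpow_le_rpow (fi_dom σ hσ1 f hf x hx) hq0.le
    _ ≤ _ := by
      rw [ENNReal.mul_rpow_of_nonneg _ _ hq0.le, mul_assoc]
      exact mul_le_mul_right (ENNReal.rpow_add_le_mul_rpow_add_rpow _ _ hq.le) _

lemma fracIntegral_smul (σ t : ℝ) (ht : 0 ≤ t) (f : ℝ → ℝ) (x : ℝ) :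
    fracIntegral σ (fun y => t * f y) x = ENNReal.ofReal t * fracIntegral σ f x := by
  unfold fracIntegral
  rw [← lintegral_const_mul' _ _ ENNReal.ofReal_ne_top]
  congr 1
  funext y
  rw [ENNReal.ofReal_mul ht, mul_assoc]

lemma fi_scaling (σ p q : ℝ) (hp : 1 < p) (hq : 1 < q) (w v : ℝ → ℝ) (hvm : Measurable v)
    (hvpos : ∀ᵐ θ ∂(volume.restrict (Ioo (0:ℝ) π)), 0 < v θ) (D : ENNReal)
    (hD : ∀ f : ℝ → ℝ, Measurable f → (∀ θ, 0 ≤ f θ) →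
        (∫⁻ θ in Ioo (0:ℝ) π, ENNReal.ofReal (f θ) ^ p * ENNReal.ofReal (v θ)) ≤ 1 →
        (∫⁻ θ in Ioo (0:ℝ) π, fracIntegral σ f θ ^ q * ENNReal.ofReal (w θ)) ≤ D)
    (f : ℝ → ℝ) (hf : Measurable f) (hf0 : ∀ θ, 0 ≤ f θ)
    (hfin : (∫⁻ θ in Ioo (0:ℝ) π, ENNReal.ofReal (f θ) ^ p * ENNReal.ofReal (v θ)) < ⊤) :
    (∫⁻ θ in Ioo (0:ℝ) π, fracIntegral σ f θ ^ q * ENNReal.ofReal (w θ)) ^ (1/q) ≤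
      D ^ (1/q) *
        (∫⁻ θ in Ioo (0:ℝ) π, ENNReal.ofReal (f θ) ^ p * ENNReal.ofReal (v θ)) ^ (1/p) := by
  have hp0 : 0 < p := by linarith
  have hq0 : 0 < q := by linarith
  set P := ∫⁻ θ in Ioo (0:ℝ) π, ENNReal.ofReal (f θ) ^ p * ENNReal.ofReal (v θ) with hP
  by_cases hP0 : P = 0
  · have hz : ∀ᵐ x ∂(volume.restrict (Ioo (0:ℝ) π)), ENNReal.ofReal (f x) = 0 := by
      rw [hP, lintegral_eq_zero_iff (by fun_prop)] at hP0
      filter_upwards [hP0, hvpos] with x hx hv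
      simp only [Pi.zero_apply, mul_eq_zero, ENNReal.rpow_eq_zero_iff, ENNReal.ofReal_ne_top,
        false_and, or_false, hp0, and_true] at hx
      rcases hx with hx | hx
      · exact hx
      · exact absurd hv (not_lt.mpr (ENNReal.ofReal_eq_zero.mp hx))
    have hz' : ∀ x, fracIntegral σ f x = 0 := by
      intro x
      unfold fracIntegral
      rw [lintegral_congr_ae (g := 0)]
      · simp
      · filter_upwards [hz] with y hy
        simp [hy]
    simp [hz', hq0]
  · have hPr : 0 < P.toReal := ENNReal.toReal_pos hP0 hfin.ne
    set t := P.toReal ^ (-(1/p)) with ht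
    have ht0 : 0 < t := rpow_pos_of_pos hPr _
    have htE : ENNReal.ofReal t = P ^ (-(1/p)) := by
      rw [ht, ← ENNReal.ofReal_rpow_of_pos hPr, ENNReal.ofReal_toReal hfin.ne]
    have h := hD (fun y => t * f y) (by fun_prop) (fun θ => mul_nonneg ht0.le (hf0 θ)) (by
      have e : ∀ θ, ENNReal.ofReal (t * f θ) ^ p * ENNReal.ofReal (v θ) =
          P⁻¹ * (ENNReal.ofReal (f θ) ^ p * ENNReal.ofReal (v θ)) := by
        intro θ
        rw [ENNReal.ofReal_mul ht0.le, ENNReal.mul_rpow_of_nonneg _ _ hp0.le, htE,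
          ← ENNReal.rpow_mul, show -(1/p) * p = -1 by field_simp, ENNReal.rpow_neg_one, mul_assoc]
      simp_rw [e]
      rw [lintegral_const_mul' _ _ (ENNReal.inv_ne_top.mpr hP0), ← hP,
        ENNReal.inv_mul_cancel hP0 hfin.ne])
    have e2 : ∀ θ, fracIntegral σ (fun y => t * f y) θ ^ q * ENNReal.ofReal (w θ) =
        ENNReal.ofReal t ^ q * (fracIntegral σ f θ ^ q * ENNReal.ofReal (w θ)) := by
      intro θ
      rw [fracIntegral_smul σ t ht0.le, ENNReal.mul_rpow_of_nonneg _ _ hq0.le, mul_assoc]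
    simp_rw [e2] at h
    rw [lintegral_const_mul' _ _ (ENNReal.rpow_ne_top_of_nonneg hq0.le ENNReal.ofReal_ne_top)] at h
    have h2 := ENNReal.rpow_le_rpow h (show 0 ≤ 1 / q by positivity)
    rw [ENNReal.mul_rpow_of_nonneg _ _ (by positivity), ← ENNReal.rpow_mul,
      show q * (1/q) = 1 by field_simp, ENNReal.rpow_one, htE, ENNReal.rpow_neg] at h2
    have hn0 : P ^ (1/p) ≠ 0 := by
      rw [Ne, ENNReal.rpow_eq_zero_iff]; push Not
      exact ⟨fun h => absurd h hP0, fun h => absurd h hfin.ne⟩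
    have hnt : P ^ (1/p) ≠ ⊤ := ENNReal.rpow_ne_top_of_nonneg (by positivity) hfin.ne
    calc _ = P ^ (1/p) * ((P ^ (1/p))⁻¹ *
        (∫⁻ θ in Ioo (0:ℝ) π, fracIntegral σ f θ ^ q * ENNReal.ofReal (w θ)) ^ (1/q)) := by
          rw [← mul_assoc, ENNReal.mul_inv_cancel hn0 hnt, one_mul]
      _ ≤ P ^ (1/p) * D ^ (1/q) := mul_le_mul_right h2 _
      _ = _ := mul_comm _ _

lemma fi_nec (σ p q : ℝ) (hσ1 : σ < 1)
    (hp : 1 < p) (hq : 1 < q) (w v : ℝ → ℝ) (hvm : Measurable v)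
    (hvpos : ∀ᵐ θ ∂(volume.restrict (Ioo (0:ℝ) π)), 0 < v θ)
    (hvA : MuckenhouptAinf (fun θ => v θ ^ (-(1/(p-1)))))
    (C : ℝ) (hC : 0 < C) (h : ∀ f : ℝ → ℝ, Measurable f → (∀ θ, 0 ≤ f θ) →
        (∫⁻ θ in Ioo (0:ℝ) π, ENNReal.ofReal (f θ) ^ p * ENNReal.ofReal (v θ)) < ⊤ →
        (∫⁻ θ in Ioo (0:ℝ) π, fracIntegral σ f θ ^ q * ENNReal.ofReal (w θ)) ^ (1/q) ≤
          ENNReal.ofReal C *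
            (∫⁻ θ in Ioo (0:ℝ) π, ENNReal.ofReal (f θ) ^ p * ENNReal.ofReal (v θ)) ^ (1/p))
    (a b : ℝ) (ha : 0 ≤ a) (hab : a ≤ b) (hb : b ≤ π) :
    (∫⁻ θ in Ioo a b, ENNReal.ofReal (w θ)) ^ (1/q) *
      (∫⁻ θ in Ioo a b, ENNReal.ofReal (v θ ^ (-(1/(p-1))))) ^ ((p-1)/p) ≤
      ENNReal.ofReal (C * (b - a) ^ (1-σ)) := by
  have hp0 : 0 < p := by linarith
  have hq0 : 0 < q := by linarith
  have hp1 : 0 < p - 1 := by linarith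
  have hsub : Ioo a b ⊆ Ioo 0 π := Ioo_subset_Ioo ha hb
  rcases hab.eq_or_lt with rfl | hlt
  · simp [hq0]
  set vb := fun θ => v θ ^ (-(1/(p-1))) with hvb
  have hvbm : Measurable vb := by fun_prop
  have hfinν := (fi_ainf vb hvbm (hvpos.mono fun x hx => rpow_pos_of_pos hx _) hvA).1
  set V := ∫⁻ θ in Ioo a b, ENNReal.ofReal (vb θ) with hV
  have hVfin : V ≠ ⊤ := by
    rw [hV, ← fiM_Ioo _ a b ha hb]; exact measure_ne_top _ _
  by_cases hV0 : V = 0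
  · rw [hV0, ENNReal.zero_rpow_of_pos (by positivity), mul_zero]; exact zero_le
  set f := (Ioo a b).indicator (fun θ => max 0 (vb θ)) with hfdef
  have hfm : Measurable f := (by fun_prop : Measurable (fun θ => max 0 (vb θ))).indicator
    measurableSet_Ioo
  have hf0 : ∀ θ, 0 ≤ f θ := fun θ => indicator_nonneg (fun _ _ => le_max_left _ _) θ
  have hE : ∀ θ, ENNReal.ofReal (f θ) =
      (Ioo a b).indicator (fun θ => ENNReal.ofReal (vb θ)) θ := by
    intro θ
    by_cases hθ : θ ∈ Ioo a b
    · simp only [hfdef, indicator_of_mem hθ]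
      rcases le_total 0 (vb θ) with h | h
      · rw [max_eq_right h]
      · rw [max_eq_left h, ENNReal.ofReal_of_nonpos h, ENNReal.ofReal_zero]
    · simp [hfdef, indicator_of_notMem hθ]
  have hind : ∀ F : ℝ → ENNReal, ∫⁻ θ in Ioo (0:ℝ) π, (Ioo a b).indicator F θ =
      ∫⁻ θ in Ioo a b, F θ := by
    intro F
    rw [lintegral_indicator measurableSet_Ioo, Measure.restrict_restrict measurableSet_Ioo,
      inter_eq_left.mpr hsub]
  have hPV : ∫⁻ θ in Ioo (0:ℝ) π, ENNReal.ofReal (f θ) ^ p * ENNReal.ofReal (v θ) = V := by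
    rw [hV, ← hind]
    apply lintegral_congr_ae
    filter_upwards [hvpos] with x hx
    rw [hE x]
    by_cases hxI : x ∈ Ioo a b
    · rw [indicator_of_mem hxI, ENNReal.ofReal_rpow_of_pos (rpow_pos_of_pos hx _),
        ← ENNReal.ofReal_mul (by positivity)]
      congr 1
      rw [← rpow_mul hx.le]
      nth_rewrite 2 [← rpow_one (v x)]
      rw [← rpow_add hx]
      congr 1
      field_simp
      ring
    · rw [indicator_of_notMem hxI, ENNReal.zero_rpow_of_pos hp0, zero_mul]
  have h1 := h f hfm hf0 (by rw [hPV]; exact hVfin.lt_top)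
  rw [hPV] at h1
  have hba : 0 < b - a := by linarith
  set B := ENNReal.ofReal (b - a) ^ (σ - 1) with hB
  have hBr : B = ENNReal.ofReal ((b - a) ^ (σ - 1)) := ENNReal.ofReal_rpow_of_pos hba
  have hlow : ∀ x ∈ Ioo a b, B * V ≤ fracIntegral σ f x := by
    intro x hx
    unfold fracIntegral
    rw [hV, ← lintegral_const_mul' _ _ (by rw [hBr]; exact ENNReal.ofReal_ne_top), ← hind]
    apply lintegral_mono
    intro y
    simp only [hE y]
    by_cases hy : y ∈ Ioo a b
    · rw [indicator_of_mem hy, indicator_of_mem hy, mul_comm]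
      apply mul_le_mul_right
      rw [hB, show σ - 1 = -(1 - σ) by ring, ENNReal.rpow_neg, ENNReal.rpow_neg,
        ENNReal.inv_le_inv]
      refine ENNReal.rpow_le_rpow (ENNReal.ofReal_le_ofReal ?_) (by linarith)
      rw [abs_le]
      constructor <;> linarith [hx.1, hx.2, hy.1, hy.2]
    · rw [indicator_of_notMem hy]; exact zero_le
  set W := ∫⁻ θ in Ioo a b, ENNReal.ofReal (w θ) with hW
  have hBV : (B * V) ^ q ≠ ⊤ := ENNReal.rpow_ne_top_of_nonneg hq0.le
    (ENNReal.mul_ne_top (by rw [hBr]; exact ENNReal.ofReal_ne_top) hVfin)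
  have h2 : (B * V) ^ q * W ≤
      ∫⁻ θ in Ioo (0:ℝ) π, fracIntegral σ f θ ^ q * ENNReal.ofReal (w θ) := by
    rw [hW, ← lintegral_const_mul' _ _ hBV]
    refine le_trans ?_ (lintegral_mono_set hsub)
    apply setLIntegral_mono' measurableSet_Ioo
    intro x hx
    exact mul_le_mul_left (ENNReal.rpow_le_rpow (hlow x hx) hq0.le) _
  have h3 := (ENNReal.rpow_le_rpow h2 (show 0 ≤ 1/q by positivity)).trans h1
  rw [ENNReal.mul_rpow_of_nonneg _ _ (by positivity), ← ENNReal.rpow_mul,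
      show q * (1/q) = 1 by field_simp, ENNReal.rpow_one] at h3
  have hBi : ENNReal.ofReal ((b - a) ^ (1 - σ)) * B = 1 := by
    rw [hBr, ← ENNReal.ofReal_mul (by positivity), ← rpow_add hba]; simp
  have hVp : V * V ^ (-(1/p)) = V ^ ((p-1)/p) := by
    nth_rewrite 1 [← ENNReal.rpow_one V]
    rw [← ENNReal.rpow_add _ _ hV0 hVfin]
    congr 1; field_simp; ring
  have hVp2 : V ^ (1/p) * V ^ (-(1/p)) = 1 := by
    rw [← ENNReal.rpow_add _ _ hV0 hVfin]; simp
  calc W ^ (1/q) * V ^ ((p-1)/p)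
      = (ENNReal.ofReal ((b - a) ^ (1 - σ)) * B) * (W ^ (1/q) * (V * V ^ (-(1/p)))) := by
        rw [hBi, hVp, one_mul]
    _ = ENNReal.ofReal ((b - a) ^ (1 - σ)) * V ^ (-(1/p)) * (B * V * W ^ (1/q)) := by ring
    _ ≤ ENNReal.ofReal ((b - a) ^ (1 - σ)) * V ^ (-(1/p)) * (ENNReal.ofReal C * V ^ (1/p)) :=
        mul_le_mul_right h3 _
    _ = ENNReal.ofReal C * ENNReal.ofReal ((b - a) ^ (1 - σ)) * (V ^ (1/p) * V ^ (-(1/p))) := by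
        ring
    _ = _ := by rw [hVp2, mul_one, ENNReal.ofReal_mul hC.le]

lemma fi_suff (σ p q : ℝ) (hσ0 : 0 < σ) (hσ1 : σ < 1)
    (hp : 1 < p) (hpq : p ≤ q) (w v : ℝ → ℝ) (hwm : Measurable w) (hvm : Measurable v)
    (hwpos : ∀ᵐ θ ∂(volume.restrict (Ioo (0:ℝ) π)), 0 < w θ)
    (hvpos : ∀ᵐ θ ∂(volume.restrict (Ioo (0:ℝ) π)), 0 < v θ)
    (hwA : MuckenhouptAinf w) (hvA : MuckenhouptAinf (fun θ => v θ ^ (-(1/(p-1)))))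
    (C' : ℝ) (hC' : 0 < C') (hc : ∀ a b : ℝ, 0 ≤ a → a ≤ b → b ≤ π →
        (∫⁻ θ in Ioo a b, ENNReal.ofReal (w θ)) ^ (1/q) *
          (∫⁻ θ in Ioo a b, ENNReal.ofReal (v θ ^ (-(1/(p-1))))) ^ ((p-1)/p) ≤
          ENNReal.ofReal (C' * (b - a) ^ (1-σ))) :
    ∃ C : ℝ, 0 < C ∧ ∀ f : ℝ → ℝ, Measurable f → (∀ θ, 0 ≤ f θ) →
        (∫⁻ θ in Ioo (0:ℝ) π, ENNReal.ofReal (f θ) ^ p * ENNReal.ofReal (v θ)) < ⊤ →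
        (∫⁻ θ in Ioo (0:ℝ) π, fracIntegral σ f θ ^ q * ENNReal.ofReal (w θ)) ^ (1/q) ≤
          ENNReal.ofReal C *
            (∫⁻ θ in Ioo (0:ℝ) π, ENNReal.ofReal (f θ) ^ p * ENNReal.ofReal (v θ)) ^ (1/p) := by
  have hq : 1 < q := by linarith
  obtain ⟨C0, h0⟩ := fi_grid σ p q hσ0 hσ1 hp hpq w v hwm hvm hwpos hvpos hwA hvA C' hC' hc fiGrid0
  obtain ⟨C1, h1⟩ := fi_grid σ p q hσ0 hσ1 hp hpq w v hwm hvm hwpos hvpos hwA hvA C' hC' hc fiGrid1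
  set D := (ENNReal.ofReal (6 ^ (1 - σ)) ^ q * 2 ^ (q - 1)) *
    (ENNReal.ofReal C0 + ENNReal.ofReal C1) with hD
  have hDt : D ≠ ⊤ := ENNReal.mul_ne_top
    (ENNReal.mul_ne_top (ENNReal.rpow_ne_top_of_nonneg (by linarith) ENNReal.ofReal_ne_top)
      (ENNReal.rpow_ne_top_of_nonneg (by linarith) (by norm_num)))
    (ENNReal.add_ne_top.mpr ⟨ENNReal.ofReal_ne_top, ENNReal.ofReal_ne_top⟩)
  have hDq : D ^ (1/q) ≠ ⊤ := ENNReal.rpow_ne_top_of_nonneg (by positivity) hDt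
  refine ⟨(D ^ (1/q)).toReal + 1, by positivity, fun f hf hf0 hfin => ?_⟩
  have hs := fi_scaling σ p q hp hq w v hvm hvpos D (fun f hf hf0 hf1 => by
    obtain ⟨hfi, k0⟩ := h0 f hf hf0 hf1
    exact fi_norm_bound σ q hσ1 hq w f hwm hf _ _ k0 (h1 f hf hf0 hf1).2) f hf hf0 hfin
  refine hs.trans (mul_le_mul_left ?_ _)
  rw [ENNReal.ofReal_add ENNReal.toReal_nonneg zero_le_one, ENNReal.ofReal_toReal hDq]
  exact le_self_add

end Final

/-- Two-weight characterization (Bernardis–Salinas) of the `L^p(v) → L^q(w)`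
boundedness of the fractional integral `I_σ` on `(0,π)`: for `0 < σ < 1`,
`1 < p ≤ q < ∞`, and weights `w, v̄ = v^{-1/(p-1)} ∈ A_∞`, the boundedness holds
for all nonnegative `f ∈ L^p(v)` if and only if
`w(I)^{1/q} v̄(I)^{(p-1)/p} ≤ C' |I|^{1-σ}` for every interval `I ⊂ (0,π)`. -/
theorem fracIntegral_two_weight_characterization (σ p q : ℝ) (hσ0 : 0 < σ) (hσ1 : σ < 1)
    (hp : 1 < p) (hpq : p ≤ q) (w v : ℝ → ℝ) (hwm : Measurable w) (hvm : Measurable v)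
    (hwpos : ∀ᵐ θ ∂(volume.restrict (Ioo (0:ℝ) π)), 0 < w θ)
    (hvpos : ∀ᵐ θ ∂(volume.restrict (Ioo (0:ℝ) π)), 0 < v θ)
    (hwA : MuckenhouptAinf w) (hvA : MuckenhouptAinf (fun θ => v θ ^ (-(1/(p-1))))) :
    (∃ C : ℝ, 0 < C ∧ ∀ f : ℝ → ℝ, Measurable f → (∀ θ, 0 ≤ f θ) →
        (∫⁻ θ in Ioo (0:ℝ) π, ENNReal.ofReal (f θ) ^ p * ENNReal.ofReal (v θ)) < ⊤ →
        (∫⁻ θ in Ioo (0:ℝ) π, fracIntegral σ f θ ^ q * ENNReal.ofReal (w θ)) ^ (1/q) ≤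
          ENNReal.ofReal C *
            (∫⁻ θ in Ioo (0:ℝ) π, ENNReal.ofReal (f θ) ^ p * ENNReal.ofReal (v θ)) ^ (1/p)) ↔
    (∃ C' : ℝ, 0 < C' ∧ ∀ a b : ℝ, 0 ≤ a → a ≤ b → b ≤ π →
        (∫⁻ θ in Ioo a b, ENNReal.ofReal (w θ)) ^ (1/q) *
          (∫⁻ θ in Ioo a b, ENNReal.ofReal (v θ ^ (-(1/(p-1))))) ^ ((p-1)/p) ≤
          ENNReal.ofReal (C' * (b - a) ^ (1-σ))) := by
  constructor
  · rintro ⟨C, hC, h⟩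
    exact ⟨C, hC, fun a b ha hab hb => fi_nec σ p q hσ1 hp (by linarith) w v hvm hvpos hvA C hC h
      a b ha hab hb⟩
  · rintro ⟨C', hC', hc⟩
    exact fi_suff σ p q hσ0 hσ1 hp hpq w v hwm hvm hwpos hvpos hwA hvA C' hC' hc
end

section
/- Let γ ≥ −1/2, λ > −1/2 and A > B > 0. Then ∫_{−1}^{1} (A − Bu)^{−(γ+λ+1)} dΠ_γ(u) ≤ (2^{γ+1/2} Γ(γ+1) Γ(λ+1/2) / (√π · Γ(γ+λ+1))) · B^{−(γ+1/2)} (A−B)^{−(λ+1/2)}. -/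
open MeasureTheory Real Set

lemma aux_gamma {a r : ℝ} (ha : 0 < a) (hr : 0 < r) :
    ∫⁻ t in Ioi (0:ℝ), ENNReal.ofReal (t ^ (a - 1) * exp (-(r * t))) =
      ENNReal.ofReal ((1 / r) ^ a * Real.Gamma a) := by
  rw [← Real.integral_rpow_mul_exp_neg_mul_Ioi ha hr, ofReal_integral_eq_lintegral_ofReal]
  · by_contra h
    have h2 := Real.integral_rpow_mul_exp_neg_mul_Ioi ha hr
    rw [integral_undef] at h2
    · have := Real.Gamma_pos_of_pos ha
      have : 0 < (1 / r) ^ a * Real.Gamma a := by positivity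
      linarith
    · exact h
  · filter_upwards [ae_restrict_mem measurableSet_Ioi] with t ht
    have : 0 < t := ht
    simp only [Pi.zero_apply]
    positivity

lemma aux_beta {a b B D : ℝ} (ha : 0 < a) (hb : 0 < b) (hB : 0 < B) (hD : 0 < D) :
    ∫⁻ s in Ioi (0:ℝ), ENNReal.ofReal (s ^ (a - 1) * (D + B * s) ^ (-(a + b))) =
      ENNReal.ofReal (B ^ (-a) * D ^ (-b) * (Real.Gamma a * Real.Gamma b / Real.Gamma (a + b))) := by
  have hGa := Real.Gamma_pos_of_pos ha
  have hGb := Real.Gamma_pos_of_pos hb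
  have hG := Real.Gamma_pos_of_pos (add_pos ha hb)
  have key : ∫⁻ s in Ioi (0:ℝ), ENNReal.ofReal (Real.Gamma (a + b)) *
      ENNReal.ofReal (s ^ (a - 1) * (D + B * s) ^ (-(a + b))) =
      ENNReal.ofReal (B ^ (-a) * D ^ (-b) * (Real.Gamma a * Real.Gamma b)) := by
    calc _ = ∫⁻ s in Ioi (0:ℝ), ∫⁻ t in Ioi (0:ℝ),
          ENNReal.ofReal (s ^ (a - 1) * (t ^ (a + b - 1) * exp (-((D + B * s) * t)))) := by
          refine setLIntegral_congr_fun measurableSet_Ioi fun s hs => ?_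
          have hs : 0 < s := hs
          have hp : 0 < D + B * s := by positivity
          have h1 : 0 ≤ s ^ (a - 1) := by positivity
          simp only [ENNReal.ofReal_mul h1]
          rw [lintegral_const_mul _ (by fun_prop), ← ENNReal.ofReal_mul h1, ← ENNReal.ofReal_mul hG.le,
            aux_gamma (add_pos ha hb) hp, ← ENNReal.ofReal_mul h1, one_div,
            Real.inv_rpow hp.le, Real.rpow_neg hp.le]
          congr 1; ring
      _ = ∫⁻ t in Ioi (0:ℝ), ∫⁻ s in Ioi (0:ℝ),
          ENNReal.ofReal (s ^ (a - 1) * (t ^ (a + b - 1) * exp (-((D + B * s) * t)))) := by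
          apply lintegral_lintegral_swap
          fun_prop
      _ = ∫⁻ t in Ioi (0:ℝ), ENNReal.ofReal (B ^ (-a) * Real.Gamma a) *
          ENNReal.ofReal (t ^ (b - 1) * exp (-(D * t))) := by
          refine setLIntegral_congr_fun measurableSet_Ioi fun t ht => ?_
          have ht : 0 < t := ht
          have h1 : 0 ≤ t ^ (a + b - 1) * exp (-(D * t)) := by positivity
          have : ∀ s, s ^ (a - 1) * (t ^ (a + b - 1) * exp (-((D + B * s) * t))) =
              (t ^ (a + b - 1) * exp (-(D * t))) * (s ^ (a - 1) * exp (-((B * t) * s))) := by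
            intro s
            rw [show -((D + B * s) * t) = -(D * t) + -((B * t) * s) by ring, Real.exp_add]; ring
          simp only [this, ENNReal.ofReal_mul h1]
          rw [lintegral_const_mul _ (by fun_prop), aux_gamma ha (by positivity),
            ← ENNReal.ofReal_mul h1, ← ENNReal.ofReal_mul (by positivity), one_div,
            Real.inv_rpow (by positivity), Real.mul_rpow hB.le ht.le, Real.rpow_neg hB.le,
            show a + b - 1 = a + (b - 1) by ring, Real.rpow_add ht]
          congr 1
          have := Real.rpow_pos_of_pos ht a
          field_simp
      _ = _ := by
          rw [lintegral_const_mul _ (by fun_prop), aux_gamma hb hD, ← ENNReal.ofReal_mul (by positivity),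
            one_div, Real.inv_rpow hD.le, Real.rpow_neg hD.le]
          congr 1; ring
  rw [lintegral_const_mul _ (by fun_prop)] at key
  have h0 : ENNReal.ofReal (Real.Gamma (a + b)) ≠ 0 := by simpa using hG
  rw [← ENNReal.mul_right_inj h0 ENNReal.ofReal_ne_top, key, ← ENNReal.ofReal_mul hG.le]
  congr 1
  field_simp

lemma aux_half {a b A B : ℝ} (ha : 0 < a) (hb : 0 < b) (hB : 0 < B) (hAB : B < A) :
    ∫⁻ u in Ioo (-1:ℝ) 1, ENNReal.ofReal ((1 - u) ^ (a - 1) * (A - B * u) ^ (-(a + b))) ≤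
      ENNReal.ofReal (B ^ (-a) * (A - B) ^ (-b) *
        (Real.Gamma a * Real.Gamma b / Real.Gamma (a + b))) := by
  rw [← aux_beta ha hb hB (sub_pos.2 hAB), ← lintegral_indicator measurableSet_Ioo,
    ← lintegral_indicator measurableSet_Ioi, ← lintegral_sub_left_eq_self _ (1:ℝ)]
  refine lintegral_mono fun u => ?_
  by_cases h : 1 - u ∈ Ioo (-1:ℝ) 1
  · have h' : u ∈ Ioi (0:ℝ) := by
      have := h.2; simp only [mem_Ioi]; linarith
    rw [indicator_of_mem h, indicator_of_mem h']
    apply le_of_eq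
    congr 3 <;> ring
  · rw [indicator_of_notMem h]; simp

lemma aux_neg (f : ℝ → ENNReal) :
    ∫⁻ u in Ioo (-1:ℝ) 1, f (-u) = ∫⁻ u in Ioo (-1:ℝ) 1, f u := by
  rw [← lintegral_indicator measurableSet_Ioo, ← lintegral_indicator measurableSet_Ioo,
    ← lintegral_neg_eq_self]
  congr 1; ext u
  simp only [indicator, mem_Ioo, neg_neg]
  congr 1
  apply propext; constructor <;> rintro ⟨h1, h2⟩ <;> constructor <;> linarith

lemma aux_rearr {a q A B : ℝ} (ha : a ≤ 1) (hq : 0 < q) (hB : 0 < B) (hAB : B < A) :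
    ∫⁻ u in Ioo (-1:ℝ) 1, ENNReal.ofReal ((1 + u) ^ (a - 1) * (A - B * u) ^ (-q)) ≤
    ∫⁻ u in Ioo (-1:ℝ) 1, ENNReal.ofReal ((1 - u) ^ (a - 1) * (A - B * u) ^ (-q)) := by
  have e1 := aux_neg fun u => ENNReal.ofReal ((1 + u) ^ (a - 1) * (A - B * u) ^ (-q))
  have e2 := aux_neg fun u => ENNReal.ofReal ((1 - u) ^ (a - 1) * (A - B * u) ^ (-q))
  have h2 : (2:ENNReal) ≠ 0 := by norm_num
  rw [← ENNReal.mul_le_mul_iff_right h2 (by norm_num), two_mul, two_mul]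
  nth_rewrite 1 [← e1]
  nth_rewrite 1 [← e2]
  rw [← lintegral_add_left (by fun_prop), ← lintegral_add_left (by fun_prop)]
  refine setLIntegral_mono (by fun_prop) fun u hu => ?_
  obtain ⟨h1, h2⟩ := hu
  have p1 : 0 < 1 - u := by linarith
  have p2 : 0 < 1 + u := by linarith
  have p3 : 0 < A - B * u := by nlinarith
  have p4 : 0 < A + B * u := by nlinarith
  simp only [mul_neg, sub_neg_eq_add, ← sub_eq_add_neg]
  rw [← ENNReal.ofReal_add (by positivity) (by positivity),
    ← ENNReal.ofReal_add (by positivity) (by positivity)]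
  apply ENNReal.ofReal_le_ofReal
  rcases le_total 0 u with hu | hu
  · have w : (1 + u) ^ (a - 1) ≤ (1 - u) ^ (a - 1) :=
      Real.rpow_le_rpow_of_nonpos p1 (by linarith) (by linarith)
    have g : (A + B * u) ^ (-q) ≤ (A - B * u) ^ (-q) :=
      Real.rpow_le_rpow_of_nonpos p3 (by nlinarith) (by linarith)
    nlinarith [mul_nonneg (sub_nonneg.2 w) (sub_nonneg.2 g)]
  · have w : (1 - u) ^ (a - 1) ≤ (1 + u) ^ (a - 1) :=
      Real.rpow_le_rpow_of_nonpos p2 (by linarith) (by linarith)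
    have g : (A - B * u) ^ (-q) ≤ (A + B * u) ^ (-q) :=
      Real.rpow_le_rpow_of_nonpos p4 (by nlinarith) (by linarith)
    nlinarith [mul_nonneg (sub_nonneg.2 w) (sub_nonneg.2 g)]

lemma aux_weight {a u : ℝ} (ha0 : 0 < a) (ha : a ≤ 1) (h1 : -1 < u) (h2 : u < 1) :
    (1 - u ^ 2) ^ (a - 1) ≤ 2 ^ (a - 1) * ((1 - u) ^ (a - 1) + (1 + u) ^ (a - 1)) := by
  have p1 : 0 < 1 - u := by linarith
  have p2 : 0 < 1 + u := by linarith
  have h := Real.rpow_add_le_add_rpow p1.le p2.le (sub_nonneg.2 ha) (by linarith : 1 - a ≤ 1)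
  rw [show 1 - u + (1 + u) = 2 by ring] at h
  rw [show 1 - u ^ 2 = (1 - u) * (1 + u) by ring, Real.mul_rpow p1.le p2.le,
    show a - 1 = -(1 - a) by ring, Real.rpow_neg p1.le, Real.rpow_neg p2.le,
    Real.rpow_neg (by norm_num)]
  have x := Real.rpow_pos_of_pos p1 (1 - a)
  have y := Real.rpow_pos_of_pos p2 (1 - a)
  have z := Real.rpow_pos_of_pos (by norm_num : (0:ℝ) < 2) (1 - a)
  field_simp
  linarith

lemma aux_main {a b A B : ℝ} (ha : 0 < a) (hb : 0 < b) (hB : 0 < B) (hAB : B < A) :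
    ∫⁻ u in Ioo (-1:ℝ) 1, ENNReal.ofReal ((1 - u ^ 2) ^ (a - 1) * (A - B * u) ^ (-(a + b))) ≤
      ENNReal.ofReal (2 ^ a * (B ^ (-a) * (A - B) ^ (-b) *
        (Real.Gamma a * Real.Gamma b / Real.Gamma (a + b)))) := by
  have hh := aux_half ha hb hB hAB
  have h2a : (2:ℝ) ^ a = 2 * 2 ^ (a - 1) := by
    rw [Real.rpow_sub_one (by norm_num)]; ring
  have z := Real.rpow_pos_of_pos (by norm_num : (0:ℝ) < 2) (a - 1)
  have step : ∫⁻ u in Ioo (-1:ℝ) 1,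
      ENNReal.ofReal ((1 - u ^ 2) ^ (a - 1) * (A - B * u) ^ (-(a + b))) ≤
      ENNReal.ofReal (2 ^ a) * ∫⁻ u in Ioo (-1:ℝ) 1,
        ENNReal.ofReal ((1 - u) ^ (a - 1) * (A - B * u) ^ (-(a + b))) := by
    rcases le_total a 1 with h | h
    · have hr := aux_rearr h (add_pos ha hb) hB hAB
      rw [h2a, mul_comm (2:ℝ), ENNReal.ofReal_mul z.le, mul_assoc, ENNReal.ofReal_ofNat, two_mul]
      refine le_trans ?_ (mul_le_mul_right (add_le_add_right hr _) _)
      rw [← lintegral_add_left (by fun_prop), ← lintegral_const_mul _ (by fun_prop)]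
      refine setLIntegral_mono (by fun_prop) fun u hu => ?_
      obtain ⟨h1, h2⟩ := hu
      have p1 : 0 < 1 - u := by linarith
      have p2 : 0 < 1 + u := by linarith
      have p3 : 0 < A - B * u := by nlinarith
      rw [← ENNReal.ofReal_add (by positivity) (by positivity), ← ENNReal.ofReal_mul z.le]
      apply ENNReal.ofReal_le_ofReal
      rw [← add_mul, ← mul_assoc]
      exact mul_le_mul_of_nonneg_right (aux_weight ha h h1 h2) (by positivity)
    · rw [← lintegral_const_mul _ (by fun_prop)]
      refine setLIntegral_mono (by fun_prop) fun u hu => ?_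
      obtain ⟨h1, h2⟩ := hu
      have p1 : 0 < 1 - u := by linarith
      have p2 : 0 < 1 + u := by linarith
      have p3 : 0 < A - B * u := by nlinarith
      rw [← ENNReal.ofReal_mul (by positivity)]
      apply ENNReal.ofReal_le_ofReal
      rw [← mul_assoc]
      refine mul_le_mul_of_nonneg_right ?_ (by positivity)
      calc (1 - u ^ 2) ^ (a - 1) = (1 + u) ^ (a - 1) * (1 - u) ^ (a - 1) := by
            rw [← Real.mul_rpow p2.le p1.le]; congr 1; ring
        _ ≤ 2 ^ (a - 1) * (1 - u) ^ (a - 1) := by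
            gcongr <;> linarith
        _ ≤ 2 ^ a * (1 - u) ^ (a - 1) := by
            refine mul_le_mul_of_nonneg_right ?_ (by positivity)
            linarith
  rw [ENNReal.ofReal_mul (by positivity)]
  exact step.trans (by gcongr)

theorem lintegral_jacobiPiMeasure_le (γ lam A B : ℝ) (hγ : -(1/2) ≤ γ)
    (hlam : -(1/2) < lam) (hB : 0 < B) (hAB : B < A) :
    ∫⁻ u, ENNReal.ofReal ((A - B * u) ^ (-(γ + lam + 1))) ∂(jacobiPiMeasure γ) ≤
      ENNReal.ofReal ((2:ℝ) ^ (γ + 1/2) * Real.Gamma (γ + 1) * Real.Gamma (lam + 1/2) /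
        (Real.sqrt π * Real.Gamma (γ + lam + 1)) *
        (B ^ (-(γ + 1/2)) * (A - B) ^ (-(lam + 1/2)))) := by
  have hb : 0 < lam + 1/2 := by linarith
  have hGb := Real.Gamma_pos_of_pos hb
  have hD : 0 < A - B := sub_pos.2 hAB
  have hpi : 0 < Real.sqrt π := Real.sqrt_pos.2 Real.pi_pos
  by_cases hg : γ = -(1/2)
  · subst hg
    rw [jacobiPiMeasure, if_pos rfl, lintegral_smul_measure, lintegral_add_measure,
      lintegral_dirac, lintegral_dirac]
    have e1 : (2:ℝ) ^ (-(1/2) + 1/2 : ℝ) * Real.Gamma (-(1/2) + 1) * Real.Gamma (lam + 1/2) /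
        (Real.sqrt π * Real.Gamma (-(1/2) + lam + 1)) *
        (B ^ (-(-(1/2) + 1/2 : ℝ)) * (A - B) ^ (-(lam + 1/2))) = (A - B) ^ (-(lam + 1/2)) := by
      rw [show (-(1/2) + 1/2 : ℝ) = 0 by norm_num, show (-(1/2) + 1 : ℝ) = 1/2 by norm_num,
        show (-(1/2) + lam + 1 : ℝ) = lam + 1/2 by ring, Real.Gamma_one_half_eq]
      simp only [neg_zero, Real.rpow_zero]
      generalize Real.Gamma (lam + 1/2) = G at hGb ⊢
      field_simp
    rw [e1, show (-(1/2) + lam + 1 : ℝ) = lam + 1/2 by ring]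
    have l1 : ENNReal.ofReal ((A - B * (-1)) ^ (-(lam + 1/2))) ≤
        ENNReal.ofReal ((A - B) ^ (-(lam + 1/2))) :=
      ENNReal.ofReal_le_ofReal (Real.rpow_le_rpow_of_nonpos hD (by linarith) (by linarith))
    rw [mul_one]
    calc _ ≤ (2:ENNReal)⁻¹ • (ENNReal.ofReal ((A - B) ^ (-(lam + 1/2))) +
          ENNReal.ofReal ((A - B) ^ (-(lam + 1/2)))) := by
            rw [smul_eq_mul, smul_eq_mul]; gcongr
      _ = _ := by
        rw [← two_mul, smul_eq_mul, ← mul_assoc, ENNReal.inv_mul_cancel (by norm_num) (by norm_num),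
          one_mul]
  · have ha : 0 < γ + 1/2 := by
      have := lt_of_le_of_ne hγ (Ne.symm hg); linarith
    have hGa := Real.Gamma_pos_of_pos ha
    have hG1 := Real.Gamma_pos_of_pos (show 0 < γ + 1 by linarith)
    have hGq := Real.Gamma_pos_of_pos (show 0 < γ + lam + 1 by linarith)
    have hC : 0 ≤ Real.Gamma (γ + 1) / (Real.sqrt π * Real.Gamma (γ + 1/2)) := by positivity
    rw [jacobiPiMeasure, if_neg hg, lintegral_withDensity_eq_lintegral_mul _ (by fun_prop)
      (by fun_prop), restrict_Ioo_eq_restrict_Icc.symm]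
    have hm := aux_main ha hb hB hAB
    calc _ = ∫⁻ u in Ioo (-1:ℝ) 1,
          ENNReal.ofReal (Real.Gamma (γ + 1) / (Real.sqrt π * Real.Gamma (γ + 1/2))) *
          ENNReal.ofReal ((1 - u ^ 2) ^ (γ + 1/2 - 1) *
            (A - B * u) ^ (-(γ + 1/2 + (lam + 1/2)))) := by
          refine setLIntegral_congr_fun measurableSet_Ioo fun u hu => ?_
          obtain ⟨h1, h2⟩ := hu
          have p : 0 < 1 - u ^ 2 := by nlinarith
          simp only [Pi.mul_apply]
          rw [← ENNReal.ofReal_mul (by positivity), ← ENNReal.ofReal_mul hC, mul_assoc,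
            show γ + 1/2 - 1 = γ - 1/2 by ring, show γ + 1/2 + (lam + 1/2) = γ + lam + 1 by ring]
      _ ≤ _ := by
          rw [lintegral_const_mul _ (by fun_prop)]
          refine (mul_le_mul_right hm _).trans ?_
          rw [← ENNReal.ofReal_mul hC]
          apply ENNReal.ofReal_le_ofReal
          rw [show γ + 1/2 + (lam + 1/2) = γ + lam + 1 by ring]
          apply le_of_eq
          clear hm hC
          generalize Real.Gamma (lam + 1/2) = G at hGb ⊢
          generalize Real.Gamma (γ + 1/2) = G' at hGa ⊢
          field_simp
end

section
/- Let γ > −1/2 and A > B > 0. Then ∫_{−1}^{1} (A − Bu)^{−(γ+1/2)} dΠ_γ(u) ≤ (2^{γ+1/2} Γ(γ+1) / (√π · Γ(γ+1/2))) · B^{−(γ+1/2)} · ( 1/(γ+1/2) + log(A/(A−B)) ). -/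
open MeasureTheory Real Set

lemma aux_bound (s A B u : ℝ) (hs : 0 < s) (hB : 0 < B) (hAB : B < A) (h1 : -1 < u) (h2 : u < 1) :
    (1 - u ^ 2) ^ (s - 1) * (A - B * u) ^ (-s) ≤
      B ^ (-s) * (1/2 * ((2:ℝ) ^ s * ((B * (1 - u) / (A - B * u)) ^ (s - 1) *
        (B * (A - B) / (A - B * u) ^ 2) + B / (A - B * u)) + (1 + u) ^ (s - 1))) := by
  have hm : 0 < 1 - u := by linarith
  have hp : 0 < 1 + u := by linarith
  have hw : 0 < B * (1 - u) := by positivity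
  have hD : 0 < A - B := by linarith
  have hW : 0 < A - B * u := by nlinarith
  have hq : 0 < B * (1 - u) / (A - B * u) := by positivity
  have hq1 : B * (1 - u) / (A - B * u) ≤ 1 := by
    rw [div_le_one hW]; linarith
  set q := B * (1 - u) / (A - B * u) with hqdef
  have hqs : q ^ s ≤ 1 := Real.rpow_le_one hq.le hq1 hs.le
  have hqs0 : 0 < q ^ s := Real.rpow_pos_of_pos hq s
  have hps : (1 + u) ^ s ≤ 2 ^ s := Real.rpow_le_rpow hp.le (by linarith) hs.le
  have hps0 : 0 < (1 + u) ^ s := Real.rpow_pos_of_pos hp s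
  have e1 : (1 - u ^ 2) ^ (s - 1) * (A - B * u) ^ (-s) =
      B ^ (-s) * (1/2 * ((1 + u) ^ s * (q ^ s / (1 - u)) + (1 + u) ^ s / (1 + u) * q ^ s)) := by
    rw [show 1 - u ^ 2 = (1 + u) * (1 - u) by ring, Real.rpow_sub_one (by positivity),
      Real.mul_rpow hp.le hm.le, hqdef, Real.div_rpow hw.le hW.le, Real.mul_rpow hB.le hm.le,
      Real.rpow_neg hB.le, Real.rpow_neg hW.le]
    have := (Real.rpow_pos_of_pos hB s).ne'
    have := (Real.rpow_pos_of_pos hW s).ne'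
    field_simp
    ring
  have e2 : q ^ s / (1 - u) = q ^ (s - 1) * (B * (A - B) / (A - B * u) ^ 2)
      + q ^ s * (B / (A - B * u)) := by
    rw [Real.rpow_sub_one hq.ne']
    have : q ^ s / q = q ^ s * ((A - B * u) / (B * (1 - u))) := by
      rw [div_eq_mul_inv, hqdef, inv_div]
    rw [this, show A - B = (A - B * u) - B * (1 - u) by ring]
    generalize A - B * u = W at hW ⊢
    field_simp
    ring
  have e3 : q ^ s / (1 - u) ≤ q ^ (s - 1) * (B * (A - B) / (A - B * u) ^ 2)
      + B / (A - B * u) := by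
    rw [e2]
    have : 0 < B / (A - B * u) := by positivity
    nlinarith
  rw [e1, ← Real.rpow_sub_one hp.ne']
  have : 0 < q ^ s / (1 - u) := by positivity
  have h3 : (1 + u) ^ (s - 1) * q ^ s ≤ (1 + u) ^ (s - 1) :=
    mul_le_of_le_one_right (by positivity) hqs
  have h4 := mul_le_mul hps e3 this.le (by positivity)
  gcongr

noncomputable def auxF (s A B u : ℝ) : ℝ :=
  1/2 * ((2:ℝ) ^ s * (- ((B * (1 - u) / (A - B * u)) ^ s / s) - Real.log (A - B * u))
    + (1 + u) ^ s / s)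

lemma auxF_deriv (s A B u : ℝ) (hs : 0 < s) (hB : 0 < B) (hAB : B < A) (h1 : -1 < u)
    (h2 : u < 1) :
    HasDerivAt (auxF s A B) (1/2 * ((2:ℝ) ^ s * ((B * (1 - u) / (A - B * u)) ^ (s - 1) *
        (B * (A - B) / (A - B * u) ^ 2) + B / (A - B * u)) + (1 + u) ^ (s - 1))) u := by
  have hm : 0 < 1 - u := by linarith
  have hp : 0 < 1 + u := by linarith
  have hW : 0 < A - B * u := by nlinarith
  have hq : 0 < B * (1 - u) / (A - B * u) := by positivity
  have dW : HasDerivAt (fun u => A - B * u) (-(B * 1)) u :=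
    ((hasDerivAt_id u).const_mul B).const_sub A
  have dw : HasDerivAt (fun u => B * (1 - u)) (B * (-1)) u :=
    ((hasDerivAt_id u).const_sub 1).const_mul B
  have dp : HasDerivAt (fun u : ℝ => 1 + u) 1 u := (hasDerivAt_id u).const_add 1
  have dq := ((dw.div dW hW.ne').rpow_const (p := s) (Or.inl hq.ne')).div_const s
  have dl := dW.log hW.ne'
  have := (((dq.neg.sub dl).const_mul ((2:ℝ) ^ s)).add
    ((dp.rpow_const (p := s) (Or.inl hp.ne')).div_const s)).const_mul (1/2)
  refine HasDerivAt.congr_deriv (f := auxF s A B) this ?_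
  simp only [Pi.div_apply]
  field_simp
  ring

lemma auxF_cont (s A B : ℝ) (hs : 0 < s) (hB : 0 < B) (hAB : B < A) :
    ContinuousOn (auxF s A B) (Icc (-1) 1) := by
  have hW : ∀ u ∈ Icc (-1:ℝ) 1, A - B * u ≠ 0 := by
    intro u hu
    have := hu.2
    have : 0 < A - B * u := by nlinarith
    exact this.ne'
  unfold auxF
  refine continuousOn_const.mul ((continuousOn_const.mul (ContinuousOn.sub (ContinuousOn.neg
    (ContinuousOn.div_const (ContinuousOn.rpow_const (ContinuousOn.div (by fun_prop)
      (by fun_prop) hW) (fun _ _ => Or.inr hs.le)) s)) (ContinuousOn.log (by fun_prop) hW))).add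
    (ContinuousOn.div_const (ContinuousOn.rpow_const (by fun_prop) (fun _ _ => Or.inr hs.le)) s))

lemma auxF_diff (s A B : ℝ) (hs : 0 < s) (hB : 0 < B) (hAB : B < A) :
    auxF s A B 1 - auxF s A B (-1) ≤ 2 ^ s * (1 / s + Real.log (A / (A - B))) := by
  have hD : 0 < A - B := by linarith
  have hS : 0 < A + B := by linarith
  have hA : 0 < A := by linarith
  have hq : (B * (1 - (-1)) / (A - B * (-1))) ^ s ≤ 1 := by
    apply Real.rpow_le_one (by apply div_nonneg <;> nlinarith) _ hs.le
    rw [div_le_one (by linarith)]; linarith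
  have hl : Real.log (A + B) + Real.log (A - B) ≤ 2 * Real.log A := by
    rw [← Real.log_mul hS.ne' hD.ne', two_mul, ← Real.log_mul hA.ne' hA.ne']
    apply Real.log_le_log (by positivity)
    nlinarith
  have h2 : (0:ℝ) < 2 ^ s := by positivity
  have hqs := div_le_div_of_nonneg_right hq hs.le
  rw [Real.log_div hA.ne' hD.ne']
  unfold auxF
  rw [show (1:ℝ) + 1 = 2 by norm_num, show (1:ℝ) - 1 = 0 by norm_num,
    show (1:ℝ) + -1 = 0 by norm_num, mul_zero, zero_div, Real.zero_rpow hs.ne', mul_one,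
    show A - B * (-1) = A + B by ring] at *
  generalize (B * (1 - (-1)) / (A + B)) ^ s / s = x at *
  have e : (2:ℝ) ^ s / s = 2 ^ s * (1 / s) := by ring
  rw [e]
  generalize 1 / s = y at *
  have := mul_nonneg h2.le (add_nonneg (sub_nonneg.2 hqs) (sub_nonneg.2 hl))
  rw [zero_div]
  nlinarith

/-- For `γ > -1/2` and `A > B > 0`,
`∫_{-1}^1 (A-Bu)^{-(γ+1/2)} dΠ_γ(u)
  ≤ (2^{γ+1/2} Γ(γ+1)/(√π Γ(γ+1/2))) B^{-(γ+1/2)} (1/(γ+1/2) + log(A/(A-B)))`. -/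
theorem lintegral_jacobiPiMeasure_log_le (γ A B : ℝ) (hγ : -(1/2) < γ)
    (hB : 0 < B) (hAB : B < A) :
    ∫⁻ u, ENNReal.ofReal ((A - B * u) ^ (-(γ + 1/2))) ∂(jacobiPiMeasure γ) ≤
      ENNReal.ofReal ((2:ℝ) ^ (γ + 1/2) * Real.Gamma (γ + 1) /
        (Real.sqrt π * Real.Gamma (γ + 1/2)) * (B ^ (-(γ + 1/2)) *
          (1/(γ + 1/2) + Real.log (A / (A - B))))) := by
  obtain ⟨s, rfl⟩ : ∃ s, γ = s - 1/2 := ⟨γ + 1/2, by ring⟩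
  have hs : 0 < s := by linarith
  have hne : ¬ (s - 1/2 = -(1/2)) := by intro h; linarith
  rw [jacobiPiMeasure, if_neg hne]
  rw [show s - 1/2 + 1/2 = s by ring, show s - 1/2 - 1/2 = s - 1 by ring]
  have hG1 : 0 < Real.Gamma (s - 1/2 + 1) := Real.Gamma_pos_of_pos (by linarith)
  have hG2 : 0 < Real.Gamma s := Real.Gamma_pos_of_pos hs
  have hC : 0 < Real.Gamma (s - 1/2 + 1) / (√π * Real.Gamma s) := by positivity
  rw [show (2:ℝ) ^ s * Real.Gamma (s - 1/2 + 1) / (√π * Real.Gamma s) *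
      (B ^ (-s) * (1/s + Real.log (A / (A - B)))) =
      Real.Gamma (s - 1/2 + 1) / (√π * Real.Gamma s) *
      (B ^ (-s) * (2 ^ s * (1/s + Real.log (A / (A - B))))) by ring]
  generalize Real.Gamma (s - 1/2 + 1) / (√π * Real.Gamma s) = C at *
  rw [lintegral_withDensity_eq_lintegral_mul _ (by fun_prop) (by fun_prop)]
  set G : ℝ → ℝ := fun u => 1/2 * ((2:ℝ) ^ s * ((B * (1 - u) / (A - B * u)) ^ (s - 1) *
        (B * (A - B) / (A - B * u) ^ 2) + B / (A - B * u)) + (1 + u) ^ (s - 1)) with hG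
  have hGd : ∀ u ∈ Ioo (-1:ℝ) 1, HasDerivAt (auxF s A B) (G u) u :=
    fun u hu => auxF_deriv s A B u hs hB hAB hu.1 hu.2
  have hG0 : ∀ u ∈ Ioo (-1:ℝ) 1, 0 ≤ G u := by
    intro u hu
    have h1 := hu.1
    have h2 := hu.2
    have hm : 0 < 1 - u := by linarith
    have hp : 0 < 1 + u := by linarith
    have hD : 0 < A - B := by linarith
    have hW : 0 < A - B * u := by nlinarith
    simp only [hG]
    positivity
  have hcont := auxF_cont s A B hs hB hAB
  have hint : IntegrableOn G (Ioc (-1) 1) :=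
    intervalIntegral.integrableOn_deriv_of_nonneg hcont hGd hG0
  have hval : ∫ u in (-1:ℝ)..1, G u = auxF s A B 1 - auxF s A B (-1) :=
    intervalIntegral.integral_eq_sub_of_hasDerivAt_of_le (by norm_num) hcont hGd
      ((intervalIntegrable_iff_integrableOn_Ioc_of_le (by norm_num)).2 hint)
  rw [intervalIntegral.integral_of_le (by norm_num), integral_Ioc_eq_integral_Ioo] at hval
  have hint' : IntegrableOn G (Ioo (-1) 1) := hint.mono_set Ioo_subset_Ioc_self
  have hB' : 0 < B ^ (-s) := Real.rpow_pos_of_pos hB _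
  rw [← restrict_Ioo_eq_restrict_Icc]
  calc _ ≤ ∫⁻ u in Ioo (-1:ℝ) 1, ENNReal.ofReal (C * (B ^ (-s) * G u)) := by
        refine setLIntegral_mono_ae' measurableSet_Ioo (Filter.Eventually.of_forall ?_)
        intro u hu
        have h1 := hu.1
        have h2 := hu.2
        have hq : 0 ≤ (1 - u ^ 2) ^ (s - 1) := Real.rpow_nonneg (by nlinarith) _
        simp only [Pi.mul_apply]
        rw [← ENNReal.ofReal_mul (by positivity), mul_assoc]
        exact ENNReal.ofReal_le_ofReal (mul_le_mul_of_nonneg_left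
          (aux_bound s A B u hs hB hAB h1 h2) hC.le)
    _ = ENNReal.ofReal (∫ u in Ioo (-1:ℝ) 1, C * (B ^ (-s) * G u)) := by
        refine (ofReal_integral_eq_lintegral_ofReal ((hint'.const_mul _).const_mul _) ?_).symm
        refine (ae_restrict_iff' measurableSet_Ioo).2 (Filter.Eventually.of_forall ?_)
        intro u hu
        have := hG0 u hu
        show 0 ≤ C * (B ^ (-s) * G u)
        positivity
    _ ≤ _ := by
        rw [integral_const_mul, integral_const_mul, hval]
        have := auxF_diff s A B hs hB hAB
        exact ENNReal.ofReal_le_ofReal (by gcongr)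
end
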